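/- Let 𝒰 ⊆ H₂ be an open interval, i.e. one of the following: 𝒰 = (A,B) for some A, B ∈ H₂ with A < B; 𝒰 = {X ∈ H₂ : A < X} for some A ∈ H₂; 𝒰 = {X ∈ H₂ : X < A} for some A ∈ H₂; or 𝒰 = H₂. Let φ : 𝒰 → U₂ satisfy rank(X − Y) ≤ 1 ⟹ rank(φ(X) − φ(Y)) ≤ 1 for all X, Y ∈ 𝒰. Then either φ is standard (there exists an automorphism Φ of U₂ with φ(X) = Φ(𝔠(X)) for all X ∈ 𝒰), or φ is degenerate: either there exist A₀ ∈ 𝒰 and B₀ ∈ φ(𝒰) such that rank(φ(X) − B₀) ≤ 1 for every X ∈ 𝒰 with X ≠ A₀, or there exist lines ℓ, ℓ' in U₂ such that φ(X) ∈ ℓ' for every X ∈ 𝒰 with 𝔠(X) ∉ ℓ. -/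

import Mathlib

open Matrix
open scoped ComplexOrder

noncomputable section

/-- The space of `2×2` complex matrices. -/
abbrev Mat2 : Type := Matrix (Fin 2) (Fin 2) ℂ

/-- The group of `2×2` complex unitary matrices. -/
abbrev U2 : Type := Matrix.unitaryGroup (Fin 2) ℂ

/-- Coherency for matrices: `A ∼ B` iff `rank (A − B) ≤ 1`. -/
def Coherent (A B : Mat2) : Prop := (A - B).rank ≤ 1

/-- Coherency for unitaries: `U ∼ V` iff `rank (U − V) ≤ 1`. -/
def CoherentU (U V : U2) : Prop := ((U : Mat2) - (V : Mat2)).rank ≤ 1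

/-- The Cayley transform, as a matrix: `𝔠(A) = (A − iI)(A + iI)⁻¹`. -/
def cayleyMat (A : Mat2) : Mat2 :=
  (A - Complex.I • (1 : Mat2)) * (A + Complex.I • (1 : Mat2))⁻¹

open Classical in
/-- The Cayley transform, landing in the unitary group.  For every hermitian `A` the matrix
`cayleyMat A` is unitary, so the junk value `1` is never used for the matrices considered here. -/
def cayley (A : Mat2) : U2 :=
  if h : cayleyMat A ∈ Matrix.unitaryGroup (Fin 2) ℂ then ⟨cayleyMat A, h⟩ else 1

/-- An automorphism of `U₂`: a bijection preserving coherency in both directions. -/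
def IsAut (Φ : U2 → U2) : Prop :=
  Function.Bijective Φ ∧ ∀ U V : U2, CoherentU U V ↔ CoherentU (Φ U) (Φ V)

/-- A line in `U₂`: a maximal subset all of whose elements are pairwise coherent. -/
def IsLine (ℓ : Set U2) : Prop :=
  (∀ U ∈ ℓ, ∀ V ∈ ℓ, CoherentU U V) ∧
  ∀ m : Set U2, ℓ ⊆ m → (∀ U ∈ m, ∀ V ∈ m, CoherentU U V) → m = ℓ

/-- The matrix interval `[A, B] = {X : A ≤ X ≤ B}` (in the Loewner order). -/
def matIcc (A B : Mat2) : Set Mat2 := {X | (X - A).PosSemidef ∧ (B - X).PosSemidef}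

/-- Rank one projections: `P = P* = P²` of rank one. -/
def IsProj1 (P : Mat2) : Prop := P.IsHermitian ∧ P * P = P ∧ P.rank = 1

/-- The set of `2×2` complex hermitian matrices. -/
def H2set : Set Mat2 := {A | A.IsHermitian}

namespace Coherency

/-- Minkowski space: `X` stands for the hermitian matrix with diagonal `X 0`, `X 3` and upper
right entry `X 1 + i X 2`. -/
abbrev Mink : Type := Fin 4 → ℝ

/-- The determinant of a hermitian matrix. -/
def mq (X : Mink) : ℝ := X 0 * X 3 - X 1 ^ 2 - X 2 ^ 2

/-- The bilinear form polar to the determinant. -/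
def mb (X Y : Mink) : ℝ := X 0 * Y 3 + X 3 * Y 0 - 2 * X 1 * Y 1 - 2 * X 2 * Y 2

theorem mb_comm (X Y : Mink) : mb X Y = mb Y X := by simp only [mb]; ring
theorem mb_self (X : Mink) : mb X X = 2 * mq X := by simp only [mb, mq]; ring
theorem mq_add (X Y : Mink) : mq (X + Y) = mq X + mq Y + mb X Y := by
  simp only [mb, mq, Pi.add_apply]; ring
theorem mq_sub (X Y : Mink) : mq (X - Y) = mq X + mq Y - mb X Y := by
  simp only [mb, mq, Pi.sub_apply]; ring
theorem mq_neg (X : Mink) : mq (-X) = mq X := by simp only [mq, Pi.neg_apply]; ring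
theorem mq_smul (t : ℝ) (X : Mink) : mq (t • X) = t ^ 2 * mq X := by
  simp only [mq, Pi.smul_apply, smul_eq_mul]; ring
theorem mb_add_left (X Y Z : Mink) : mb (X + Y) Z = mb X Z + mb Y Z := by
  simp only [mb, Pi.add_apply]; ring
theorem mb_add_right (X Y Z : Mink) : mb X (Y + Z) = mb X Y + mb X Z := by
  simp only [mb, Pi.add_apply]; ring
theorem mb_sub_left (X Y Z : Mink) : mb (X - Y) Z = mb X Z - mb Y Z := by
  simp only [mb, Pi.sub_apply]; ring
theorem mb_sub_right (X Y Z : Mink) : mb X (Y - Z) = mb X Y - mb X Z := by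
  simp only [mb, Pi.sub_apply]; ring
theorem mb_neg_left (X Y : Mink) : mb (-X) Y = -mb X Y := by
  simp only [mb, Pi.neg_apply]; ring
theorem mb_neg_right (X Y : Mink) : mb X (-Y) = -mb X Y := by
  simp only [mb, Pi.neg_apply]; ring
theorem mb_smul_left (t : ℝ) (X Y : Mink) : mb (t • X) Y = t * mb X Y := by
  simp only [mb, Pi.smul_apply, smul_eq_mul]; ring
theorem mb_smul_right (t : ℝ) (X Y : Mink) : mb X (t • Y) = t * mb X Y := by
  simp only [mb, Pi.smul_apply, smul_eq_mul]; ring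
theorem mq_zero : mq 0 = 0 := by simp [mq]
theorem mb_zero_left (X : Mink) : mb 0 X = 0 := by simp [mb]
theorem mb_zero_right (X : Mink) : mb X 0 = 0 := by simp [mb]
theorem mq_sub_comm (X Y : Mink) : mq (X - Y) = mq (Y - X) := by
  rw [← mq_neg, neg_sub]

theorem mink_ext {X Y : Mink} (h0 : X 0 = Y 0) (h1 : X 1 = Y 1) (h2 : X 2 = Y 2)
    (h3 : X 3 = Y 3) : X = Y := by
  funext i; fin_cases i <;> assumption

/-- The orthogonal complement of a timelike vector is negative definite. -/
theorem mq_orthogonal_nonpos {H v : Mink} (hH : 0 < mq H) (hv : mb H v = 0) :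
    mq v ≤ 0 ∧ (mq v = 0 → v = 0) := by
  have h03 : 0 < H 0 * H 3 := by
    simp only [mq] at hH; nlinarith [sq_nonneg (H 1), sq_nonneg (H 2)]
  have h0 : H 0 ≠ 0 := by rintro h; simp [h] at h03
  have h3 : H 3 ≠ 0 := by rintro h; simp [h] at h03
  simp only [mq, mb] at *
  have key : H 0 * H 3 * (v 0 * v 3 - v 1 ^ 2 - v 2 ^ 2) * 4
      = -(H 0 * v 3 - H 3 * v 0) ^ 2
        - 4 * (H 0 * H 3 - H 1 ^ 2 - H 2 ^ 2) * (v 1 ^ 2 + v 2 ^ 2)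
        - 4 * (H 1 * v 2 - H 2 * v 1) ^ 2 := by
    linear_combination (H 0 * v 3 + H 3 * v 0 + 2 * H 1 * v 1 + 2 * H 2 * v 2) * hv
  have hle : v 0 * v 3 - v 1 ^ 2 - v 2 ^ 2 ≤ 0 := by
    by_contra hcon
    push Not at hcon
    nlinarith [mul_pos h03 hcon, sq_nonneg (H 0 * v 3 - H 3 * v 0),
      mul_nonneg hH.le (add_nonneg (sq_nonneg (v 1)) (sq_nonneg (v 2))),
      sq_nonneg (H 1 * v 2 - H 2 * v 1)]
  refine ⟨hle, fun h => ?_⟩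
  rw [h] at key
  have hs : v 1 ^ 2 + v 2 ^ 2 = 0 := by
    by_contra hne
    have : 0 < v 1 ^ 2 + v 2 ^ 2 := lt_of_le_of_ne (by positivity) (Ne.symm hne)
    nlinarith [mul_pos hH this, sq_nonneg (H 0 * v 3 - H 3 * v 0),
      sq_nonneg (H 1 * v 2 - H 2 * v 1)]
  have h1 : v 1 = 0 := by nlinarith [sq_nonneg (v 1), sq_nonneg (v 2)]
  have h2 : v 2 = 0 := by nlinarith [sq_nonneg (v 1), sq_nonneg (v 2)]
  rw [h1, h2] at hv key
  have e1 : H 0 * v 3 - H 3 * v 0 = 0 := by nlinarith [sq_nonneg (H 0 * v 3 - H 3 * v 0)]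
  have e2 : H 0 * v 3 + H 3 * v 0 = 0 := by linarith
  have e3 : H 0 * v 3 = 0 := by linarith
  have e4 : H 3 * v 0 = 0 := by linarith
  exact mink_ext (by simpa [h3] using e4) (by simpa using h1) (by simpa using h2)
    (by simpa [h0] using e3)

/-- Reverse Cauchy-Schwarz: causal vectors of the same time orientation. -/
theorem mb_nonneg_of_causal {H A B : Mink} (hH : 0 < mq H) (hA : 0 ≤ mq A) (hB : 0 ≤ mq B)
    (hHA : 0 < mb H A) (hHB : 0 < mb H B) :
    0 ≤ mb A B ∧ (mb A B = 0 → mb H B • A = mb H A • B) := by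
  have horth : mb H (mb H B • A - mb H A • B) = 0 := by
    rw [mb_sub_right, mb_smul_right, mb_smul_right]; ring
  obtain ⟨h1, h2⟩ := mq_orthogonal_nonpos hH horth
  have hexp : mq (mb H B • A - mb H A • B)
      = mb H B ^ 2 * mq A + mb H A ^ 2 * mq B - mb H B * mb H A * mb A B := by
    rw [mq_sub, mq_smul, mq_smul, mb_smul_left, mb_smul_right]; ring
  have hpos := mul_pos hHB hHA
  refine ⟨?_, fun h0 => sub_eq_zero.1 (h2 ?_)⟩
  · by_contra hcon
    push Not at hcon
    nlinarith [mul_nonneg (sq_nonneg (mb H B)) hA, mul_nonneg (sq_nonneg (mb H A)) hB,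
      mul_pos hpos (neg_pos.2 hcon)]
  · apply le_antisymm h1
    rw [hexp, h0]
    nlinarith [mul_nonneg (sq_nonneg (mb H B)) hA, mul_nonneg (sq_nonneg (mb H A)) hB]

/-- Orthogonal null vectors are parallel. -/
theorem null_parallel {n m : Mink} (hn : mq n = 0) (hm : mq m = 0) (hnm : mb n m = 0)
    (hn0 : n ≠ 0) : ∃ t : ℝ, m = t • n := by
  set e : Mink := ![1, 0, 0, 1] with he
  have hq : 0 < mq e := by simp [mq, he]
  have horth : mb e (mb e n • m - mb e m • n) = 0 := by
    rw [mb_sub_right, mb_smul_right, mb_smul_right]; ring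
  have hz := (mq_orthogonal_nonpos hq horth).2 (by
    rw [mq_sub, mq_smul, mq_smul, mb_smul_left, mb_smul_right, mb_comm m n, hn, hm, hnm]; ring)
  have hen : mb e n ≠ 0 := fun h => hn0 ((mq_orthogonal_nonpos hq h).2 hn)
  refine ⟨mb e m / mb e n, ?_⟩
  have := sub_eq_zero.1 hz
  rw [div_eq_inv_mul, mul_smul, ← this, smul_smul, inv_mul_cancel₀ hen, one_smul]

/-- Two null vectors whose difference is null are parallel. -/
theorem null_parallel_of_sub {n m : Mink} (hn : mq n = 0) (hm : mq m = 0) (hnm : mq (n - m) = 0)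
    (hn0 : n ≠ 0) : ∃ t : ℝ, m = t • n :=
  null_parallel hn hm (by rw [mq_sub] at hnm; linarith) hn0

/-- Future timelike vectors: positive definite matrices. -/
def Fut (X : Mink) : Prop := 0 < X 0 ∧ 0 < mq X

/-- Future causal vectors: positive semidefinite matrices. -/
def Caus (X : Mink) : Prop := 0 ≤ X 0 ∧ 0 ≤ X 3 ∧ 0 ≤ mq X

/-- Nonzero future null vectors: positive semidefinite matrices of rank one. -/
def NullF (X : Mink) : Prop := 0 ≤ X 0 ∧ 0 ≤ X 3 ∧ mq X = 0 ∧ X ≠ 0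

theorem Fut.three_pos {X : Mink} (h : Fut X) : 0 < X 3 := by
  obtain ⟨h0, h1⟩ := h
  simp only [mq] at h1
  by_contra hcon
  push Not at hcon
  nlinarith [sq_nonneg (X 1), sq_nonneg (X 2)]

theorem Fut.caus {X : Mink} (h : Fut X) : Caus X := ⟨h.1.le, h.three_pos.le, h.2.le⟩
theorem NullF.caus {X : Mink} (h : NullF X) : Caus X := ⟨h.1, h.2.1, h.2.2.1.ge⟩
theorem Caus.zero : Caus 0 := by simp [Caus, mq]
theorem Fut.ne_zero {X : Mink} (h : Fut X) : X ≠ 0 := by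
  rintro rfl; simpa using h.1

theorem Fut.mb_pos {X Y : Mink} (hX : Fut X) (hY : Caus Y) (hY0 : Y ≠ 0) : 0 < mb X Y := by
  have h3 := hX.three_pos
  obtain ⟨h0, hq⟩ := hX
  obtain ⟨k0, k3, kq⟩ := hY
  have hs : 0 < Y 0 + Y 3 := by
    rcases (add_nonneg k0 k3).lt_or_eq with h | h
    · exact h
    · exfalso; apply hY0
      have a : Y 0 = 0 := by linarith
      have b : Y 3 = 0 := by linarith
      simp only [mq, a, b] at kq
      have h1 : Y 1 = 0 := by
        have : Y 1 ^ 2 = 0 := by nlinarith [sq_nonneg (Y 1), sq_nonneg (Y 2)]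
        exact pow_eq_zero_iff (two_ne_zero) |>.1 this
      have h2 : Y 2 = 0 := by
        have : Y 2 ^ 2 = 0 := by nlinarith [sq_nonneg (Y 1), sq_nonneg (Y 2)]
        exact pow_eq_zero_iff (two_ne_zero) |>.1 this
      exact mink_ext a h1 h2 b
  have hpos : 0 < X 0 * Y 3 + X 3 * Y 0 := by
    rcases k0.lt_or_eq with h | h
    · nlinarith [mul_pos h3 h, mul_nonneg h0.le k3]
    · have : 0 < Y 3 := by linarith
      nlinarith [mul_pos h0 this]
  by_contra hcon
  push Not at hcon
  simp only [mq, mb] at *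
  -- (X₀Y₃ + X₃Y₀)² ≥ 4 X₀X₃Y₀Y₃ ≥ 4 (X₁² + X₂²)(Y₁² + Y₂²), with one strict inequality
  have hc : X 0 * Y 3 + X 3 * Y 0 ≤ 2 * (X 1 * Y 1 + X 2 * Y 2) := by linarith
  have hsq : (X 0 * Y 3 + X 3 * Y 0) ^ 2 ≤ (2 * (X 1 * Y 1 + X 2 * Y 2)) ^ 2 :=
    pow_le_pow_left₀ hpos.le hc 2
  have hy : 0 < Y 1 ^ 2 + Y 2 ^ 2 := by
    by_contra hz
    have a : Y 1 = 0 := by nlinarith [sq_nonneg (Y 1), sq_nonneg (Y 2)]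
    have b : Y 2 = 0 := by nlinarith [sq_nonneg (Y 1), sq_nonneg (Y 2)]
    rw [a, b] at hc; nlinarith
  have h1 : (X 1 * Y 1 + X 2 * Y 2) ^ 2 ≤ (X 1 ^ 2 + X 2 ^ 2) * (Y 1 ^ 2 + Y 2 ^ 2) := by
    nlinarith [sq_nonneg (X 1 * Y 2 - X 2 * Y 1)]
  have h2 : (X 1 ^ 2 + X 2 ^ 2) * (Y 1 ^ 2 + Y 2 ^ 2) < X 0 * X 3 * (Y 1 ^ 2 + Y 2 ^ 2) :=
    mul_lt_mul_of_pos_right (by linarith) hy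
  have h4 : X 0 * X 3 * (Y 1 ^ 2 + Y 2 ^ 2) ≤ X 0 * X 3 * (Y 0 * Y 3) :=
    mul_le_mul_of_nonneg_left (by linarith) (by positivity)
  nlinarith [sq_nonneg (X 0 * Y 3 - X 3 * Y 0)]

theorem Caus.mb_nonneg {X Y : Mink} (hX : Caus X) (hY : Caus Y) : 0 ≤ mb X Y := by
  by_cases hY0 : Y = 0
  · simp [hY0, mb]
  by_contra hcon
  push Not at hcon
  set e : Mink := ![1, 0, 0, 1] with he
  have hfe : Fut e := by simp [Fut, mq, he]
  have heY : 0 < mb e Y := hfe.mb_pos hY hY0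
  -- a small timelike perturbation of `X`
  have hfut : Fut (X + (-mb X Y / (2 * mb e Y)) • e) := by
    have ht : 0 < -mb X Y / (2 * mb e Y) := by apply div_pos <;> linarith
    refine ⟨by simp [he]; linarith [hX.1], ?_⟩
    rw [mq_add, mq_smul, mb_smul_right]
    have : 0 ≤ mb X e := by simp [mb, he]; linarith [hX.1, hX.2.1]
    have : 0 < mq e := hfe.2
    have := hX.2.2
    positivity
  have := hfut.mb_pos hY hY0
  rw [mb_add_left, mb_smul_left] at this
  have h2 : -mb X Y / (2 * mb e Y) * mb e Y = -mb X Y / 2 := by field_simp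
  rw [h2] at this
  linarith

theorem Caus.add {X Y : Mink} (hX : Caus X) (hY : Caus Y) : Caus (X + Y) :=
  ⟨add_nonneg hX.1 hY.1, add_nonneg hX.2.1 hY.2.1, by
    rw [mq_add]; linarith [hX.2.2, hY.2.2, hX.mb_nonneg hY]⟩

theorem Fut.add_caus {X Y : Mink} (hX : Fut X) (hY : Caus Y) : Fut (X + Y) :=
  ⟨add_pos_of_pos_of_nonneg hX.1 hY.1, by
    rw [mq_add]; linarith [hX.2, hY.2.2, hX.caus.mb_nonneg hY]⟩

theorem Caus.add_fut {X Y : Mink} (hX : Caus X) (hY : Fut Y) : Fut (X + Y) := by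
  rw [add_comm]; exact hY.add_caus hX

theorem Caus.smul {X : Mink} (hX : Caus X) {t : ℝ} (ht : 0 ≤ t) : Caus (t • X) :=
  ⟨mul_nonneg ht hX.1, mul_nonneg ht hX.2.1, by rw [mq_smul]; exact mul_nonneg (sq_nonneg t) hX.2.2⟩

theorem Fut.smul {X : Mink} (hX : Fut X) {t : ℝ} (ht : 0 < t) : Fut (t • X) :=
  ⟨mul_pos ht hX.1, by rw [mq_smul]; exact mul_pos (by positivity) hX.2⟩

theorem NullF.smul {X : Mink} (hX : NullF X) {t : ℝ} (ht : 0 < t) : NullF (t • X) :=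
  ⟨mul_nonneg ht.le hX.1, mul_nonneg ht.le hX.2.1, by rw [mq_smul, hX.2.2.1, mul_zero],
    smul_ne_zero ht.ne' hX.2.2.2⟩

/-- A causal vector is future timelike or null or zero according to its square. -/
theorem Caus.fut {X : Mink} (hX : Caus X) (h : 0 < mq X) : Fut X := by
  refine ⟨lt_of_le_of_ne hX.1 fun h0 => ?_, h⟩
  simp only [mq, ← h0] at h
  nlinarith [sq_nonneg (X 1), sq_nonneg (X 2)]

theorem caus_or_neg {X : Mink} (h : 0 ≤ mq X) : Caus X ∨ Caus (-X) := by
  have h03 : 0 ≤ X 0 * X 3 := by simp only [mq] at h; nlinarith [sq_nonneg (X 1), sq_nonneg (X 2)]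
  rcases mul_nonneg_iff.1 h03 with ⟨a, b⟩ | ⟨a, b⟩
  · exact Or.inl ⟨a, b, h⟩
  · exact Or.inr ⟨by simpa using a, by simpa using b, by rwa [mq_neg]⟩

theorem Caus.of_mb_pos {H X : Mink} (hH : Fut H) (hX : 0 ≤ mq X) (h : 0 ≤ mb H X) : Caus X := by
  rcases caus_or_neg hX with h1 | h1
  · exact h1
  · by_cases h0 : X = 0
    · rw [h0]; exact Caus.zero
    · have := hH.mb_pos h1 (neg_ne_zero.2 h0)
      rw [mb_neg_right] at this; linarith

theorem NullF.of_caus {X : Mink} (hX : Caus X) (h : mq X = 0) (h0 : X ≠ 0) : NullF X :=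
  ⟨hX.1, hX.2.1, h, h0⟩

theorem NullF.add_fut {n m : Mink} (hn : NullF n) (hm : NullF m) (h : 0 < mb n m) :
    Fut (n + m) :=
  (hn.caus.add hm.caus).fut (by rw [mq_add, hn.2.2.1, hm.2.2.1]; linarith)

/-- Splitting a timelike vector along a null direction. -/
theorem Fut.split {H n : Mink} (hH : Fut H) (hn : NullF n) :
    0 < mq H / mb H n ∧ NullF (H - (mq H / mb H n) • n) ∧
      ∀ s, 0 ≤ s → s < mq H / mb H n → Fut (H - s • n) := by
  have hb := hH.mb_pos hn.caus hn.2.2.2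
  have ht : 0 < mq H / mb H n := div_pos hH.2 hb
  have hq : ∀ s, mq (H - s • n) = mq H - s * mb H n := fun s => by
    rw [mq_sub, mq_smul, mb_smul_right, hn.2.2.1]; ring
  have hbb : ∀ s, mb H (H - s • n) = 2 * mq H - s * mb H n := fun s => by
    rw [mb_sub_right, mb_smul_right, mb_self]
  have hT : mq H / mb H n * mb H n = mq H := div_mul_cancel₀ _ hb.ne'
  refine ⟨ht, ?_, fun s hs hst => ?_⟩
  · apply NullF.of_caus (Caus.of_mb_pos hH _ _)
    · rw [hq, hT, sub_self]
    · intro h0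
      have := hbb (mq H / mb H n)
      rw [h0, hT, mb_zero_right] at this
      linarith [hH.2]
    · rw [hq, hT, sub_self]
    · rw [hbb, hT]; linarith [hH.2]
  · have h1 : s * mb H n < mq H := by rw [← hT]; exact mul_lt_mul_of_pos_right hst hb
    have h2 : 0 < mq (H - s • n) := by rw [hq]; linarith
    exact (Caus.of_mb_pos hH h2.le (by rw [hbb]; linarith [hH.2])).fut h2

theorem exists_upper (X : Mink) : ∃ c : ℝ, 0 < c ∧ Fut (c • (![1, 0, 0, 1] : Mink) - X) := by
  refine ⟨|X 0| + |X 3| + X 1 ^ 2 + X 2 ^ 2 + 1, by positivity, ?_, ?_⟩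
  · simp
    nlinarith [le_abs_self (X 0), abs_nonneg (X 3), sq_nonneg (X 1), sq_nonneg (X 2)]
  · simp only [mq]
    simp
    have h0 := le_abs_self (X 0)
    have h3 := le_abs_self (X 3)
    nlinarith [abs_nonneg (X 3), abs_nonneg (X 0), sq_nonneg (X 1), sq_nonneg (X 2),
      mul_nonneg (sub_nonneg.2 h0) (sub_nonneg.2 h3),
      mul_nonneg (add_nonneg (sub_nonneg.2 h0) (sub_nonneg.2 h3))
        (add_nonneg (sq_nonneg (X 1)) (sq_nonneg (X 2))),
      mul_nonneg (sub_nonneg.2 h0) (abs_nonneg (X 0)),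
      mul_nonneg (sub_nonneg.2 h3) (abs_nonneg (X 3)),
      sq_nonneg (X 1 ^ 2 + X 2 ^ 2), mul_nonneg (abs_nonneg (X 0)) (abs_nonneg (X 3)),
      mul_nonneg (abs_nonneg (X 0)) (add_nonneg (sq_nonneg (X 1)) (sq_nonneg (X 2))),
      mul_nonneg (abs_nonneg (X 3)) (add_nonneg (sq_nonneg (X 1)) (sq_nonneg (X 2)))]

theorem exists_upper_pair (X Y : Mink) : ∃ M : Mink, Fut (M - X) ∧ Fut (M - Y) := by
  obtain ⟨c, hc, h⟩ := exists_upper (Y - X)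
  refine ⟨X + c • (![1, 0, 0, 1] : Mink), ?_, ?_⟩
  · rw [add_sub_cancel_left]
    exact Fut.smul (by simp [Fut, mq]) hc
  · convert h using 1; abel

end Coherency

namespace Coherency

/-- The incidence properties of the coherency relation that are used: the common neighbours of
two distinct coherent points form a clique, and every point has a neighbour on every line. -/
structure IsGQ {T : Type*} (r : T → T → Prop) : Prop where
  refl : ∀ a, r a a
  symm : ∀ {a b}, r a b → r b a
  tri : ∀ {a b c d}, a ≠ b → r a b → r c a → r c b → r d a → r d b → r c d
  proj : ∀ {a b}, a ≠ b → r a b → ∀ w, ∃ c, r c a ∧ r c b ∧ r c w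

variable {T : Type*} {r : T → T → Prop}

/-- The common neighbours of two noncoherent points form a coclique. -/
theorem IsGQ.eq_of (G : IsGQ r) {x y u v : T} (hxy : ¬ r x y) (hux : r u x) (huy : r u y)
    (hvx : r v x) (hvy : r v y) (huv : r u v) : u = v := by
  by_contra h
  exact hxy (G.tri h huv (G.symm hux) (G.symm hvx) (G.symm huy) (G.symm hvy))

/-- `φ` preserves coherency on `𝒰`. -/
def Pres (r : T → T → Prop) (φ : Mink → T) (𝒰 : Set Mink) : Prop :=
  ∀ X ∈ 𝒰, ∀ Y ∈ 𝒰, mq (X - Y) = 0 → r (φ X) (φ Y)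

theorem Pres.mono {φ : Mink → T} {𝒰 𝒱 : Set Mink} (h : Pres r φ 𝒰) (hs : 𝒱 ⊆ 𝒰) : Pres r φ 𝒱 :=
  fun X hX Y hY => h X (hs hX) Y (hs hY)

/-- A null tetrad. -/
structure Frame (n₁ n₂ m₁ m₂ : Mink) (κ : ℝ) : Prop where
  pos : 0 < κ
  n1 : mq n₁ = 0
  n2 : mq n₂ = 0
  m1 : mq m₁ = -κ
  m2 : mq m₂ = -κ
  n12 : mb n₁ n₂ = κ
  n1m1 : mb n₁ m₁ = 0
  n1m2 : mb n₁ m₂ = 0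
  n2m1 : mb n₂ m₁ = 0
  n2m2 : mb n₂ m₂ = 0
  m12 : mb m₁ m₂ = 0
  complete : ∀ v, (2 * κ) • v = (2 * mb v n₂) • n₁ + (2 * mb v n₁) • n₂ - mb v m₁ • m₁ - mb v m₂ • m₂

theorem NullF.exists_spinor {n : Mink} (hn : NullF n) : ∃ a b c d : ℝ,
    n = ![a ^ 2 + b ^ 2, a * c + b * d, b * c - a * d, c ^ 2 + d ^ 2] := by
  obtain ⟨h0, h3, hq, -⟩ := hn
  simp only [mq] at hq
  rcases h0.lt_or_eq with h | h
  · have hs := Real.sq_sqrt h0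
    have hs' : √(n 0) ≠ 0 := (Real.sqrt_pos.2 h).ne'
    refine ⟨√(n 0), 0, n 1 / √(n 0), -n 2 / √(n 0), mink_ext ?_ ?_ ?_ ?_⟩ <;> simp
    · exact hs.symm
    · field_simp
    · field_simp
    · field_simp; rw [hs]; linarith
  · have h1 : n 1 = 0 := by
      have : n 1 ^ 2 = 0 := by rw [← h] at hq; nlinarith [sq_nonneg (n 1), sq_nonneg (n 2)]
      simpa using this
    have h2 : n 2 = 0 := by
      have : n 2 ^ 2 = 0 := by rw [← h] at hq; nlinarith [sq_nonneg (n 1), sq_nonneg (n 2)]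
      simpa using this
    refine ⟨0, 0, √(n 3), 0, mink_ext ?_ ?_ ?_ ?_⟩ <;> simp [h1, h2, ← h, Real.sq_sqrt h3]

theorem exists_frame {n₁ n₂ : Mink} (h₁ : NullF n₁) (h₂ : NullF n₂) (h : 0 < mb n₁ n₂) :
    ∃ m₁ m₂, Frame n₁ n₂ m₁ m₂ (mb n₁ n₂) := by
  obtain ⟨a, b, c, d, hn₁⟩ := h₁.exists_spinor
  obtain ⟨a', b', c', d', hn₂⟩ := h₂.exists_spinor
  refine ⟨![2 * (a * a' + b * b'), a * c' + b * d' + (a' * c + b' * d),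
      b * c' - a * d' + (b' * c - a' * d), 2 * (c * c' + d * d')],
    ![-2 * (b * a' - a * b'), -(b * c' - a * d') + (b' * c - a' * d),
      a * c' + b * d' - (a' * c + b' * d), -2 * (d * c' - c * d')], ?_⟩
  constructor
  · exact h
  · exact h₁.2.2.1
  · exact h₂.2.2.1
  all_goals
    clear h h₁ h₂
    subst hn₁ hn₂
  · simp only [mq, mb]; simp; ring
  · simp only [mq, mb]; simp; ring
  · rfl
  · simp only [mb]; simp; ring
  · simp only [mb]; simp; ring
  · simp only [mb]; simp; ring
  · simp only [mb]; simp; ring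
  · simp only [mb]; simp; ring
  · intro v
    apply mink_ext <;> simp [mb] <;> ring

/-- The null direction with stereographic coordinate `u + iv`. -/
def nd (n₁ n₂ m₁ m₂ : Mink) (u v : ℝ) : Mink := n₁ + (u ^ 2 + v ^ 2) • n₂ + u • m₁ + v • m₂

section
variable {n₁ n₂ m₁ m₂ : Mink} {κ : ℝ}

theorem Frame.mb_nd (F : Frame n₁ n₂ m₁ m₂ κ) (u v u' v' : ℝ) :
    mb (nd n₁ n₂ m₁ m₂ u v) (nd n₁ n₂ m₁ m₂ u' v') = κ * ((u - u') ^ 2 + (v - v') ^ 2) := by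
  have e1 := mb_self n₁; have e2 := mb_self n₂; have e3 := mb_self m₁; have e4 := mb_self m₂
  rw [F.n1] at e1; rw [F.n2] at e2; rw [F.m1] at e3; rw [F.m2] at e4
  simp only [nd, mb_add_left, mb_add_right, mb_smul_left, mb_smul_right, mb_comm n₂ n₁,
    mb_comm m₁ n₁, mb_comm m₂ n₁, mb_comm m₁ n₂, mb_comm m₂ n₂, mb_comm m₂ m₁, F.n12, F.n1m1,
    F.n1m2, F.n2m1, F.n2m2, F.m12, e1, e2, e3, e4]
  ring

theorem Frame.mq_nd (F : Frame n₁ n₂ m₁ m₂ κ) (u v : ℝ) : mq (nd n₁ n₂ m₁ m₂ u v) = 0 := by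
  have := F.mb_nd u v u v
  rw [mb_self] at this; linarith

theorem Frame.mb_nd_n2 (F : Frame n₁ n₂ m₁ m₂ κ) (u v : ℝ) : mb (nd n₁ n₂ m₁ m₂ u v) n₂ = κ := by
  have e2 := mb_self n₂
  rw [F.n2] at e2
  simp only [nd, mb_add_left, mb_smul_left, mb_comm m₁ n₂, mb_comm m₂ n₂, F.n12, F.n2m1, F.n2m2, e2]
  ring

theorem nd_zero : nd n₁ n₂ m₁ m₂ 0 0 = n₁ := by simp [nd]

theorem Frame.mb_nd_n1 (F : Frame n₁ n₂ m₁ m₂ κ) (u v : ℝ) :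
    mb (nd n₁ n₂ m₁ m₂ u v) n₁ = κ * (u ^ 2 + v ^ 2) := by
  have := F.mb_nd u v 0 0
  rw [nd_zero] at this; rw [this]; ring

theorem Frame.nullF_nd (F : Frame n₁ n₂ m₁ m₂ κ) (h₁ : NullF n₁) (h₂ : NullF n₂) (u v : ℝ) :
    NullF (nd n₁ n₂ m₁ m₂ u v) := by
  have hf : Fut (n₁ + n₂) := h₁.add_fut h₂ (by rw [F.n12]; exact F.pos)
  have hb : mb (n₁ + n₂) (nd n₁ n₂ m₁ m₂ u v) = κ * (u ^ 2 + v ^ 2) + κ := by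
    rw [mb_add_left, mb_comm n₁, mb_comm n₂, F.mb_nd_n1, F.mb_nd_n2]
  have hp : 0 < κ * (u ^ 2 + v ^ 2) + κ := by have := F.pos; positivity
  refine NullF.of_caus (Caus.of_mb_pos hf (F.mq_nd u v).ge ?_) (F.mq_nd u v) fun h0 => ?_
  · rw [hb]; exact hp.le
  · rw [h0, mb_zero_right] at hb; linarith

/-- Every null vector not parallel to `n₂` is a multiple of a normalized one. -/
theorem Frame.exists_nd (F : Frame n₁ n₂ m₁ m₂ κ) {n : Mink} (hn : mq n = 0) (h : mb n n₂ ≠ 0) :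
    ∃ u v, n = (mb n n₂ / κ) • nd n₁ n₂ m₁ m₂ u v := by
  have hκ := F.pos.ne'
  have hc := F.complete n
  have h0 : mb n ((2 * κ) • n) = 0 := by rw [mb_smul_right, mb_self, hn]; ring
  rw [hc, mb_sub_right, mb_sub_right, mb_add_right] at h0
  simp only [mb_smul_right] at h0
  refine ⟨-mb n m₁ / (2 * mb n n₂), -mb n m₂ / (2 * mb n n₂), ?_⟩
  have e : n = (2 * κ)⁻¹ • ((2 * κ) • n) := by
    rw [smul_smul, inv_mul_cancel₀ (by positivity), one_smul]
  have h1 : mb n n₁ = mb n n₂ * ((-mb n m₁ / (2 * mb n n₂)) ^ 2 + (-mb n m₂ / (2 * mb n n₂)) ^ 2) := by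
    field_simp; linarith
  rw [hc, h1] at e
  conv_lhs => rw [e]
  simp only [nd, smul_add, smul_sub, smul_smul]
  have a1 : (2 * κ)⁻¹ * (2 * mb n n₂) = mb n n₂ / κ := by field_simp
  have a3 : mb n n₂ / κ * (-mb n m₁ / (2 * mb n n₂)) = - ((2 * κ)⁻¹ * mb n m₁) := by field_simp
  have a4 : mb n n₂ / κ * (-mb n m₂ / (2 * mb n n₂)) = - ((2 * κ)⁻¹ * mb n m₂) := by field_simp
  rw [a3, a4, a1]
  have a2 : ∀ x : ℝ, (2 * κ)⁻¹ * (2 * (mb n n₂ * x)) = mb n n₂ / κ * x := fun x => by field_simp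
  rw [a2, neg_smul, neg_smul]
  abel

end
end Coherency

namespace Coherency

/-- Common neighbours of `X` and `Y`. -/
def Sph (X Y : Mink) : Set Mink := {Z | mq (Z - X) = 0 ∧ mq (Z - Y) = 0}

/-- The closed order interval between `X` and `Y`, in either order. -/
def Dia (X Y : Mink) : Set Mink :=
  {W | 0 ≤ mq (W - X) ∧ 0 ≤ mq (W - Y) ∧ 0 ≤ mb (W - X) (Y - W)}

/-- The open order interval between `X` and `Y`, in either order. -/
def Mid (X Y : Mink) : Set Mink :=
  {W | 0 < mq (W - X) ∧ 0 < mq (W - Y) ∧ 0 < mb (W - X) (Y - W)}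

/-- A point of the segment from `Z` to `X`. -/
def pt (Z X : Mink) (a : ℝ) : Mink := (1 + a)⁻¹ • (Z + a • X)

/-- The normalized distance of two points of `Sph X Y`. -/
def cr (X Y Z Z' : Mink) : ℝ := -mq (Z - Z') / mq (X - Y)

section
variable {X Y Z Z' W : Mink} {a b : ℝ}

theorem Sph_comm : Sph X Y = Sph Y X := by ext; simp [Sph, and_comm]

theorem mb_swap (X Y W : Mink) : mb (W - X) (Y - W) = mb (W - Y) (X - W) := by
  rw [mb_comm, ← neg_sub W Y, ← neg_sub X W, mb_neg_left, mb_neg_right, neg_neg]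

theorem Dia_comm : Dia X Y = Dia Y X := by
  ext W; simp only [Dia, Set.mem_ofPred_eq]; rw [mb_swap]; tauto

theorem Mid_comm : Mid X Y = Mid Y X := by
  ext W; simp only [Mid, Set.mem_ofPred_eq]; rw [mb_swap]; tauto

theorem cr_comm : cr X Y Z Z' = cr X Y Z' Z := by rw [cr, cr, mq_sub_comm]
theorem cr_swap : cr X Y Z Z' = cr Y X Z Z' := by rw [cr, cr, mq_sub_comm X Y]

theorem Mid_subset_Dia : Mid X Y ⊆ Dia X Y := fun _ h => ⟨h.1.le, h.2.1.le, h.2.2.le⟩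

theorem pt_zero : pt Z X 0 = Z := by simp [pt]

theorem pt_sub (ha : 0 ≤ a) : pt Z X a - X = (1 + a)⁻¹ • (Z - X) := by
  have : 1 + a ≠ 0 := by positivity
  simp only [pt]
  match_scalars <;> field_simp
  ring

theorem pt_pt {c : ℝ} (ha : 0 ≤ a) (hc : 0 ≤ c) : pt (pt Z X a) X c = pt Z X (a + (1 + a) * c) := by
  have h1 : 1 + a ≠ 0 := by positivity
  have h2 : 1 + c ≠ 0 := by positivity
  have h3 : 1 + (a + (1 + a) * c) = (1 + a) * (1 + c) := by ring
  simp only [pt, h3]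
  match_scalars <;> field_simp

theorem mq_sub_pt (W : Mink) (ha : 0 ≤ a) : (1 + a) * mq (W - pt Z X a)
    = mq (W - Z) + a * mq (W - X) - a * (1 + a)⁻¹ * mq (Z - X) := by
  have h1 : 1 + a ≠ 0 := by positivity
  simp only [pt, mq, Pi.sub_apply, Pi.smul_apply, Pi.add_apply, smul_eq_mul]
  field_simp
  ring

theorem mq_pt_sub_pt {b : ℝ} (ha : 0 ≤ a) (hb : 0 ≤ b) : mq (pt Z X a - pt Z X b) = 
    (((1 + a)⁻¹ - (1 + b)⁻¹)) ^ 2 * mq (Z - X) := by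
  have : pt Z X a - pt Z X b = ((1 + a)⁻¹ - (1 + b)⁻¹) • (Z - X) := by
    rw [sub_smul, ← pt_sub ha, ← pt_sub hb]; abel
  rw [this, mq_smul]

theorem mem_Sph_comm : Z ∈ Sph X Y ↔ Z ∈ Sph Y X := by rw [Sph_comm]

theorem coh_pt_line (hZ : Z ∈ Sph X Y) {b : ℝ} (ha : 0 ≤ a) (hb : 0 ≤ b) :
    mq (pt Z X a - pt Z X b) = 0 := by
  rw [mq_pt_sub_pt ha hb, hZ.1, mul_zero]

theorem coh_pt_left (hZ : Z ∈ Sph X Y) (ha : 0 ≤ a) : mq (pt Z X a - X) = 0 := by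
  rw [pt_sub ha, mq_smul, hZ.1, mul_zero]

theorem coh_pt_self (hZ : Z ∈ Sph X Y) (ha : 0 ≤ a) : mq (pt Z X a - Z) = 0 := by
  have := coh_pt_line hZ ha le_rfl
  rwa [pt_zero] at this

theorem mb_of_mem_Sph (hZ : Z ∈ Sph X Y) : mb (Z - X) (Y - Z) = mq (Y - X) := by
  have h : Y - X = (Z - X) + (Y - Z) := by abel
  rw [h, mq_add, hZ.1, mq_sub_comm Y Z, hZ.2]; ring

theorem mb_of_mem_Sph' (hZ : Z ∈ Sph X Y) : mb (Y - X) (Z - X) = mq (Y - X) := by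
  rw [← mb_of_mem_Sph hZ, mb_comm]
  have h : Y - X = (Z - X) + (Y - Z) := by abel
  rw [h, mb_add_right, mb_self, hZ.1]; ring

theorem left_mem_Dia (h : 0 < mq (X - Y)) : X ∈ Dia X Y := by
  refine ⟨?_, h.le, ?_⟩
  · rw [sub_self, mq_zero]
  · rw [sub_self, mb_zero_left]

theorem right_mem_Dia (h : 0 < mq (X - Y)) : Y ∈ Dia X Y := by
  rw [Dia_comm]; exact left_mem_Dia (by rwa [mq_sub_comm])

theorem pt_mem_Dia (h : 0 < mq (X - Y)) (hZ : Z ∈ Sph X Y) (ha : 0 ≤ a) : pt Z X a ∈ Dia X Y := by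
  have hm := mb_of_mem_Sph hZ
  have hm' := mb_of_mem_Sph' hZ
  have e : Y - pt Z X a = (Y - X) - (1 + a)⁻¹ • (Z - X) := by rw [← pt_sub ha]; abel
  rw [mq_sub_comm] at h
  have h1 : 0 < 1 + a := by positivity
  have h2 : (1 + a)⁻¹ ≤ 1 := inv_le_one_of_one_le₀ (by linarith)
  refine ⟨(coh_pt_left hZ ha).ge, ?_, ?_⟩
  · rw [mq_sub_comm, e, mq_sub, mq_smul, hZ.1, mb_smul_right, hm']
    nlinarith
  · rw [e, pt_sub ha, mb_smul_left, mb_sub_right, mb_smul_right, mb_self, hZ.1, mb_comm, hm']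
    simp only [mul_zero, sub_zero]
    positivity

theorem pt_mem_Dia' (h : 0 < mq (X - Y)) (hZ : Z ∈ Sph X Y) (ha : 0 ≤ a) : pt Z Y a ∈ Dia X Y := by
  rw [Dia_comm]; exact pt_mem_Dia (by rwa [mq_sub_comm]) (mem_Sph_comm.1 hZ) ha

theorem mem_Dia_of_Sph (h : 0 < mq (X - Y)) (hZ : Z ∈ Sph X Y) : Z ∈ Dia X Y := by
  have := pt_mem_Dia h hZ le_rfl
  rwa [pt_zero] at this

theorem Sph_neg (h : 0 < mq (X - Y)) (hZ : Z ∈ Sph X Y) (hZ' : Z' ∈ Sph X Y) (hne : Z ≠ Z') :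
    mq (Z - Z') < 0 := by
  rw [mq_sub_comm] at h
  have ho : mb (Y - X) (Z - Z') = 0 := by
    have e : Z - Z' = (Z - X) - (Z' - X) := by abel
    rw [e, mb_sub_right, mb_of_mem_Sph' hZ, mb_of_mem_Sph' hZ', sub_self]
  obtain ⟨h1, h2⟩ := mq_orthogonal_nonpos h ho
  exact lt_of_le_of_ne h1 fun h0 => hne (sub_eq_zero.1 (h2 h0))

theorem cr_pos (h : 0 < mq (X - Y)) (hZ : Z ∈ Sph X Y) (hZ' : Z' ∈ Sph X Y) (hne : Z ≠ Z') :
    0 < cr X Y Z Z' := div_pos (neg_pos.2 (Sph_neg h hZ hZ' hne)) h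

theorem coh_pt_pt (h : 0 < mq (X - Y)) (hZ : Z ∈ Sph X Y) (hZ' : Z' ∈ Sph X Y)
    (ha : 0 ≤ a) (hb : 0 ≤ b) :
    mq (pt Z X a - pt Z' Y b) = 0 ↔ a * b = cr X Y Z Z' := by
  have h1 := mq_sub_pt (Z := Z') (X := Y) (a := b) (pt Z X a) hb
  have h2 := mq_sub_pt (Z := Z) (X := X) (a := a) Z' ha
  have h3 := mq_sub_pt (Z := Z) (X := X) (a := a) Y ha
  rw [hZ'.2, mul_zero, sub_zero, mq_sub_comm _ Z', mq_sub_comm _ Y] at h1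
  rw [hZ'.1, hZ.1, mq_sub_comm Z' Z] at h2
  rw [mq_sub_comm Y Z, hZ.2, hZ.1, mq_sub_comm Y X] at h3
  have hA : 1 + a ≠ 0 := by positivity
  have hB : 1 + b ≠ 0 := by positivity
  have key : (1 + a) * (1 + b) * mq (pt Z X a - pt Z' Y b) = mq (Z - Z') + a * b * mq (X - Y) := by
    linear_combination (1 + a) * h1 + h2 + b * h3
  rw [cr, eq_div_iff h.ne']
  constructor
  · intro h0; rw [h0] at key; linarith
  · intro h0
    have : (1 + a) * (1 + b) * mq (pt Z X a - pt Z' Y b) = 0 := by rw [key]; linarith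
    simpa [hA, hB] using this

theorem Mid_neg (hW : W ∈ Mid X Y) (hZ : Z ∈ Sph X Y) : mq (W - Z) < 0 := by
  obtain ⟨h1, h2, h3⟩ := hW
  by_contra hcon
  push Not at hcon
  rw [mq_sub_comm] at h2
  have e1 := hZ.1
  have e2 := hZ.2
  rw [show Z - X = (W - X) - (W - Z) by abel, mq_sub] at e1
  rw [show Z - Y = -((Y - W) + (W - Z)) by abel, mq_neg, mq_add] at e2
  have := (mb_nonneg_of_causal h1 h2.le hcon h3 (by linarith)).1
  linarith

theorem Mid_coh (hW : W ∈ Mid X Y) (hZ : Z ∈ Sph X Y) :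
    0 < -mq (W - Z) / mq (W - X) ∧ mq (W - pt Z X (-mq (W - Z) / mq (W - X))) = 0 := by
  have h1 := hW.1
  have ha := div_pos (neg_pos.2 (Mid_neg hW hZ)) h1
  refine ⟨ha, ?_⟩
  have := mq_sub_pt (Z := Z) (X := X) W ha.le
  rw [hZ.1, div_mul_cancel₀ _ h1.ne'] at this
  have hp : (1 + -mq (W - Z) / mq (W - X)) ≠ 0 := by positivity
  have h0 : (1 + -mq (W - Z) / mq (W - X)) * mq (W - pt Z X (-mq (W - Z) / mq (W - X))) = 0 := by
    rw [this]; ring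
  simpa [hp] using h0

theorem fut_or_fut (h : 0 < mq (X - Y)) : Fut (Y - X) ∨ Fut (X - Y) := by
  rcases caus_or_neg h.le with h1 | h1
  · exact Or.inr (h1.fut h)
  · left; rw [neg_sub] at h1; exact h1.fut (by rwa [mq_sub_comm])

theorem Dia_iff (h : Fut (Y - X)) : W ∈ Dia X Y ↔ Caus (W - X) ∧ Caus (Y - W) := by
  have e : Y - X = (W - X) + (Y - W) := by abel
  constructor
  · rintro ⟨h1, h2, h3⟩
    rw [mq_sub_comm W Y] at h2
    refine ⟨Caus.of_mb_pos h h1 ?_, Caus.of_mb_pos h h2 ?_⟩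
    · rw [e, mb_add_left, mb_self, mb_comm (Y - W)]; linarith
    · rw [e, mb_add_left, mb_self]; linarith
  · rintro ⟨h1, h2⟩
    exact ⟨h1.2.2, by rw [mq_sub_comm]; exact h2.2.2, h1.mb_nonneg h2⟩

theorem Mid_iff (h : Fut (Y - X)) : W ∈ Mid X Y ↔ Fut (W - X) ∧ Fut (Y - W) := by
  constructor
  · intro hW
    obtain ⟨h1, h2⟩ := (Dia_iff h).1 (Mid_subset_Dia hW)
    exact ⟨h1.fut hW.1, h2.fut (by rw [mq_sub_comm]; exact hW.2.1)⟩
  · rintro ⟨h1, h2⟩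
    exact ⟨h1.2, by rw [mq_sub_comm]; exact h2.2, h1.mb_pos h2.caus h2.ne_zero⟩

theorem Dia_subset (h : 0 < mq (X - Y)) (hW : W ∈ Dia X Y) (hXW : 0 < mq (X - W)) :
    Dia X W ⊆ Dia X Y := by
  intro V hV
  rcases fut_or_fut h with h' | h'
  · obtain ⟨h1, h2⟩ := (Dia_iff h').1 hW
    obtain ⟨h3, h4⟩ := (Dia_iff (h1.fut (by rwa [mq_sub_comm]))).1 hV
    refine (Dia_iff h').2 ⟨h3, ?_⟩
    rw [show Y - V = (W - V) + (Y - W) by abel]; exact h4.add h2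
  · rw [Dia_comm] at hW hV ⊢
    obtain ⟨h1, h2⟩ := (Dia_iff h').1 hW
    obtain ⟨h3, h4⟩ := (Dia_iff (h2.fut hXW)).1 hV
    refine (Dia_iff h').2 ⟨?_, h4⟩
    rw [show V - Y = (V - W) + (W - Y) by abel]; exact h3.add h1

theorem mq_left_pt (hZ : Z ∈ Sph X Y) (hb : 0 ≤ b) :
    mq (X - pt Z Y b) = b / (1 + b) * mq (X - Y) := by
  have := mq_sub_pt (Z := Z) (X := Y) X hb
  rw [mq_sub_comm X Z, hZ.1, hZ.2] at this
  have hB : 1 + b ≠ 0 := by positivity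
  field_simp
  linarith

/-- The line from `X` through a neighbour `V` meets `Sph X Y`. -/
theorem line_meets_Sph {V : Mink} (hV : mq (V - X) = 0) (hb : mb (Y - X) (V - X) ≠ 0) :
    X + (mq (Y - X) / mb (Y - X) (V - X)) • (V - X) ∈ Sph X Y := by
  constructor
  · rw [add_sub_cancel_left, mq_smul, hV, mul_zero]
  · rw [mq_sub_comm, ← sub_sub, mq_sub, mq_smul, hV, mb_smul_right, div_mul_cancel₀ _ hb]; ring

theorem Sph_infinite (h : 0 < mq (X - Y)) : (Sph X Y).Infinite := by
  wlog h' : Fut (Y - X) generalizing X Y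
  · rw [Sph_comm]
    exact this (by rwa [mq_sub_comm]) ((fut_or_fut h).resolve_left h')
  have h₁ : NullF ![1, 0, 0, 0] := by
    refine ⟨by simp, by simp, by simp [mq], fun h => ?_⟩
    simpa using congrFun h 0
  have h₂ : NullF ![0, 0, 0, 1] := by
    refine ⟨by simp, by simp, by simp [mq], fun h => ?_⟩
    simpa using congrFun h 3
  obtain ⟨m₁, m₂, F⟩ := exists_frame h₁ h₂ (by simp [mb])
  set n : ℝ → Mink := fun u => nd ![1, 0, 0, 0] ![0, 0, 0, 1] m₁ m₂ u 0
  have hn : ∀ u, NullF (n u) := fun u => F.nullF_nd h₁ h₂ u 0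
  have hp : ∀ u, 0 < mb (Y - X) (n u) := fun u => h'.mb_pos (hn u).caus (hn u).2.2.2
  have hmem : ∀ u, X + (mq (Y - X) / mb (Y - X) (n u)) • n u ∈ Sph X Y := fun u => by
    have := line_meets_Sph (X := X) (Y := Y) (V := X + n u) (by
      rw [add_sub_cancel_left]; exact (hn u).2.2.1) (by rw [add_sub_cancel_left]; exact (hp u).ne')
    rwa [add_sub_cancel_left] at this
  refine Set.infinite_of_injective_forall_mem (f := fun u : ℝ =>
    X + (mq (Y - X) / mb (Y - X) (n u)) • n u) (fun u v huv => ?_) hmem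
  have h0 : mb (n u) (n v) = 0 := by
    have e := add_left_cancel huv
    have hs : ∀ u, mq (Y - X) / mb (Y - X) (n u) ≠ 0 := fun u => (div_pos h'.2 (hp u)).ne'
    have := mb_smul_right (mq (Y - X) / mb (Y - X) (n v)) (n u) (n v)
    rw [← e, mb_smul_right, mb_self, (hn u).2.2.1] at this
    simpa [hs v] using this.symm
  rw [F.mb_nd] at h0
  have : (u - v) ^ 2 = 0 := by simpa [F.pos.ne'] using h0
  have := pow_eq_zero_iff (two_ne_zero) |>.1 this
  linarith

end
end Coherency

namespace Coherency

/-- A multiplicative subgroup of the positive reals containing an interval is everything. -/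
theorem pos_subgroup_eq_all {G : Set ℝ} (hmul : ∀ x ∈ G, ∀ y ∈ G, x * y ∈ G)
    (hinv : ∀ x ∈ G, x⁻¹ ∈ G) {δ : ℝ} (hδ : 1 < δ) (hI : ∀ x, 1 ≤ x → x ≤ δ → x ∈ G)
    {ρ : ℝ} (hρ : 0 < ρ) : ρ ∈ G := by
  have hge : ∀ x, 1 ≤ x → x ∈ G := by
    intro x hx
    obtain ⟨n, hn⟩ := pow_unbounded_of_one_lt x hδ
    have : ∀ n : ℕ, ∀ x, 1 ≤ x → x ≤ δ ^ n → x ∈ G := by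
      intro n
      induction n with
      | zero => intro x h1 h2; exact hI x h1 (by simp at h2; linarith)
      | succ n ih =>
        intro x h1 h2
        by_cases hx : x ≤ δ
        · exact hI x h1 hx
        · push Not at hx
          have hd : 0 < δ := by linarith
          have := hmul (x / δ) (ih _ (by rw [le_div_iff₀ hd]; linarith)
            (by rw [div_le_iff₀ hd, ← pow_succ]; exact h2)) δ (hI δ hδ.le le_rfl)
          rwa [div_mul_cancel₀ _ hd.ne'] at this
    exact this n x hx hn.le
  rcases le_total 1 ρ with h | h
  · exact hge ρ h
  · have := hinv _ (hge ρ⁻¹ ((one_le_inv₀ hρ).2 h))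
    rwa [inv_inv] at this

/-- Cross ratio argument in the plane. -/
theorem plane_period {E : ℝ → ℝ → Prop} {G : Set ℝ} (hmul : ∀ x ∈ G, ∀ y ∈ G, x * y ∈ G)
    (hinv : ∀ x ∈ G, x⁻¹ ∈ G) {p q p' q' : ℝ} (h0 : 0 < p ^ 2 + q ^ 2)
    (hne : ¬ (p = p' ∧ q = q')) (hE : ¬ E p q) (hE' : ¬ E p' q')
    (hG : ∀ u v, 0 < u ^ 2 + v ^ 2 → ¬ E u v → (u ^ 2 + v ^ 2) / (p ^ 2 + q ^ 2) ∈ G)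
    (hG' : ∀ u v u' v', E u v → E u' v' →
      ((u' - p) ^ 2 + (v' - q) ^ 2) * ((u - p') ^ 2 + (v - q') ^ 2) /
        (((u' - p') ^ 2 + (v' - q') ^ 2) * ((u - p) ^ 2 + (v - q) ^ 2)) ∈ G)
    {ρ : ℝ} (hρ : 0 < ρ) : ρ ∈ G := by
  by_contra hcon
  have h1G : (1 : ℝ) ∈ G := by
    have := hG p q h0 hE
    rwa [div_self h0.ne'] at this
  have circ : ∀ ρ : ℝ, 0 < ρ → ρ ∉ G → ∀ u v, u ^ 2 + v ^ 2 = ρ * (p ^ 2 + q ^ 2) → E u v := by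
    intro ρ hρ hn u v huv
    by_contra hE
    have := hG u v (by rw [huv]; positivity) hE
    rw [huv, mul_div_assoc, div_self h0.ne', mul_one] at this
    exact hn this
  have main : ∀ ρ : ℝ, 0 < ρ → ρ ∉ G → p' = ρ * p ∧ q' = ρ * q := by
    intro ρ hρ hn
    have hEc := circ ρ hρ hn
    set s := √(ρ * (p ^ 2 + q ^ 2)) with hs
    have hs2 : s ^ 2 = ρ * (p ^ 2 + q ^ 2) := Real.sq_sqrt (by positivity)
    have hspos : 0 < s := Real.sqrt_pos.2 (by positivity)
    have hcirc : ∀ u v, u ^ 2 + v ^ 2 = s ^ 2 → E u v := fun u v h => hEc u v (h.trans hs2)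
    have npos : ∀ {u v a b : ℝ}, E u v → ¬ E a b → 0 < (u - a) ^ 2 + (v - b) ^ 2 := by
      intro u v a b h1 h2
      by_contra hc
      push Not at hc
      have e1 : (u - a) ^ 2 = 0 := by nlinarith [sq_nonneg (u - a), sq_nonneg (v - b)]
      have e2 : (v - b) ^ 2 = 0 := by nlinarith [sq_nonneg (u - a), sq_nonneg (v - b)]
      have e1' : u = a := by have := pow_eq_zero_iff (two_ne_zero) |>.1 e1; linarith
      have e2' : v = b := by have := pow_eq_zero_iff (two_ne_zero) |>.1 e2; linarith
      exact h2 (e1' ▸ e2' ▸ h1)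
    set k : ℝ → ℝ := fun θ => ((s * Real.cos θ - p) ^ 2 + (s * Real.sin θ - q) ^ 2) /
      ((s * Real.cos θ - p') ^ 2 + (s * Real.sin θ - q') ^ 2) with hk
    have hEθ : ∀ θ, E (s * Real.cos θ) (s * Real.sin θ) := fun θ => hcirc _ _ (by
      nlinarith [Real.sin_sq_add_cos_sq θ])
    have hkpos : ∀ θ, 0 < k θ := fun θ => div_pos (npos (hEθ θ) hE) (npos (hEθ θ) hE')
    have hkc : Continuous k := by
      apply Continuous.div
      · fun_prop
      · fun_prop
      · exact fun θ => (npos (hEθ θ) hE').ne'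
    have hratio : ∀ θ θ', k θ' / k θ ∈ G := by
      intro θ θ'
      have := hG' _ _ _ _ (hEθ θ) (hEθ θ')
      have e : k θ' / k θ = ((s * Real.cos θ' - p) ^ 2 + (s * Real.sin θ' - q) ^ 2) *
          ((s * Real.cos θ - p') ^ 2 + (s * Real.sin θ - q') ^ 2) /
        (((s * Real.cos θ' - p') ^ 2 + (s * Real.sin θ' - q') ^ 2) *
          ((s * Real.cos θ - p) ^ 2 + (s * Real.sin θ - q) ^ 2)) := by
        simp only [hk]; rw [div_div_div_eq]
      rw [e]; exact this
    have hconst : ∀ θ θ', k θ = k θ' := by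
      by_contra hnc
      push Not at hnc
      have : ∃ θ θ', k θ < k θ' := by
        obtain ⟨θ, θ', h⟩ := hnc
        rcases lt_or_gt_of_ne h with h | h
        · exact ⟨_, _, h⟩
        · exact ⟨_, _, h⟩
      obtain ⟨θ, θ', h⟩ := this
      apply hn
      refine pos_subgroup_eq_all hmul hinv ((one_lt_div (hkpos θ)).2 h) (fun x h1 h2 => ?_) hρ
      obtain ⟨θ'', h''⟩ := mem_range_of_exists_le_of_exists_ge hkc (c := x * k θ)
        ⟨θ, by nlinarith [hkpos θ]⟩ ⟨θ', by rwa [le_div_iff₀ (hkpos θ)] at h2⟩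
      have := hratio θ θ''
      rwa [h'', mul_div_assoc, div_self (hkpos θ).ne', mul_one] at this
    set c := k 0 with hc
    have hc0 : 0 < c := hkpos 0
    have eqk : ∀ θ, (s * Real.cos θ - p) ^ 2 + (s * Real.sin θ - q) ^ 2 =
        c * ((s * Real.cos θ - p') ^ 2 + (s * Real.sin θ - q') ^ 2) := fun θ => by
      have := hconst θ 0
      rw [← hc] at this
      simp only [hk] at this
      rwa [div_eq_iff (npos (hEθ θ) hE').ne'] at this
    have k0 := eqk 0
    have k1 := eqk Real.pi
    have k2 := eqk (Real.pi / 2)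
    have k3 := eqk (-(Real.pi / 2))
    simp only [Real.cos_zero, Real.sin_zero, Real.cos_pi, Real.sin_pi, Real.cos_pi_div_two,
      Real.sin_pi_div_two, Real.cos_neg, Real.sin_neg] at k0 k1 k2 k3
    have hp : p = c * p' := by
      have : s * (p - c * p') = 0 := by linear_combination (k1 - k0) / 4
      have := (mul_eq_zero.1 this).resolve_left hspos.ne'
      linarith
    have hq : q = c * q' := by
      have : s * (q - c * q') = 0 := by linear_combination (k3 - k2) / 4
      have := (mul_eq_zero.1 this).resolve_left hspos.ne'
      linarith
    have hsum : s ^ 2 + (p ^ 2 + q ^ 2) = c * (s ^ 2 + (p' ^ 2 + q' ^ 2)) := by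
      linear_combination (k0 + k1) / 2
    have hc1 : c ≠ 1 := fun h => hne ⟨by rw [hp, h, one_mul], by rw [hq, h, one_mul]⟩
    have hρc : ρ * c = 1 := by
      have e1 : c * (p' ^ 2 + q' ^ 2) * c = p ^ 2 + q ^ 2 := by rw [hp, hq]; ring
      have e2 : (1 - c) * ((ρ * c - 1) * (p ^ 2 + q ^ 2)) = 0 := by
        rw [hs2] at hsum; linear_combination c * hsum + e1
      have := (mul_eq_zero.1 e2).resolve_left (sub_ne_zero.2 hc1.symm)
      have := (mul_eq_zero.1 this).resolve_right h0.ne'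
      linarith
    constructor
    · rw [hp]; linear_combination -p' * hρc
    · rw [hq]; linear_combination -q' * hρc
  have hsq : √ρ ∉ G := fun h => hcon (by
    have := hmul _ h _ h
    rwa [Real.mul_self_sqrt hρ.le] at this)
  obtain ⟨a1, a2⟩ := main ρ hρ hcon
  obtain ⟨b1, b2⟩ := main (√ρ) (Real.sqrt_pos.2 hρ) hsq
  have e : (ρ - √ρ) ^ 2 * (p ^ 2 + q ^ 2) = 0 := by
    have c1 : (ρ - √ρ) * p = 0 := by linarith
    have c2 : (ρ - √ρ) * q = 0 := by linarith
    linear_combination (ρ - √ρ) * p * c1 + (ρ - √ρ) * q * c2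
  have e := (mul_eq_zero.1 e).resolve_right h0.ne'
  have e : ρ = √ρ := by have := pow_eq_zero_iff (two_ne_zero) |>.1 e; linarith
  apply hcon
  have h1 : ρ = 1 := by
    have h2 := Real.mul_self_sqrt hρ.le
    rw [← e] at h2
    have : ρ * (ρ - 1) = 0 := by linarith
    have := (mul_eq_zero.1 this).resolve_left hρ.ne'
    linarith
  rw [h1]; exact h1G

section
variable {X Y : Mink}

/-- Stereographic coordinates on `Sph X Y`, with the points `e₁`, `e₂` at the origin and at
infinity. -/
theorem Sph_coords (h : Fut (Y - X)) {e₁ e₂ : Mink} (h₁ : e₁ ∈ Sph X Y) (h₂ : e₂ ∈ Sph X Y)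
    (hne : e₁ ≠ e₂) : ∃ (κ : ℝ) (t : ℝ → ℝ → ℝ) (Z : ℝ → ℝ → Mink), 0 < κ ∧ (∀ u v, 0 < t u v) ∧
      (∀ u v, Z u v ∈ Sph X Y) ∧ Z 0 0 = e₁ ∧ t 0 0 = 1 ∧
      (∀ u v u' v', mq (Z u v - Z u' v') =
        -(t u v * t u' v' * κ * ((u - u') ^ 2 + (v - v') ^ 2))) ∧
      (∀ u v, mq (Z u v - e₂) = -(t u v * κ)) ∧ (∀ P ∈ Sph X Y, P ≠ e₂ → ∃ u v, P = Z u v) := by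
  have hX : 0 < mq (X - Y) := by rw [mq_sub_comm]; exact h.2
  have hnull : ∀ P ∈ Sph X Y, NullF (P - X) := by
    intro P hP
    refine NullF.of_caus ((Dia_iff h).1 (mem_Dia_of_Sph hX hP)).1 hP.1 fun h0 => ?_
    have := mb_of_mem_Sph' hP
    rw [h0, mb_zero_right] at this
    linarith [h.2]
  have hpol : ∀ P ∈ Sph X Y, ∀ Q ∈ Sph X Y, mb (P - X) (Q - X) = -mq (P - Q) := by
    intro P hP Q hQ
    rw [show P - Q = (P - X) - (Q - X) by abel, mq_sub, hP.1, hQ.1]; ring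
  have hb : 0 < mb (e₁ - X) (e₂ - X) := by
    rw [hpol _ h₁ _ h₂]; linarith [Sph_neg hX h₁ h₂ hne]
  obtain ⟨m₁, m₂, F⟩ := exists_frame (hnull _ h₁) (hnull _ h₂) hb
  set κ := mb (e₁ - X) (e₂ - X)
  set n : ℝ → ℝ → Mink := fun u v => nd (e₁ - X) (e₂ - X) m₁ m₂ u v with hn
  have hN : ∀ u v, NullF (n u v) := fun u v => F.nullF_nd (hnull _ h₁) (hnull _ h₂) u v
  have hp : ∀ u v, 0 < mb (Y - X) (n u v) := fun u v => h.mb_pos (hN u v).caus (hN u v).2.2.2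
  have hmem : ∀ u v, X + (mq (Y - X) / mb (Y - X) (n u v)) • n u v ∈ Sph X Y := fun u v => by
    have := line_meets_Sph (X := X) (Y := Y) (V := X + n u v) (by
      rw [add_sub_cancel_left]; exact (hN u v).2.2.1)
      (by rw [add_sub_cancel_left]; exact (hp u v).ne')
    rwa [add_sub_cancel_left] at this
  have ht0 : mq (Y - X) / mb (Y - X) (n 0 0) = 1 := by
    simp only [hn, nd_zero]
    rw [mb_of_mem_Sph' h₁, div_self h.2.ne']
  refine ⟨κ, fun u v => mq (Y - X) / mb (Y - X) (n u v),
    fun u v => X + (mq (Y - X) / mb (Y - X) (n u v)) • n u v, F.pos,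
    fun u v => div_pos h.2 (hp u v), hmem, ?_, ht0, ?_, ?_, ?_⟩
  · show X + (mq (Y - X) / mb (Y - X) (n 0 0)) • n 0 0 = e₁
    rw [ht0]; simp only [hn, nd_zero]; simp
  · intro u v u' v'
    have := hpol _ (hmem u v) _ (hmem u' v')
    rw [add_sub_cancel_left, add_sub_cancel_left, mb_smul_left, mb_smul_right, F.mb_nd] at this
    linarith
  · intro u v
    have := hpol _ (hmem u v) _ h₂
    rw [add_sub_cancel_left, mb_smul_left, F.mb_nd_n2] at this
    linarith
  · intro P hP hPe
    have hPn : 0 < mb (P - X) (e₂ - X) := by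
      rw [hpol _ hP _ h₂]; linarith [Sph_neg hX hP h₂ hPe]
    obtain ⟨u, v, huv⟩ := F.exists_nd hP.1 hPn.ne'
    refine ⟨u, v, ?_⟩
    have h1 := mb_of_mem_Sph' hP
    set c := mb (P - X) (e₂ - X) / κ
    change P - X = c • n u v at huv
    rw [huv, mb_smul_right] at h1
    have h2 : mq (Y - X) / mb (Y - X) (n u v) = c := by rw [div_eq_iff (hp u v).ne', h1]
    show P = X + (mq (Y - X) / mb (Y - X) (n u v)) • n u v
    rw [h2, ← huv]; abel

/-- The transfer lemma: predicates on the two rulings which correspond to each other for a two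
class partition of `Sph X Y` are trivial. -/
theorem transfer (hXY : 0 < mq (X - Y)) {E : Mink → Prop} {e₁ e₂ f₁ f₂ : Mink}
    (he₁ : e₁ ∈ Sph X Y) (he₂ : e₂ ∈ Sph X Y) (hf₁ : f₁ ∈ Sph X Y) (hf₂ : f₂ ∈ Sph X Y)
    (hE₁ : E e₁) (hE₂ : E e₂) (hF₁ : ¬ E f₁) (hF₂ : ¬ E f₂) (hne : e₁ ≠ e₂) (hnf : f₁ ≠ f₂)
    {𝒜 ℬ : Mink → ℝ → Prop}
    (htr : ∀ Z ∈ Sph X Y, ∀ Z' ∈ Sph X Y, E Z → ¬ E Z' → ∀ a b, 0 < a → 0 < b →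
      a * b = cr X Y Z Z' → (𝒜 Z a ↔ ℬ Z' b))
    {Z₀ : Mink} {a₀ : ℝ} (hZ₀ : Z₀ ∈ Sph X Y) (hEZ₀ : E Z₀) (ha₀ : 0 < a₀) (hA : 𝒜 Z₀ a₀) :
    (∀ Z ∈ Sph X Y, E Z → ∀ a, 0 < a → 𝒜 Z a) ∧ (∀ Z ∈ Sph X Y, ¬ E Z → ∀ b, 0 < b → ℬ Z b) := by
  have hcr : ∀ {Z Z'}, Z ∈ Sph X Y → Z' ∈ Sph X Y → E Z → ¬ E Z' → 0 < cr X Y Z Z' :=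
    fun h1 h2 h3 h4 => cr_pos hXY h1 h2 fun h => h4 (h ▸ h3)
  have tr' : ∀ {Z Z'}, Z ∈ Sph X Y → Z' ∈ Sph X Y → E Z → ¬ E Z' → ∀ a, 0 < a →
      (𝒜 Z a ↔ ℬ Z' (cr X Y Z Z' / a)) := fun h1 h2 h3 h4 a ha =>
    htr _ h1 _ h2 h3 h4 a _ ha (div_pos (hcr h1 h2 h3 h4) ha) (mul_div_cancel₀ _ ha.ne')
  have tr'' : ∀ {Z Z'}, Z ∈ Sph X Y → Z' ∈ Sph X Y → E Z → ¬ E Z' → ∀ b, 0 < b →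
      (𝒜 Z (cr X Y Z Z' / b) ↔ ℬ Z' b) := fun h1 h2 h3 h4 b hb =>
    htr _ h1 _ h2 h3 h4 _ b (div_pos (hcr h1 h2 h3 h4) hb) hb (div_mul_cancel₀ _ hb.ne')
  set G : Set ℝ := {l | 0 < l ∧ ∀ b, 0 < b → (ℬ f₁ b ↔ ℬ f₁ (l * b))} with hG
  have hmul : ∀ x ∈ G, ∀ y ∈ G, x * y ∈ G := fun x hx y hy => ⟨mul_pos hx.1 hy.1, fun b hb => by
    rw [hy.2 b hb, hx.2 _ (mul_pos hy.1 hb), mul_assoc]⟩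
  have hinv : ∀ x ∈ G, x⁻¹ ∈ G := fun x hx => ⟨inv_pos.2 hx.1, fun b hb => by
    rw [hx.2 (x⁻¹ * b) (mul_pos (inv_pos.2 hx.1) hb), mul_inv_cancel_left₀ hx.1.ne']⟩
  have hcross : ∀ Z ∈ Sph X Y, ∀ Z' ∈ Sph X Y, ∀ R ∈ Sph X Y, E Z → E Z' → ¬ E R →
      cr X Y Z' f₁ * cr X Y Z R / (cr X Y Z' R * cr X Y Z f₁) ∈ G := by
    intro Z hZ Z' hZ' R hR h1 h2 h3
    have c1 := hcr hZ' hf₁ h2 hF₁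
    have c2 := hcr hZ hR h1 h3
    have c3 := hcr hZ' hR h2 h3
    have c4 := hcr hZ hf₁ h1 hF₁
    refine ⟨by positivity, fun b hb => ?_⟩
    rw [← tr'' hZ hf₁ h1 hF₁ b hb, tr' hZ hR h1 h3 _ (div_pos c4 hb),
      ← tr'' hZ' hR h2 h3 _ (by positivity), tr' hZ' hf₁ h2 hF₁ _ (by positivity)]
    have e : cr X Y Z' f₁ / (cr X Y Z' R / (cr X Y Z R / (cr X Y Z f₁ / b)))
      = cr X Y Z' f₁ * cr X Y Z R / (cr X Y Z' R * cr X Y Z f₁) * b := by field_simp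
    rw [e]
  have hall : ∀ ρ : ℝ, 0 < ρ → ρ ∈ G := by
    intro ρ hρ
    have hcoord : ∃ (κ : ℝ) (t : ℝ → ℝ → ℝ) (Z : ℝ → ℝ → Mink), 0 < κ ∧ (∀ u v, 0 < t u v) ∧
      (∀ u v, Z u v ∈ Sph X Y) ∧ Z 0 0 = e₁ ∧ t 0 0 = 1 ∧
      (∀ u v u' v', mq (Z u v - Z u' v') =
        -(t u v * t u' v' * κ * ((u - u') ^ 2 + (v - v') ^ 2))) ∧
      (∀ u v, mq (Z u v - e₂) = -(t u v * κ)) ∧ (∀ P ∈ Sph X Y, P ≠ e₂ → ∃ u v, P = Z u v) := by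
      rcases fut_or_fut hXY with h | h
      · exact Sph_coords h he₁ he₂ hne
      · have := Sph_coords h (mem_Sph_comm.1 he₁) (mem_Sph_comm.1 he₂) hne
        simpa only [Sph_comm (X := Y)] using this
    obtain ⟨κ, t, Z, hκ, ht, hZ, hZ0, ht0, hZZ, hZe, hsurj⟩ := hcoord
    obtain ⟨p, q, rfl⟩ := hsurj f₁ hf₁ (fun h => hF₁ (h ▸ hE₂))
    obtain ⟨p', q', rfl⟩ := hsurj f₂ hf₂ (fun h => hF₂ (h ▸ hE₂))
    have h0 : 0 < p ^ 2 + q ^ 2 := by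
      by_contra hc
      push Not at hc
      have e1 : p ^ 2 = 0 := by nlinarith [sq_nonneg p, sq_nonneg q]
      have e2 : q ^ 2 = 0 := by nlinarith [sq_nonneg p, sq_nonneg q]
      rw [pow_eq_zero_iff two_ne_zero] at e1 e2
      rw [e1, e2, hZ0] at hF₁
      exact hF₁ hE₁
    refine plane_period (E := fun u v => E (Z u v)) hmul hinv h0
      (fun h => hnf (by rw [h.1, h.2])) hF₁ hF₂ ?_ ?_ hρ
    · intro u v huv hE
      have := hcross e₁ he₁ e₂ he₂ (Z u v) (hZ u v) hE₁ hE₂ hE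
      have e : cr X Y e₂ (Z p q) * cr X Y e₁ (Z u v) / (cr X Y e₂ (Z u v) * cr X Y e₁ (Z p q))
          = (u ^ 2 + v ^ 2) / (p ^ 2 + q ^ 2) := by
        simp only [cr]
        rw [mq_sub_comm e₂, hZe, mq_sub_comm e₂, hZe, ← hZ0, hZZ, hZZ, ht0]
        have h1 := (ht u v).ne'
        have h2 := (ht p q).ne'
        have h3 := hXY.ne'
        have h4 := h0.ne'
        simp only [zero_sub, neg_sq]
        field_simp
      rwa [e] at this
    · intro u v u' v' hE hE'
      have := hcross _ (hZ u v) _ (hZ u' v') (Z p' q') (hZ p' q') hE hE' hF₂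
      have e : cr X Y (Z u' v') (Z p q) * cr X Y (Z u v) (Z p' q') /
          (cr X Y (Z u' v') (Z p' q') * cr X Y (Z u v) (Z p q))
          = ((u' - p) ^ 2 + (v' - q) ^ 2) * ((u - p') ^ 2 + (v - q') ^ 2) /
        (((u' - p') ^ 2 + (v' - q') ^ 2) * ((u - p) ^ 2 + (v - q) ^ 2)) := by
        simp only [cr, hZZ, neg_neg]
        have h1 := (ht u v).ne'
        have h2 := (ht p q).ne'
        have h3 := (ht u' v').ne'
        have h4 := (ht p' q').ne'
        have h5 := hXY.ne'
        have h6 := hκ.ne'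
        rw [div_mul_div_comm, div_mul_div_comm, div_div_div_cancel_right₀ (by positivity)]
        rw [show t u' v' * t p q * κ * ((u' - p) ^ 2 + (v' - q) ^ 2) *
            (t u v * t p' q' * κ * ((u - p') ^ 2 + (v - q') ^ 2)) =
            (t u' v' * t p q * κ * (t u v * t p' q' * κ)) * (((u' - p) ^ 2 + (v' - q) ^ 2) *
              ((u - p') ^ 2 + (v - q') ^ 2)) by ring,
          show t u' v' * t p' q' * κ * ((u' - p') ^ 2 + (v' - q') ^ 2) *
            (t u v * t p q * κ * ((u - p) ^ 2 + (v - q) ^ 2)) =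
            (t u' v' * t p q * κ * (t u v * t p' q' * κ)) * (((u' - p') ^ 2 + (v' - q') ^ 2) *
              ((u - p) ^ 2 + (v - q) ^ 2)) by ring,
          mul_div_mul_left _ _ (by positivity)]
      rwa [e] at this
  have hf : ∀ b, 0 < b → ℬ f₁ b := by
    intro b hb
    have c0 := hcr hZ₀ hf₁ hEZ₀ hF₁
    have h1 := (tr' hZ₀ hf₁ hEZ₀ hF₁ a₀ ha₀).1 hA
    have hd := div_pos c0 ha₀
    have := ((hall (b / (cr X Y Z₀ f₁ / a₀)) (by positivity)).2 _ hd).1 h1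
    rwa [div_mul_cancel₀ _ hd.ne'] at this
  have hAll : ∀ Z ∈ Sph X Y, E Z → ∀ a, 0 < a → 𝒜 Z a := fun Z hZ hE a ha =>
    (tr' hZ hf₁ hE hF₁ a ha).2 (hf _ (div_pos (hcr hZ hf₁ hE hF₁) ha))
  exact ⟨hAll, fun Z hZ hE b hb => (tr'' he₁ hZ hE₁ hE b hb).1
    (hAll e₁ he₁ hE₁ _ (div_pos (hcr he₁ hZ hE₁ hE) hb))⟩

end
end Coherency

namespace Coherency

variable {T : Type*} {r : T → T → Prop}

/-! ### Configurations in the target -/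

/-- `x ≁ y` and `u ≠ v` are common neighbours of `x` and `y`. -/
structure Quad (r : T → T → Prop) (x y u v : T) : Prop where
  gq : IsGQ r
  nxy : ¬ r x y
  ux : r u x
  uy : r u y
  vx : r v x
  vy : r v y
  ne : u ≠ v

section
variable {x y u v : T}

theorem Quad.symm (q : Quad r x y u v) : Quad r y x v u :=
  ⟨q.gq, fun h => q.nxy (q.gq.symm h), q.vy, q.vx, q.uy, q.ux, q.ne.symm⟩

theorem Quad.swap (q : Quad r x y u v) : Quad r y x u v :=
  ⟨q.gq, fun h => q.nxy (q.gq.symm h), q.uy, q.ux, q.vy, q.vx, q.ne⟩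

theorem Quad.ne_xu (q : Quad r x y u v) : x ≠ u := fun h => q.nxy (h ▸ q.uy)

theorem Quad.no_common (q : Quad r x y u v) {h : T} (hx : r h x) (hu : r h u) (hv : r h v)
    (hy : r h y) : False :=
  q.ne ((q.gq.eq_of q.nxy hx hy q.ux q.uy hu).symm.trans (q.gq.eq_of q.nxy hx hy q.vx q.vy hv))

/-- A point of the line `vy` has a unique neighbour on the opposite line `xu`. -/
theorem Quad.unique (q : Quad r x y u v) {h h' k : T} (hx : r h x) (hu : r h u) (hx' : r h' x)
    (hu' : r h' u) (kv : r k v) (ky : r k y) (hk : r k h) (hk' : r k h') : h = h' := by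
  by_contra hne
  have hh := q.gq.tri q.ne_xu (q.gq.symm q.ux) hx hu hx' hu'
  exact q.no_common (q.gq.tri hne hh hk hk' (q.gq.symm hx) (q.gq.symm hx'))
    (q.gq.tri hne hh hk hk' (q.gq.symm hu) (q.gq.symm hu')) kv ky

/-- `w` lies on the transversal joining `h ∈ xu` and `n ∈ vy`. -/
structure Quad.Trans (q : Quad r x y u v) (w h n : T) : Prop where
  hx : r h x
  hu : r h u
  nv : r n v
  ny : r n y
  hn : r h n
  wh : r w h
  wn : r w n

theorem Quad.Trans.hne {q : Quad r x y u v} {w h n : T} (t : q.Trans w h n) : h ≠ n := by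
  rintro rfl; exact q.no_common t.hx t.hu t.nv t.ny

theorem Quad.Trans.eq {q : Quad r x y u v} {w w' h n n' : T} (t : q.Trans w h n)
    (t' : q.Trans w' h n') : n = n' :=
  q.symm.unique t.ny t.nv t'.ny t'.nv t.hu t.hx t.hn t'.hn

theorem Quad.Trans.coh {q : Quad r x y u v} {w w' h n n' : T} (t : q.Trans w h n)
    (t' : q.Trans w' h n') : r w w' := by
  have := t.eq t'
  subst this
  exact q.gq.tri t.hne t.hn t.wh t.wn t'.wh t'.wn

theorem Quad.Trans.disjoint {q : Quad r x y u v} {w h n h' n' : T} (t : q.Trans w h n)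
    (t' : q.Trans w h' n') : h = h' := by
  by_contra hne
  have hh := q.gq.tri q.ne_xu (q.gq.symm q.ux) t.hx t.hu t'.hx t'.hu
  have hnn : n ≠ n' := by
    rintro rfl
    exact hne (q.unique t.hx t.hu t'.hx t'.hu t.nv t.ny (q.gq.symm t.hn) (q.gq.symm t'.hn))
  have nn := q.gq.tri q.symm.ne_xu (q.gq.symm q.vy) t.ny t.nv t'.ny t'.nv
  exact q.no_common (q.gq.tri hne hh t.wh t'.wh (q.gq.symm t.hx) (q.gq.symm t'.hx))
    (q.gq.tri hne hh t.wh t'.wh (q.gq.symm t.hu) (q.gq.symm t'.hu))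
    (q.gq.tri hnn nn t.wn t'.wn (q.gq.symm t.nv) (q.gq.symm t'.nv))
    (q.gq.tri hnn nn t.wn t'.wn (q.gq.symm t.ny) (q.gq.symm t'.ny))

/-- The two families of transversals: no triangle in a grid. -/
theorem Quad.no_grid (q : Quad r x y u v) {w₁₁ w₁₂ w₂₂ h₁ h₂ n₁₁ n₁₂ n₂₂ k₁ k₂ m₁₁ m₁₂ m₂₂ : T}
    (t₁₁ : q.Trans w₁₁ h₁ n₁₁) (t₁₂ : q.Trans w₁₂ h₁ n₁₂) (t₂₂ : q.Trans w₂₂ h₂ n₂₂)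
    (s₁₁ : q.swap.Trans w₁₁ k₁ m₁₁) (s₁₂ : q.swap.Trans w₁₂ k₂ m₁₂)
    (s₂₂ : q.swap.Trans w₂₂ k₂ m₂₂) (hw : r w₁₁ w₂₂) (hh : h₁ ≠ h₂) (hk : k₁ ≠ k₂) : False := by
  have hne : w₁₁ ≠ w₁₂ := by
    rintro rfl
    exact hk (s₁₁.disjoint s₁₂)
  have hc := t₁₁.coh t₁₂
  have hc' := s₂₂.coh s₁₂
  have hn := t₁₁.eq t₁₂
  subst hn
  have g := q.gq
  refine hh (Quad.Trans.disjoint (q := q) (w := w₂₂) ⟨t₁₁.hx, t₁₁.hu, t₁₁.nv, t₁₁.ny, t₁₁.hn,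
    g.tri hne hc (g.symm hw) hc' (g.symm t₁₁.wh) (g.symm t₁₂.wh),
    g.tri hne hc (g.symm hw) hc' (g.symm t₁₁.wn) (g.symm t₁₂.wn)⟩ t₂₂)

end

/-! ### Two values on the sphere -/

section
variable {X Y : Mink} {φ : Mink → T}

theorem Pres.sph (hφ : Pres r φ (Dia X Y)) (hXY : 0 < mq (X - Y)) {Z : Mink} (hZ : Z ∈ Sph X Y) :
    r (φ Z) (φ X) ∧ r (φ Z) (φ Y) :=
  ⟨hφ _ (mem_Dia_of_Sph hXY hZ) _ (left_mem_Dia hXY) hZ.1,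
    hφ _ (mem_Dia_of_Sph hXY hZ) _ (right_mem_Dia hXY) hZ.2⟩

theorem Pres.pt (hφ : Pres r φ (Dia X Y)) (hXY : 0 < mq (X - Y)) {Z : Mink} (hZ : Z ∈ Sph X Y)
    {a : ℝ} (ha : 0 ≤ a) : r (φ (pt Z X a)) (φ X) ∧ r (φ (pt Z X a)) (φ Z) :=
  ⟨hφ _ (pt_mem_Dia hXY hZ ha) _ (left_mem_Dia hXY) (coh_pt_left hZ ha),
    hφ _ (pt_mem_Dia hXY hZ ha) _ (mem_Dia_of_Sph hXY hZ) (coh_pt_self hZ ha)⟩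

theorem Pres.comm (hφ : Pres r φ (Dia X Y)) : Pres r φ (Dia Y X) := by rwa [Dia_comm]

theorem pos_comm (hXY : 0 < mq (X - Y)) : 0 < mq (Y - X) := by rwa [mq_sub_comm]

theorem Pres.pt' (hφ : Pres r φ (Dia X Y)) (hXY : 0 < mq (X - Y)) {Z : Mink} (hZ : Z ∈ Sph X Y)
    {a : ℝ} (ha : 0 ≤ a) : r (φ (Coherency.pt Z Y a)) (φ Y) ∧ r (φ (Coherency.pt Z Y a)) (φ Z) :=
  hφ.comm.pt (pos_comm hXY) (mem_Sph_comm.1 hZ) ha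

theorem Pres.pt_pt (hφ : Pres r φ (Dia X Y)) (hXY : 0 < mq (X - Y)) {Z Z' : Mink}
    (hZ : Z ∈ Sph X Y) (hZ' : Z' ∈ Sph X Y) {a b : ℝ} (ha : 0 ≤ a) (hb : 0 ≤ b)
    (hab : a * b = cr X Y Z Z') : r (φ (Coherency.pt Z X a)) (φ (Coherency.pt Z' Y b)) :=
  hφ _ (pt_mem_Dia hXY hZ ha) _ (pt_mem_Dia' hXY hZ' hb) ((coh_pt_pt hXY hZ hZ' ha hb).2 hab)

theorem Pres.mid (hφ : Pres r φ (Dia X Y)) (hXY : 0 < mq (X - Y)) {Z W : Mink} (hZ : Z ∈ Sph X Y)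
    (hW : W ∈ Mid X Y) : ∃ a, 0 < a ∧ r (φ W) (φ (Coherency.pt Z X a)) :=
  ⟨_, (Mid_coh hW hZ).1, hφ _ (Mid_subset_Dia hW) _ (pt_mem_Dia hXY hZ (Mid_coh hW hZ).1.le)
    (Mid_coh hW hZ).2⟩

theorem Pres.mid' (hφ : Pres r φ (Dia X Y)) (hXY : 0 < mq (X - Y)) {Z W : Mink} (hZ : Z ∈ Sph X Y)
    (hW : W ∈ Mid X Y) : ∃ a, 0 < a ∧ r (φ W) (φ (Coherency.pt Z Y a)) :=
  hφ.comm.mid (pos_comm hXY) (mem_Sph_comm.1 hZ) (by rwa [Mid_comm])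

/-- Two values on the sphere, each taken at least twice. -/
theorem clique_of_two_values (G : IsGQ r) (hXY : 0 < mq (X - Y)) (hφ : Pres r φ (Dia X Y))
    (hg : ¬ r (φ X) (φ Y)) {u v : T} (huv : u ≠ v) (hval : ∀ Z ∈ Sph X Y, φ Z = u ∨ φ Z = v)
    {e₁ e₂ f₁ f₂ : Mink} (he₁ : e₁ ∈ Sph X Y) (he₂ : e₂ ∈ Sph X Y) (hf₁ : f₁ ∈ Sph X Y)
    (hf₂ : f₂ ∈ Sph X Y) (hE₁ : φ e₁ = u) (hE₂ : φ e₂ = u) (hF₁ : φ f₁ = v) (hF₂ : φ f₂ = v)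
    (hne : e₁ ≠ e₂) (hnf : f₁ ≠ f₂) : ∀ W ∈ Mid X Y, ∀ W' ∈ Mid X Y, r (φ W) (φ W') := by
  have q : Quad r (φ X) (φ Y) u v := by
    refine ⟨G, hg, ?_, ?_, ?_, ?_, huv⟩
    · rw [← hE₁]; exact (hφ.sph hXY he₁).1
    · rw [← hE₁]; exact (hφ.sph hXY he₁).2
    · rw [← hF₁]; exact (hφ.sph hXY hf₁).1
    · rw [← hF₁]; exact (hφ.sph hXY hf₁).2
  have hX : ∀ Z ∈ Sph X Y, φ Z = u → ∀ a, 0 < a → r (φ (pt Z X a)) (φ X) ∧ r (φ (pt Z X a)) u :=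
    fun Z hZ hu a ha => by rw [← hu]; exact hφ.pt hXY hZ ha.le
  have hY : ∀ Z ∈ Sph X Y, ¬ φ Z = u → ∀ a, 0 < a → r (φ (pt Z Y a)) (φ Y) ∧ r (φ (pt Z Y a)) v :=
    fun Z hZ hu a ha => by
      rw [← (hval Z hZ).resolve_left hu]; exact hφ.pt' hXY hZ ha.le
  obtain ⟨h1, h2⟩ := transfer hXY (E := fun Z => φ Z = u) he₁ he₂ hf₁ hf₂ hE₁ hE₂
    (by rw [hF₁]; exact huv.symm) (by rw [hF₂]; exact huv.symm) hne hnf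
    (𝒜 := fun Z a => φ (pt Z X a) = φ (pt e₁ X 1)) (ℬ := fun Z b => r (φ (pt Z Y b)) (φ (pt e₁ X 1)))
    (fun Z hZ Z' hZ' hu hv a b ha hb hab => by
      have hc := G.symm (hφ.pt_pt hXY hZ hZ' ha.le hb.le hab)
      constructor
      · intro h; rw [← h]; exact hc
      · intro h
        exact q.unique (hX Z hZ hu a ha).1 (hX Z hZ hu a ha).2 (hX e₁ he₁ hE₁ 1 one_pos).1
          (hX e₁ he₁ hE₁ 1 one_pos).2 (hY Z' hZ' hv b hb).2 (hY Z' hZ' hv b hb).1 hc h)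
    he₁ hE₁ one_pos rfl
  have hnf₁ : ¬ φ f₁ = u := by rw [hF₁]; exact huv.symm
  have ht : ∀ W ∈ Mid X Y, ∃ n, q.Trans (φ W) (φ (pt e₁ X 1)) n := by
    intro W hW
    obtain ⟨a, ha, hwa⟩ := hφ.mid hXY he₁ hW
    obtain ⟨b, hb, hwb⟩ := hφ.mid' hXY hf₁ hW
    rw [h1 e₁ he₁ hE₁ a ha] at hwa
    exact ⟨φ (pt f₁ Y b), (hX e₁ he₁ hE₁ 1 one_pos).1, (hX e₁ he₁ hE₁ 1 one_pos).2,
      (hY f₁ hf₁ hnf₁ b hb).2, (hY f₁ hf₁ hnf₁ b hb).1, G.symm (h2 f₁ hf₁ hnf₁ b hb), hwa, hwb⟩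
  intro W hW W' hW'
  obtain ⟨n, t⟩ := ht W hW
  obtain ⟨n', t'⟩ := ht W' hW'
  exact t.coh t'

/-! ### Three values on the sphere -/

/-- `φ` takes at least three values on `Sph X Y`. -/
def Three (φ : Mink → T) (X Y : Mink) : Prop :=
  ∃ Z₁ ∈ Sph X Y, ∃ Z₂ ∈ Sph X Y, ∃ Z₃ ∈ Sph X Y, φ Z₁ ≠ φ Z₂ ∧ φ Z₁ ≠ φ Z₃ ∧ φ Z₂ ≠ φ Z₃

theorem Three.comm (h : Three φ X Y) : Three φ Y X := by
  rwa [Three, Sph_comm]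

theorem Three.exists_ne (h : Three φ X Y) (u v : T) : ∃ Z ∈ Sph X Y, φ Z ≠ u ∧ φ Z ≠ v := by
  obtain ⟨Z₁, h₁, Z₂, h₂, Z₃, h₃, h12, h13, h23⟩ := h
  by_cases a1 : φ Z₁ ≠ u ∧ φ Z₁ ≠ v
  · exact ⟨_, h₁, a1⟩
  by_cases a2 : φ Z₂ ≠ u ∧ φ Z₂ ≠ v
  · exact ⟨_, h₂, a2⟩
  refine ⟨_, h₃, ?_, ?_⟩ <;> rintro rfl <;> grind

theorem collapse_iff (G : IsGQ r) (hXY : 0 < mq (X - Y)) (hφ : Pres r φ (Dia X Y))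
    (hg : ¬ r (φ X) (φ Y)) {Z Z' : Mink} (hZ : Z ∈ Sph X Y) (hZ' : Z' ∈ Sph X Y)
    (hne : φ Z ≠ φ Z') {a b : ℝ} (ha : 0 < a) (hb : 0 < b) (hab : a * b = cr X Y Z Z') :
    φ (pt Z X a) = φ Z ↔ φ (pt Z' Y b) = φ Y := by
  have hc := hφ.pt_pt hXY hZ hZ' ha.le hb.le hab
  have zx := (hφ.sph hXY hZ).1
  have zy := (hφ.sph hXY hZ).2
  have zx' := (hφ.sph hXY hZ').1
  have zy' := (hφ.sph hXY hZ').2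
  constructor
  · intro h
    rw [h] at hc
    by_contra hn
    obtain ⟨p1, p2⟩ := hφ.pt' hXY hZ' hb.le
    exact hne (G.eq_of hg zx zy zx' zy' (G.tri hn p1 hc zy (G.symm p2) zy'))
  · intro h
    rw [h] at hc
    obtain ⟨p1, p2⟩ := hφ.pt hXY hZ ha.le
    exact G.eq_of hg p1 hc zx zy p2

/-- A collapsed segment on one line through `X` forces all of them to collapse. -/
theorem collapse_all (G : IsGQ r) (hXY : 0 < mq (X - Y)) (hφ : Pres r φ (Dia X Y))
    (hg : ¬ r (φ X) (φ Y)) (h3 : Three φ X Y) {Z₀ : Mink} (hZ₀ : Z₀ ∈ Sph X Y) {a₀ : ℝ}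
    (ha₀ : 0 < a₀) (hc : φ (pt Z₀ X a₀) = φ Z₀) :
    ∀ Z ∈ Sph X Y, ∀ a, 0 < a → φ (pt Z X a) = φ Z := by
  have hpart : ∃ C : T → Prop, C (φ Z₀) ∧ (∃ e ∈ Sph X Y, C (φ e) ∧ Z₀ ≠ e) ∧
      ∃ f₁ ∈ Sph X Y, ∃ f₂ ∈ Sph X Y, ¬ C (φ f₁) ∧ ¬ C (φ f₂) ∧ f₁ ≠ f₂ := by
    obtain ⟨Z₁, h₁, h10, -⟩ := h3.exists_ne (φ Z₀) (φ Z₀)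
    obtain ⟨Z₂, h₂, h20, h21⟩ := h3.exists_ne (φ Z₀) (φ Z₁)
    by_cases hA : ∃ e ∈ Sph X Y, φ e = φ Z₀ ∧ Z₀ ≠ e
    · exact ⟨fun t => t = φ Z₀, rfl, hA, Z₁, h₁, Z₂, h₂, h10, h20, fun h => h21 (h ▸ rfl)⟩
    push Not at hA
    by_cases hB : ∃ Z₃ ∈ Sph X Y, Z₂ ≠ Z₃ ∧ φ Z₃ ≠ φ Z₀ ∧ φ Z₃ ≠ φ Z₁
    · obtain ⟨Z₃, h₃, h23, h30, h31⟩ := hB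
      refine ⟨fun t => t = φ Z₀ ∨ t = φ Z₁, Or.inl rfl, ⟨Z₁, h₁, Or.inr rfl, fun h => h10 (h ▸ rfl)⟩,
        Z₂, h₂, Z₃, h₃, ?_, ?_, h23⟩ <;> push Not <;> constructor <;> assumption
    push Not at hB
    obtain ⟨Z₃, h₃, hn⟩ := (Sph_infinite hXY).exists_notMem_finset {Z₀, Z₁, Z₂}
    simp only [Finset.mem_insert, Finset.mem_singleton, not_or] at hn
    have h30 : φ Z₃ ≠ φ Z₀ := fun h => hn.1 (hA Z₃ h₃ h).symm
    have h31 : φ Z₃ = φ Z₁ := hB Z₃ h₃ (Ne.symm hn.2.2) h30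
    refine ⟨fun t => t = φ Z₀ ∨ t = φ Z₂, Or.inl rfl, ⟨Z₂, h₂, Or.inr rfl, fun h => h20 (h ▸ rfl)⟩,
        Z₁, h₁, Z₃, h₃, ?_, ?_, Ne.symm hn.2.1⟩ <;> push Not
    · exact ⟨h10, h21.symm⟩
    · exact ⟨h30, h31 ▸ h21.symm⟩
  obtain ⟨C, hC₀, ⟨e, he, hCe, hne⟩, f₁, hf₁, f₂, hf₂, hCf₁, hCf₂, hnf⟩ := hpart
  obtain ⟨hA, hB⟩ := transfer hXY (E := fun Z => C (φ Z)) hZ₀ he hf₁ hf₂ hC₀ hCe hCf₁ hCf₂ hne hnf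
    (𝒜 := fun Z a => φ (pt Z X a) = φ Z) (ℬ := fun Z b => φ (pt Z Y b) = φ Y)
    (fun Z hZ Z' hZ' h1 h2 a b ha hb hab =>
      collapse_iff G hXY hφ hg hZ hZ' (fun h => h2 (by show C (φ Z'); rw [← h]; exact h1)) ha hb hab)
    hZ₀ hC₀ ha₀ hc
  have hne_of : ∀ {Z Z'}, φ Z ≠ φ Z' → Z ≠ Z' := fun h h' => h (h' ▸ rfl)
  have getA : ∀ Z ∈ Sph X Y, ∀ Z' ∈ Sph X Y, φ Z ≠ φ Z' → (∀ b, 0 < b → φ (pt Z' Y b) = φ Y) →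
      ∀ a, 0 < a → φ (pt Z X a) = φ Z := fun Z hZ Z' hZ' hn h a ha => by
    have hp := cr_pos hXY hZ hZ' (hne_of hn)
    exact (collapse_iff G hXY hφ hg hZ hZ' hn ha (div_pos hp ha) (mul_div_cancel₀ _ ha.ne')).2
      (h _ (div_pos hp ha))
  have getB : ∀ Z ∈ Sph X Y, ∀ Z' ∈ Sph X Y, φ Z ≠ φ Z' → (∀ b, 0 < b → φ (pt Z X b) = φ Z) →
      ∀ b, 0 < b → φ (pt Z' Y b) = φ Y := fun Z hZ Z' hZ' hn h b hb => by
    have hp := cr_pos hXY hZ hZ' (hne_of hn)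
    exact (collapse_iff G hXY hφ hg hZ hZ' hn (div_pos hp hb) hb (div_mul_cancel₀ _ hb.ne')).1
      (h _ (div_pos hp hb))
  intro Z hZ
  by_cases hCZ : C (φ Z)
  · exact hA Z hZ hCZ
  by_cases hex : ∃ Z' ∈ Sph X Y, ¬ C (φ Z') ∧ φ Z ≠ φ Z'
  · obtain ⟨Z', hZ', hCZ', hn⟩ := hex
    exact getA Z hZ Z' hZ' hn (hB Z' hZ' hCZ')
  push Not at hex
  obtain ⟨Z₁, h₁, h1, -⟩ := h3.exists_ne (φ Z) (φ Z)
  obtain ⟨Z₂, h₂, h2, h21⟩ := h3.exists_ne (φ Z) (φ Z₁)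
  have hC₁ : C (φ Z₁) := by by_contra h; exact h1 (hex Z₁ h₁ h).symm
  exact getA Z hZ Z₂ h₂ h2.symm (getB Z₁ h₁ Z₂ h₂ h21.symm (hA Z₁ h₁ hC₁))

theorem clique_of_collapse (G : IsGQ r) (hXY : 0 < mq (X - Y)) (hφ : Pres r φ (Dia X Y))
    (hg : ¬ r (φ X) (φ Y)) (h3 : Three φ X Y) {Z₀ : Mink} (hZ₀ : Z₀ ∈ Sph X Y) {a₀ : ℝ}
    (ha₀ : 0 < a₀) (hc : φ (pt Z₀ X a₀) = φ Z₀) :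
    ∀ W ∈ Mid X Y, ∀ W' ∈ Mid X Y, r (φ W) (φ W') := by
  have hall := collapse_all G hXY hφ hg h3 hZ₀ ha₀ hc
  obtain ⟨Z₁, h₁, hn, -⟩ := h3.exists_ne (φ Z₀) (φ Z₀)
  have key : ∀ W ∈ Mid X Y, r (φ W) (φ Z₀) ∧ r (φ W) (φ Y) := by
    intro W hW
    obtain ⟨a, ha, hwa⟩ := hφ.mid hXY hZ₀ hW
    obtain ⟨b, hb, hwb⟩ := hφ.mid' hXY h₁ hW
    rw [hall _ hZ₀ a ha] at hwa
    have hp := cr_pos hXY hZ₀ h₁ (fun h => hn (h ▸ rfl))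
    rw [(collapse_iff G hXY hφ hg hZ₀ h₁ hn.symm (div_pos hp hb) hb (div_mul_cancel₀ _ hb.ne')).1
      (hall _ hZ₀ _ (div_pos hp hb))] at hwb
    exact ⟨hwa, hwb⟩
  intro W hW W' hW'
  have hz := hφ.sph hXY hZ₀
  exact G.tri (fun h => hg (G.symm (by rw [← h]; exact hz.1))) hz.2 (key W hW).1 (key W hW).2
    (key W' hW').1 (key W' hW').2

/-- The nondegenerate pairs. -/
structure ND3 (r : T → T → Prop) (φ : Mink → T) (X Y : Mink) : Prop where
  tl : 0 < mq (X - Y)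
  good : ¬ r (φ X) (φ Y)
  three : Three φ X Y
  injX : ∀ Z ∈ Sph X Y, ∀ a b, 0 ≤ a → 0 ≤ b → φ (pt Z X a) = φ (pt Z X b) → a = b
  neX : ∀ Z ∈ Sph X Y, ∀ a, 0 ≤ a → φ (pt Z X a) ≠ φ X
  injY : ∀ Z ∈ Sph X Y, ∀ a b, 0 ≤ a → 0 ≤ b → φ (pt Z Y a) = φ (pt Z Y b) → a = b
  neY : ∀ Z ∈ Sph X Y, ∀ a, 0 ≤ a → φ (pt Z Y a) ≠ φ Y

theorem ND3.comm (h : ND3 r φ X Y) (G : IsGQ r) : ND3 r φ Y X :=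
  ⟨pos_comm h.tl, fun h' => h.good (G.symm h'), h.three.comm, by rw [Sph_comm]; exact h.injY,
    by rw [Sph_comm]; exact h.neY, by rw [Sph_comm]; exact h.injX, by rw [Sph_comm]; exact h.neX⟩

/-- `pt Z₂ Y b` sees the lines through `X` at the corresponding points. -/
theorem mem_Sph_pt (hXY : 0 < mq (X - Y)) {Z Z₂ : Mink} (hZ : Z ∈ Sph X Y) (hZ₂ : Z₂ ∈ Sph X Y)
    {a b : ℝ} (ha : 0 ≤ a) (hb : 0 ≤ b) (hab : a * b = cr X Y Z Z₂) :
    pt Z X a ∈ Sph X (pt Z₂ Y b) :=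
  ⟨coh_pt_left hZ ha, (coh_pt_pt hXY hZ hZ₂ ha hb).2 hab⟩

theorem self_mem_Sph_pt {Z₂ : Mink} (hZ₂ : Z₂ ∈ Sph X Y) {b : ℝ} (hb : 0 ≤ b) :
    Z₂ ∈ Sph X (pt Z₂ Y b) :=
  ⟨hZ₂.1, by rw [mq_sub_comm]; exact coh_pt_self (mem_Sph_comm.1 hZ₂) hb⟩

theorem tl_pt (hXY : 0 < mq (X - Y)) {Z₂ : Mink} (hZ₂ : Z₂ ∈ Sph X Y) {b : ℝ} (hb : 0 < b) :
    0 < mq (X - pt Z₂ Y b) := by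
  rw [mq_left_pt hZ₂ hb.le]; positivity

theorem good_pt (G : IsGQ r) (hXY : 0 < mq (X - Y)) (hφ : Pres r φ (Dia X Y))
    (hg : ¬ r (φ X) (φ Y)) {Z₂ : Mink} (hZ₂ : Z₂ ∈ Sph X Y) {b : ℝ} (hb : 0 < b)
    (hn : φ (pt Z₂ Y b) ≠ φ Z₂) : ¬ r (φ X) (φ (pt Z₂ Y b)) := by
  intro h
  obtain ⟨p1, p2⟩ := hφ.pt' hXY hZ₂ hb.le
  obtain ⟨p3, p4⟩ := hφ.sph hXY hZ₂
  exact hn (G.eq_of hg (G.symm h) p1 p3 p4 p2)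

theorem three_pt (G : IsGQ r) (hXY : 0 < mq (X - Y)) (hφ : Pres r φ (Dia X Y))
    (hg : ¬ r (φ X) (φ Y)) (h3 : Three φ X Y) {Z₂ : Mink} (hZ₂ : Z₂ ∈ Sph X Y) {b : ℝ} (hb : 0 < b)
    (hn : φ (pt Z₂ Y b) ≠ φ Z₂) : Three φ X (pt Z₂ Y b) := by
  obtain ⟨Z, hZ, hz2, -⟩ := h3.exists_ne (φ Z₂) (φ Z₂)
  obtain ⟨Z', hZ', hz2', hzz'⟩ := h3.exists_ne (φ Z₂) (φ Z)
  have hg' := good_pt G hXY hφ hg hZ₂ hb hn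
  have hp : ∀ {Z}, Z ∈ Sph X Y → φ Z ≠ φ Z₂ → 0 < cr X Y Z Z₂ / b := fun h1 h2 =>
    div_pos (cr_pos hXY h1 hZ₂ fun h => h2 (h ▸ rfl)) hb
  have nadj : ∀ {Z Z'}, Z ∈ Sph X Y → Z' ∈ Sph X Y → φ Z ≠ φ Z' → ¬ r (φ Z) (φ Z') := fun h1 h2 h h' =>
    h (G.eq_of hg (hφ.sph hXY h1).1 (hφ.sph hXY h1).2 (hφ.sph hXY h2).1 (hφ.sph hXY h2).2 h')
  have hxne : ∀ {Z} (h : Z ∈ Sph X Y) (h2 : φ Z ≠ φ Z₂), φ (pt Z X (cr X Y Z Z₂ / b)) ≠ φ X :=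
    fun h h2 h' => hg' (by
      rw [← h']; exact hφ.pt_pt hXY h hZ₂ (hp h h2).le hb.le (div_mul_cancel₀ _ hb.ne'))
  refine ⟨Z₂, self_mem_Sph_pt hZ₂ hb.le, _,
    mem_Sph_pt hXY hZ hZ₂ (hp hZ hz2).le hb.le (div_mul_cancel₀ _ hb.ne'), _,
    mem_Sph_pt hXY hZ' hZ₂ (hp hZ' hz2').le hb.le (div_mul_cancel₀ _ hb.ne'), ?_, ?_, ?_⟩
  · intro h
    have := (hφ.pt hXY hZ (hp hZ hz2).le).2
    rw [← h] at this
    exact nadj hZ₂ hZ hz2.symm this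
  · intro h
    have := (hφ.pt hXY hZ' (hp hZ' hz2').le).2
    rw [← h] at this
    exact nadj hZ₂ hZ' hz2'.symm this
  · intro h
    obtain ⟨p1, p2⟩ := hφ.pt hXY hZ (hp hZ hz2).le
    obtain ⟨p3, p4⟩ := hφ.pt hXY hZ' (hp hZ' hz2').le
    rw [← h] at p3 p4
    exact nadj hZ hZ' hzz'.symm (G.tri (hxne hZ hz2) p1 (G.symm p2) (hφ.sph hXY hZ).1 (G.symm p4)
      (hφ.sph hXY hZ').1)

theorem injX_of_ne (G : IsGQ r) (hXY : 0 < mq (X - Y)) (hφ : Pres r φ (Dia X Y))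
    (hg : ¬ r (φ X) (φ Y)) (h3 : Three φ X Y)
    (n1 : ∀ Z ∈ Sph X Y, ∀ a, 0 < a → φ (pt Z X a) ≠ φ Z)
    (n2 : ∀ Z ∈ Sph X Y, ∀ a, 0 < a → φ (pt Z Y a) ≠ φ Z) :
    (∀ Z ∈ Sph X Y, ∀ a b, 0 ≤ a → 0 ≤ b → φ (pt Z X a) = φ (pt Z X b) → a = b) ∧
    (∀ Z ∈ Sph X Y, ∀ a, 0 ≤ a → φ (pt Z X a) ≠ φ X) := by
  have hg' : ¬ r (φ Y) (φ X) := fun h => hg (G.symm h)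
  have hlt : ∀ Z ∈ Sph X Y, ∀ a b, 0 ≤ a → a < b → φ (pt Z X a) ≠ φ (pt Z X b) := by
    intro Z hZ a b ha hab h
    rcases ha.lt_or_eq with ha | ha
    swap
    · subst ha; rw [pt_zero] at h; exact n1 Z hZ b hab h.symm
    obtain ⟨Z₂, hZ₂, hz2, -⟩ := h3.exists_ne (φ Z) (φ Z)
    have hp := cr_pos hXY hZ hZ₂ (fun h => hz2 (h ▸ rfl))
    have hβ := div_pos hp ha
    set β := cr X Y Z Z₂ / a
    have hab' : a * β = cr X Y Z Z₂ := mul_div_cancel₀ _ ha.ne'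
    have hn := n2 Z₂ hZ₂ β hβ
    have htl := tl_pt hXY hZ₂ hβ
    have hφ' : Pres r φ (Dia X (pt Z₂ Y β)) :=
      hφ.mono (Dia_subset hXY (pt_mem_Dia' hXY hZ₂ hβ.le) htl)
    have e : pt (pt Z X a) X ((b - a) / (1 + a)) = pt Z X b := by
      rw [pt_pt ha.le (div_nonneg (by linarith) (by linarith))]
      congr 1; field_simp; ring
    have := collapse_all G htl hφ' (good_pt G hXY hφ hg hZ₂ hβ hn) (three_pt G hXY hφ hg h3 hZ₂ hβ hn)
      (mem_Sph_pt hXY hZ hZ₂ ha.le hβ.le hab') (a₀ := (b - a) / (1 + a))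
      (div_pos (by linarith) (by linarith)) (by rw [e, h]) Z₂ (self_mem_Sph_pt hZ₂ hβ.le) 1 one_pos
    exact n1 Z₂ hZ₂ 1 one_pos this
  refine ⟨fun Z hZ a b ha hb h => ?_, fun Z hZ a ha h => ?_⟩
  · rcases lt_trichotomy a b with hab | hab | hab
    · exact absurd h (hlt Z hZ a b ha hab)
    · exact hab
    · exact absurd h.symm (hlt Z hZ b a hb hab)
  · rcases ha.lt_or_eq with ha | ha
    swap
    · subst ha; rw [pt_zero] at h
      exact hg (by rw [← h]; exact (hφ.sph hXY hZ).2)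
    obtain ⟨Z₂, hZ₂, hz2, -⟩ := h3.exists_ne (φ Z) (φ Z)
    have hp := cr_pos hXY hZ hZ₂ (fun h => hz2 (h ▸ rfl))
    have hβ := div_pos hp ha
    refine n2 Z₂ hZ₂ _ hβ ((collapse_iff G (pos_comm hXY) hφ.comm hg' (mem_Sph_comm.1 hZ₂)
      (mem_Sph_comm.1 hZ) hz2 hβ ha ?_).2 h)
    rw [div_mul_cancel₀ _ ha.ne', cr_comm, cr_swap]

theorem nd3_of_ne (G : IsGQ r) (hXY : 0 < mq (X - Y)) (hφ : Pres r φ (Dia X Y))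
    (hg : ¬ r (φ X) (φ Y)) (h3 : Three φ X Y)
    (n1 : ∀ Z ∈ Sph X Y, ∀ a, 0 < a → φ (pt Z X a) ≠ φ Z)
    (n2 : ∀ Z ∈ Sph X Y, ∀ a, 0 < a → φ (pt Z Y a) ≠ φ Z) : ND3 r φ X Y := by
  obtain ⟨h1, h2⟩ := injX_of_ne G hXY hφ hg h3 n1 n2
  obtain ⟨h4, h5⟩ := injX_of_ne G (pos_comm hXY) hφ.comm (fun h => hg (G.symm h)) h3.comm
    (by rwa [Sph_comm]) (by rwa [Sph_comm])
  rw [Sph_comm] at h4 h5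
  exact ⟨hXY, hg, h3, h1, h2, h4, h5⟩

theorem nd3_of_three (G : IsGQ r) (hXY : 0 < mq (X - Y)) (hφ : Pres r φ (Dia X Y))
    (hg : ¬ r (φ X) (φ Y)) (h3 : Three φ X Y)
    (hcl : ¬ ∀ W ∈ Mid X Y, ∀ W' ∈ Mid X Y, r (φ W) (φ W')) : ND3 r φ X Y := by
  refine nd3_of_ne G hXY hφ hg h3 (fun Z hZ a ha h => hcl ?_) fun Z hZ a ha h => hcl ?_
  · exact clique_of_collapse G hXY hφ hg h3 hZ ha h
  · rw [Mid_comm]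
    exact clique_of_collapse G (pos_comm hXY) hφ.comm (fun h => hg (G.symm h)) h3.comm
      (mem_Sph_comm.1 hZ) ha h

end
end Coherency

namespace Coherency

variable {T : Type*} {r : T → T → Prop} {X Y : Mink} {φ : Mink → T}

/-! ### Two values on the sphere, one of them taken only once -/

theorem exists_opposite_of_fut (h : Fut (Y - X)) {W P₀ : Mink} (hW : W ∈ Mid X Y)
    (hP : P₀ ∈ Sph X Y) {a : ℝ} (ha : 0 < a) (hc : mq (W - pt P₀ X a) = 0) :
    ∃ N ∈ Dia X Y, ∃ P ∈ Sph X Y, P ≠ P₀ ∧ mq (N - pt P₀ X a) = 0 ∧ mq (W - N) = 0 ∧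
      mq (N - Y) = 0 ∧ mq (N - P) = 0 := by
  obtain ⟨h1, h2⟩ := (Mid_iff h).1 hW
  have hXY : 0 < mq (X - Y) := by rw [mq_sub_comm]; exact h.2
  set V := pt P₀ X a with hV
  obtain ⟨c1, c2⟩ := (Dia_iff h).1 (pt_mem_Dia hXY hP ha.le)
  have hVX : mq (V - X) = 0 := coh_pt_left hP ha.le
  have hYV : Fut (Y - V) := by
    refine c2.fut ?_
    rw [mq_left_pt (mem_Sph_comm.1 hP) ha.le, mq_sub_comm]
    positivity
  have hn0 : W - V ≠ 0 := by
    intro h0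
    rw [sub_eq_zero] at h0
    have := h1.2
    rw [h0, hVX] at this
    exact this.false
  have hn : NullF (W - V) := by
    rcases caus_or_neg hc.ge with h3 | h3
    · exact NullF.of_caus h3 hc hn0
    · have := (h3.add_fut h1).2
      rw [show -(W - V) + (W - X) = V - X by abel, hVX] at this
      exact absurd this (lt_irrefl _)
  obtain ⟨hs, hN, -⟩ := hYV.split hn
  set s := mq (Y - V) / mb (Y - V) (W - V) with hsdef
  set N := V + s • (W - V) with hNdef
  have hYN : Y - V - s • (W - V) = Y - N := by rw [hNdef]; abel
  rw [hYN] at hN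
  have hNV : N - V = s • (W - V) := by rw [hNdef]; abel
  obtain ⟨hs', hP', -⟩ := h.split hN
  set s' := mq (Y - X) / mb (Y - X) (Y - N) with hsdef'
  set P := Y - s' • (Y - N) with hPdef
  have hPX : Y - X - s' • (Y - N) = P - X := by rw [hPdef]; abel
  rw [hPX] at hP'
  have hNP : N - P = (s' - 1) • (Y - N) := by rw [hPdef]; module
  have q1 : mq (N - V) = 0 := by rw [hNV, mq_smul, hc, mul_zero]
  have q2 : mq (N - P) = 0 := by rw [hNP, mq_smul, hN.2.2.1, mul_zero]
  refine ⟨N, (Dia_iff h).2 ⟨?_, hN.caus⟩, P, ⟨hP'.2.2.1, ?_⟩, ?_, q1, ?_, ?_, q2⟩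
  · rw [show N - X = (V - X) + s • (W - V) by rw [hNdef]; abel]
    exact c1.add (hn.caus.smul hs.le)
  · rw [show P - Y = (-s') • (Y - N) by rw [hPdef]; module, mq_smul, hN.2.2.1, mul_zero]
  · intro hPP
    rw [hPP] at q2
    have e1 : V - X = (1 + a)⁻¹ • (P₀ - X) := pt_sub ha.le
    have e2 : N - P₀ = s • (W - V) + (-a * (1 + a)⁻¹) • (P₀ - X) := by
      have : V = X + (1 + a)⁻¹ • (P₀ - X) := by rw [← e1]; abel
      rw [hNdef, this]
      have h1a : 1 + a ≠ 0 := by positivity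
      match_scalars <;> field_simp <;> ring
    rw [e2, mq_add, mq_smul, mq_smul, hc, hP.1, mb_smul_left, mb_smul_right] at q2
    have q3 : mb (W - V) (P₀ - X) = 0 := by
      have : s * (-a * (1 + a)⁻¹) ≠ 0 := by
        have : 0 < 1 + a := by positivity
        exact mul_ne_zero hs.ne' (mul_ne_zero (neg_ne_zero.2 ha.ne') (inv_ne_zero this.ne'))
      have h0 : s * (-a * (1 + a)⁻¹) * mb (W - V) (P₀ - X) = 0 := by linarith
      exact (mul_eq_zero.1 h0).resolve_left this
    have q4 : mq (W - X) = 0 := by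
      rw [show W - X = (W - V) + (V - X) by abel, mq_add, hc, hVX, e1, mb_smul_right, q3]; ring
    exact h1.2.ne' q4
  · rw [show W - N = (1 - s) • (W - V) by rw [hNdef]; module, mq_smul, hc, mul_zero]
  · rw [mq_sub_comm]; exact hN.2.2.1

theorem exists_opposite (h : 0 < mq (X - Y)) {W P₀ : Mink} (hW : W ∈ Mid X Y)
    (hP : P₀ ∈ Sph X Y) {a : ℝ} (ha : 0 < a) (hc : mq (W - pt P₀ X a) = 0) :
    ∃ N ∈ Dia X Y, ∃ P ∈ Sph X Y, P ≠ P₀ ∧ mq (N - pt P₀ X a) = 0 ∧ mq (W - N) = 0 ∧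
      mq (N - Y) = 0 ∧ mq (N - P) = 0 := by
  rcases fut_or_fut h with h' | h'
  · exact exists_opposite_of_fut h' hW hP ha hc
  · have e : ∀ A B : Mink, mq (-A - -B) = mq (A - B) := fun A B => by
      rw [show -A - -B = -(A - B) by abel, mq_neg]
    have e' : ∀ A B C D : Mink, mb (-A - -B) (-C - -D) = mb (A - B) (C - D) := fun A B C D => by
      rw [show -A - -B = -(A - B) by abel, show -C - -D = -(C - D) by abel, mb_neg_left,
        mb_neg_right, neg_neg]
    have ept : pt (-P₀) (-X) a = -pt P₀ X a := by simp only [pt]; module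
    obtain ⟨N, hN, P, hP', hne, h1, h2, h3, h4⟩ :=
      exists_opposite_of_fut (X := -X) (Y := -Y) (W := -W) (P₀ := -P₀) (a := a)
        (by rwa [show -Y - -X = X - Y by abel])
        ⟨by rw [e]; exact hW.1, by rw [e]; exact hW.2.1, by rw [e']; exact hW.2.2⟩
        ⟨by rw [e]; exact hP.1, by rw [e]; exact hP.2⟩ ha (by rw [ept, e]; exact hc)
    have en : ∀ A B : Mink, mq (-A - B) = mq (A - -B) := fun A B => by
      rw [← e A (-B), neg_neg]
    refine ⟨-N, ⟨?_, ?_, ?_⟩, -P, ⟨?_, ?_⟩, fun h => hne (by rw [← h, neg_neg]), ?_, ?_, ?_, ?_⟩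
    · rw [en]; exact hN.1
    · rw [en]; exact hN.2.1
    · have := hN.2.2
      rw [← e', neg_neg, neg_neg] at this; exact this
    · rw [en]; exact hP'.1
    · rw [en]; exact hP'.2
    · rw [en, ← ept]; exact h1
    · rw [← en]; exact h2
    · rw [en]; exact h3
    · rw [e]; exact h4

theorem exists_grid (h : Fut (Y - X)) {P₀ : Mink} (hP : P₀ ∈ Sph X Y) {a₁ a₂ b₁ b₂ : ℝ}
    (ha₂ : 0 < a₂) (ha : a₂ < a₁) (hb₁ : 0 < b₁) (hb : b₁ < b₂) :
    ∃ W₁₁ ∈ Mid X Y, ∃ W₁₂ ∈ Mid X Y, ∃ W₂₂ ∈ Mid X Y, mq (W₁₁ - W₂₂) = 0 ∧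
      mq (W₁₁ - pt P₀ X a₁) = 0 ∧ mq (W₁₂ - pt P₀ X a₁) = 0 ∧ mq (W₂₂ - pt P₀ X a₂) = 0 ∧
      mq (W₁₁ - pt P₀ Y b₁) = 0 ∧ mq (W₁₂ - pt P₀ Y b₂) = 0 ∧ mq (W₂₂ - pt P₀ Y b₂) = 0 := by
  have hXY : 0 < mq (X - Y) := by rw [mq_sub_comm]; exact h.2
  obtain ⟨c1, c2⟩ := (Dia_iff h).1 (mem_Dia_of_Sph hXY hP)
  have hκ := mb_of_mem_Sph hP
  have hκ0 : 0 < mb (P₀ - X) (Y - P₀) := by rw [hκ]; exact h.2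
  have n1 : NullF (P₀ - X) := NullF.of_caus c1 hP.1 fun h0 => by
    rw [h0, mb_zero_left] at hκ0; exact hκ0.false
  have n2 : NullF (Y - P₀) := NullF.of_caus c2 (by rw [mq_sub_comm]; exact hP.2) fun h0 => by
    rw [h0, mb_zero_right] at hκ0; exact hκ0.false
  obtain ⟨m₁, m₂, F⟩ := exists_frame n1 n2 hκ0
  set κ := mb (P₀ - X) (Y - P₀)
  have hq : ∀ x y z : ℝ, mq (x • (P₀ - X) + y • (Y - P₀) + z • m₁) = κ * (x * y - z ^ 2) := by
    intro x y z
    rw [mq_add, mq_add, mq_smul, mq_smul, mq_smul, F.n1, F.n2, F.m1, mb_add_left, mb_smul_left,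
      mb_smul_left, mb_smul_left, mb_smul_right, mb_smul_right, mb_smul_right, F.n1m1, F.n2m1, F.n12]
    ring
  have hb' : ∀ x y z x' y' z' : ℝ, mb (x • (P₀ - X) + y • (Y - P₀) + z • m₁)
      (x' • (P₀ - X) + y' • (Y - P₀) + z' • m₁) = κ * (x * y' + x' * y - 2 * z * z') := by
    intro x y z x' y' z'
    have := mq_add (x • (P₀ - X) + y • (Y - P₀) + z • m₁) (x' • (P₀ - X) + y' • (Y - P₀) + z' • m₁)
    rw [show x • (P₀ - X) + y • (Y - P₀) + z • m₁ + (x' • (P₀ - X) + y' • (Y - P₀) + z' • m₁) =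
      (x + x') • (P₀ - X) + (y + y') • (Y - P₀) + (z + z') • m₁ by module, hq, hq, hq] at this
    linarith
  set w : ℝ → ℝ → ℝ → Mink := fun x y z => X + (x • (P₀ - X) + y • (Y - P₀) + z • m₁) with hw
  have hww : ∀ x y z x' y' z', mq (w x y z - w x' y' z') =
      κ * ((x - x') * (y - y') - (z - z') ^ 2) := by
    intro x y z x' y' z'
    rw [← hq]; congr 1; simp only [hw]; module
  have eX : X = w 0 0 0 := by simp [hw]
  have eY : Y = w 1 1 0 := by simp [hw]
  have ePX : ∀ a, 0 < a → pt P₀ X a = w (1 + a)⁻¹ 0 0 := by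
    intro a ha
    have := pt_sub (Z := P₀) (X := X) ha.le
    rw [sub_eq_iff_eq_add] at this
    rw [this]; simp [hw, add_comm]
  have ePY : ∀ b, 0 < b → pt P₀ Y b = w 1 (b / (1 + b)) 0 := by
    intro b hb
    have := pt_sub (Z := P₀) (X := Y) hb.le
    rw [sub_eq_iff_eq_add] at this
    have h1 : 1 + b ≠ 0 := by positivity
    rw [this]; simp only [hw]
    match_scalars <;> field_simp <;> ring
  have hmid : ∀ x y z, 0 < x * y - z ^ 2 → 0 < (1 - x) * (1 - y) - z ^ 2 →
      0 < x * (1 - y) + (1 - x) * y + 2 * z ^ 2 → w x y z ∈ Mid X Y := by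
    intro x y z h1 h2 h3
    refine ⟨?_, ?_, ?_⟩
    · rw [show w x y z - X = x • (P₀ - X) + y • (Y - P₀) + z • m₁ by simp [hw], hq]
      exact mul_pos F.pos h1
    · rw [show w x y z - Y = (x - 1) • (P₀ - X) + (y - 1) • (Y - P₀) + z • m₁ by
        simp only [hw]; module, hq]
      exact mul_pos F.pos (by nlinarith)
    · rw [show w x y z - X = x • (P₀ - X) + y • (Y - P₀) + z • m₁ by simp [hw],
        show Y - w x y z = (1 - x) • (P₀ - X) + (1 - y) • (Y - P₀) + (-z) • m₁ by
        simp only [hw]; module, hb']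
      exact mul_pos F.pos (by nlinarith)
  have hA₂ : 0 < 1 + a₂ := by linarith
  have hA₁ : 0 < 1 + a₁ := by linarith
  have hB₁ : 0 < 1 + b₁ := by linarith
  have hB₂ : 0 < 1 + b₂ := by linarith
  rw [ePX _ ha₂, ePX _ (ha₂.trans ha), ePY _ hb₁, ePY _ (hb₁.trans hb)]
  have i1 : 0 < (1 + a₁)⁻¹ := inv_pos.2 hA₁
  have i2 : (1 + a₁)⁻¹ < (1 + a₂)⁻¹ := inv_strictAnti₀ hA₂ (by linarith)
  have i3 : (1 + a₂)⁻¹ < 1 := inv_lt_one_of_one_lt₀ (by linarith)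
  have i4 : 0 < b₁ / (1 + b₁) := by positivity
  have i5 : b₁ / (1 + b₁) < b₂ / (1 + b₂) := by rw [div_lt_div_iff₀ hB₁ hB₂]; nlinarith
  have i6 : b₂ / (1 + b₂) < 1 := by rw [div_lt_one hB₂]; linarith
  generalize (1 + a₁)⁻¹ = s₁ at *
  generalize (1 + a₂)⁻¹ = s₂ at *
  generalize b₁ / (1 + b₁) = t₁ at *
  generalize b₂ / (1 + b₂) = t₂ at *
  have hD : 0 < t₁ * (1 - s₁) + (s₂ - s₁) * (t₂ - t₁) := by
    have := mul_pos i4 (sub_pos.2 (i2.trans i3))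
    have := mul_pos (sub_pos.2 i2) (sub_pos.2 i5)
    linarith
  obtain ⟨A, hA⟩ : ∃ A, A * (t₁ * (1 - s₁) + (s₂ - s₁) * (t₂ - t₁)) = (s₂ - s₁) * t₂ * (1 - s₁) :=
    ⟨_, div_mul_cancel₀ _ hD.ne'⟩
  obtain ⟨B, hB⟩ : ∃ B, B * (1 - s₁) = (t₂ - t₁) * (1 - s₁ - A) :=
    ⟨_, div_mul_cancel₀ _ (sub_pos.2 (i2.trans i3)).ne'⟩
  have j0 : 0 < 1 - s₁ := sub_pos.2 (i2.trans i3)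
  have jA : 0 < A := by
    refine pos_of_mul_pos_left ?_ hD.le
    rw [hA]
    exact mul_pos (mul_pos (sub_pos.2 i2) (by linarith)) j0
  have jA' : A < 1 - s₁ := by
    have : A * (t₁ * (1 - s₁) + (s₂ - s₁) * (t₂ - t₁)) <
        (1 - s₁) * (t₁ * (1 - s₁) + (s₂ - s₁) * (t₂ - t₁)) := by
      rw [hA]
      have := mul_pos (mul_pos i4 (sub_pos.2 i3)) j0
      nlinarith
    exact lt_of_mul_lt_mul_right this hD.le
  have jB : 0 < B := by
    refine pos_of_mul_pos_left ?_ j0.le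
    rw [hB]
    exact mul_pos (sub_pos.2 i5) (by linarith)
  have jB' : B < t₂ - t₁ := by
    have : B * (1 - s₁) < (t₂ - t₁) * (1 - s₁) := by
      rw [hB]; exact mul_lt_mul_of_pos_left (by linarith) (sub_pos.2 i5)
    exact lt_of_mul_lt_mul_right this j0.le
  have k1 : A * t₁ = (s₂ - s₁) * (t₁ + B) := by
    have : (1 - s₁) * (A * t₁) = (1 - s₁) * ((s₂ - s₁) * (t₁ + B)) := by
      linear_combination hA - (s₂ - s₁) * hB
    exact mul_left_cancel₀ j0.ne' this
  have hsq : √(A * B) ^ 2 = A * B := Real.sq_sqrt (mul_pos jA jB).le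
  have l1 := mul_pos (i1.trans i2) (add_pos i4 jB)
  have l2 : 0 < (1 - (s₁ + A)) * (1 - t₂) := mul_pos (by linarith) (by linarith)
  refine ⟨w s₁ t₁ 0, hmid _ _ _ ?_ ?_ ?_, w s₁ t₂ 0, hmid _ _ _ ?_ ?_ ?_,
    w (s₁ + A) (t₁ + B) √(A * B), hmid _ _ _ ?_ ?_ ?_, ?_, ?_, ?_, ?_, ?_, ?_, ?_⟩
  · have := mul_pos i1 i4; linarith
  · have := mul_pos j0 (show 0 < 1 - t₁ by linarith); linarith
  · have := mul_pos i1 (show 0 < 1 - t₁ by linarith)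
    have := mul_pos j0 i4
    linarith
  · have := mul_pos i1 (i4.trans i5); linarith
  · have := mul_pos j0 (show 0 < 1 - t₂ by linarith); linarith
  · have := mul_pos i1 (show 0 < 1 - t₂ by linarith)
    have := mul_pos j0 (i4.trans i5)
    linarith
  · rw [hsq]; nlinarith
  · rw [hsq]; nlinarith
  · have := mul_pos (add_pos i1 jA) (show 0 < 1 - (t₁ + B) by linarith)
    have := mul_pos (show 0 < 1 - (s₁ + A) by linarith) (add_pos i4 jB)
    have := mul_pos jA jB
    rw [hsq]; linarith
  · rw [hww]
    linear_combination (-κ) * hsq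
  · rw [hww]; ring
  · rw [hww]; ring
  · rw [hww]
    linear_combination κ * k1 - κ * hsq
  · rw [hww]; ring
  · rw [hww]; ring
  · rw [hww]
    linear_combination (-κ) * hsq - κ * hB

theorem clique_of_singleton (G : IsGQ r) (hXY : 0 < mq (X - Y)) (hφ : Pres r φ (Dia X Y))
    (hg : ¬ r (φ X) (φ Y)) {u v : T} (huv : u ≠ v) {P₀ : Mink} (hP : P₀ ∈ Sph X Y) (hPu : φ P₀ = u)
    (hv : ∀ Z ∈ Sph X Y, Z ≠ P₀ → φ Z = v) : ∀ W ∈ Mid X Y, ∀ W' ∈ Mid X Y, r (φ W) (φ W') := by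
  wlog h : Fut (Y - X) generalizing X Y
  · rw [Mid_comm]
    exact this (pos_comm hXY) hφ.comm (fun h => hg (G.symm h)) (mem_Sph_comm.1 hP)
      (by rwa [Sph_comm]) ((fut_or_fut hXY).resolve_left h)
  obtain ⟨P₁, h₁, hP₁⟩ := (Sph_infinite hXY).exists_notMem_finset {P₀}
  rw [Finset.mem_singleton] at hP₁
  have hF₁ := hv P₁ h₁ hP₁
  have q : Quad r (φ X) (φ Y) u v := by
    refine ⟨G, hg, ?_, ?_, ?_, ?_, huv⟩
    · rw [← hPu]; exact (hφ.sph hXY hP).1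
    · rw [← hPu]; exact (hφ.sph hXY hP).2
    · rw [← hF₁]; exact (hφ.sph hXY h₁).1
    · rw [← hF₁]; exact (hφ.sph hXY h₁).2
  have hT : ∀ W ∈ Mid X Y, ∀ a, 0 < a → mq (W - pt P₀ X a) = 0 →
      ∃ n, q.Trans (φ W) (φ (pt P₀ X a)) n := by
    intro W hW a ha hc
    obtain ⟨N, hN, P, hP', hne, h1, h2, h3, h4⟩ := exists_opposite hXY hW hP ha hc
    have hV := pt_mem_Dia hXY hP ha.le
    refine ⟨φ N, (hφ.pt hXY hP ha.le).1, by rw [← hPu]; exact (hφ.pt hXY hP ha.le).2, ?_,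
      hφ _ hN _ (right_mem_Dia hXY) h3, hφ _ hV _ hN (by rwa [mq_sub_comm]),
      hφ _ (Mid_subset_Dia hW) _ hV hc, hφ _ (Mid_subset_Dia hW) _ hN h2⟩
    rw [← hv P hP' hne]
    exact hφ _ hN _ (mem_Dia_of_Sph hXY hP') h4
  have hS : ∀ W ∈ Mid X Y, ∀ b, 0 < b → mq (W - pt P₀ Y b) = 0 →
      ∃ n, q.swap.Trans (φ W) (φ (pt P₀ Y b)) n := by
    intro W hW b hb hc
    obtain ⟨N, hN, P, hP', hne, h1, h2, h3, h4⟩ := exists_opposite (pos_comm hXY)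
      (by rwa [Mid_comm]) (mem_Sph_comm.1 hP) hb hc
    rw [Dia_comm] at hN
    have hV := pt_mem_Dia' hXY hP hb.le
    refine ⟨φ N, (hφ.pt' hXY hP hb.le).1, by rw [← hPu]; exact (hφ.pt' hXY hP hb.le).2, ?_,
      hφ _ hN _ (left_mem_Dia hXY) h3, hφ _ hV _ hN (by rwa [mq_sub_comm]),
      hφ _ (Mid_subset_Dia hW) _ hV hc, hφ _ (Mid_subset_Dia hW) _ hN h2⟩
    rw [← hv P (mem_Sph_comm.1 hP') hne]
    exact hφ _ hN _ (mem_Dia_of_Sph hXY (mem_Sph_comm.1 hP')) h4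
  by_cases hh : ∃ a₁ a₂, 0 < a₂ ∧ a₂ < a₁ ∧ φ (pt P₀ X a₁) ≠ φ (pt P₀ X a₂)
  · by_cases hk : ∃ b₁ b₂, 0 < b₁ ∧ b₁ < b₂ ∧ φ (pt P₀ Y b₁) ≠ φ (pt P₀ Y b₂)
    · obtain ⟨a₁, a₂, ha₂, ha, hha⟩ := hh
      obtain ⟨b₁, b₂, hb₁, hb, hkb⟩ := hk
      obtain ⟨W₁₁, w11, W₁₂, w12, W₂₂, w22, c0, c1, c2, c3, c4, c5, c6⟩ :=
        exists_grid h hP ha₂ ha hb₁ hb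
      obtain ⟨_, t11⟩ := hT _ w11 _ (ha₂.trans ha) c1
      obtain ⟨_, t12⟩ := hT _ w12 _ (ha₂.trans ha) c2
      obtain ⟨_, t22⟩ := hT _ w22 _ ha₂ c3
      obtain ⟨_, s11⟩ := hS _ w11 _ hb₁ c4
      obtain ⟨_, s12⟩ := hS _ w12 _ (hb₁.trans hb) c5
      obtain ⟨_, s22⟩ := hS _ w22 _ (hb₁.trans hb) c6
      exact (q.no_grid t11 t12 t22 s11 s12 s22
        (hφ _ (Mid_subset_Dia w11) _ (Mid_subset_Dia w22) c0) hha hkb).elim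
    · push Not at hk
      intro W hW W' hW'
      have e := Mid_coh (X := Y) (Y := X) (by rwa [Mid_comm]) (mem_Sph_comm.1 hP) (W := W)
      have e' := Mid_coh (X := Y) (Y := X) (by rwa [Mid_comm]) (mem_Sph_comm.1 hP) (W := W')
      obtain ⟨_, t⟩ := hS W hW _ e.1 e.2
      obtain ⟨_, t'⟩ := hS W' hW' _ e'.1 e'.2
      rcases lt_trichotomy (-mq (W - P₀) / mq (W - Y)) (-mq (W' - P₀) / mq (W' - Y)) with l | l | l
      · rw [hk _ _ e.1 l] at t; exact t.coh t'
      · rw [l] at t; exact t.coh t'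
      · rw [hk _ _ e'.1 l] at t'; exact t.coh t'
  · push Not at hh
    intro W hW W' hW'
    have e := Mid_coh hW hP
    have e' := Mid_coh hW' hP
    obtain ⟨_, t⟩ := hT W hW _ e.1 e.2
    obtain ⟨_, t'⟩ := hT W' hW' _ e'.1 e'.2
    rcases lt_trichotomy (-mq (W - P₀) / mq (W - X)) (-mq (W' - P₀) / mq (W' - X)) with l | l | l
    · rw [hh _ _ e.1 l] at t'; exact t.coh t'
    · rw [l] at t; exact t.coh t'
    · rw [hh _ _ e'.1 l] at t; exact t.coh t'

theorem nd3_of_nonconstant (G : IsGQ r) (hXY : 0 < mq (X - Y)) (hφ : Pres r φ (Dia X Y))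
    (hg : ¬ r (φ X) (φ Y)) {Z Z' : Mink} (hZ : Z ∈ Sph X Y) (hZ' : Z' ∈ Sph X Y) (hne : φ Z ≠ φ Z')
    (hcl : ¬ ∀ W ∈ Mid X Y, ∀ W' ∈ Mid X Y, r (φ W) (φ W')) : ND3 r φ X Y := by
  refine nd3_of_three G hXY hφ hg ?_ hcl
  by_contra h3
  have hval : ∀ V ∈ Sph X Y, φ V = φ Z ∨ φ V = φ Z' := by
    intro V hV
    by_contra hcon
    push Not at hcon
    exact h3 ⟨Z, hZ, Z', hZ', V, hV, hne, hcon.1.symm, hcon.2.symm⟩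
  by_cases h1 : ∃ e ∈ Sph X Y, φ e = φ Z ∧ Z ≠ e
  · obtain ⟨e, he, hez, hn⟩ := h1
    by_cases h2 : ∃ f ∈ Sph X Y, φ f = φ Z' ∧ Z' ≠ f
    · obtain ⟨f, hf, hfz, hn'⟩ := h2
      exact hcl (clique_of_two_values G hXY hφ hg hne hval hZ he hZ' hf rfl hez rfl hfz hn hn')
    · push Not at h2
      exact hcl (clique_of_singleton G hXY hφ hg hne.symm hZ' rfl fun V hV hn =>
        (hval V hV).resolve_right fun h => hn (h2 V hV h).symm)
  · push Not at h1
    exact hcl (clique_of_singleton G hXY hφ hg hne hZ rfl fun V hV hn =>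
      (hval V hV).resolve_left fun h => hn (h1 V hV h).symm)

end Coherency

namespace Coherency

variable {T : Type*} {r : T → T → Prop} {X Y : Mink} {φ : Mink → T}

/-! ### Propagation of nondegeneracy -/

theorem exists_pt (hXY : 0 < mq (X - Y)) {V : Mink} (hV : V ∈ Dia X Y) (hVX : mq (V - X) = 0)
    (hne : V ≠ X) : ∃ Z ∈ Sph X Y, ∃ a, 0 ≤ a ∧ V = pt Z X a := by
  rw [mq_sub_comm] at hXY
  have h1 : mb (Y - X) (V - X) = mb (V - X) (Y - V) := by
    rw [show Y - X = (V - X) + (Y - V) by abel, mb_add_left, mb_self, hVX, mb_comm]; ring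
  have h2 : mb (Y - X) (V - X) ≠ 0 := fun h0 =>
    hne (sub_eq_zero.1 ((mq_orthogonal_nonpos hXY h0).2 hVX))
  have h3 : 0 < mb (Y - X) (V - X) := lt_of_le_of_ne (by rw [h1]; exact hV.2.2) h2.symm
  have h4 : mb (Y - X) (V - X) ≤ mq (Y - X) := by
    have := hV.2.1
    rw [mq_sub_comm, show Y - V = (Y - X) - (V - X) by abel, mq_sub, hVX] at this
    linarith
  refine ⟨_, line_meets_Sph hVX h2, mq (Y - X) / mb (Y - X) (V - X) - 1, ?_, ?_⟩
  · rw [sub_nonneg, one_le_div h3]; exact h4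
  · have h0 : mq (Y - X) / mb (Y - X) (V - X) ≠ 0 := div_ne_zero hXY.ne' h2
    generalize mq (Y - X) / mb (Y - X) (V - X) = σ at *
    simp only [pt]
    rw [add_sub_cancel]
    match_scalars <;> field_simp; ring

theorem ND3.n1 (h : ND3 r φ X Y) {Z : Mink} (hZ : Z ∈ Sph X Y) {a : ℝ} (ha : 0 < a) :
    φ (pt Z X a) ≠ φ Z := fun h' => by
  have := h.injX Z hZ a 0 ha.le le_rfl (by rw [h', pt_zero])
  exact ha.ne' this

theorem ND3.pt (G : IsGQ r) (h : ND3 r φ X Y) (hφ : Pres r φ (Dia X Y)) {Z₂ : Mink}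
    (hZ₂ : Z₂ ∈ Sph X Y) {b : ℝ} (hb : 0 < b) : ND3 r φ X (pt Z₂ Y b) := by
  have hXY := h.tl
  have hg := h.good
  have hn : φ (Coherency.pt Z₂ Y b) ≠ φ Z₂ := (h.comm G).n1 (mem_Sph_comm.1 hZ₂) hb
  have htl := tl_pt hXY hZ₂ hb
  have hφ' : Pres r φ (Dia X (Coherency.pt Z₂ Y b)) :=
    hφ.mono (Dia_subset hXY (pt_mem_Dia' hXY hZ₂ hb.le) htl)
  have hg' := good_pt G hXY hφ hg hZ₂ hb hn
  have h3 := three_pt G hXY hφ hg h.three hZ₂ hb hn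
  have key : ∀ V ∈ Sph X (Coherency.pt Z₂ Y b), ∃ Z ∈ Sph X Y, ∃ a, 0 ≤ a ∧
      V = Coherency.pt Z X a := fun V hV => by
    refine exists_pt hXY (Dia_subset hXY (pt_mem_Dia' hXY hZ₂ hb.le) htl (mem_Dia_of_Sph htl hV))
      hV.1 ?_
    rintro rfl
    exact htl.ne' hV.2
  refine nd3_of_ne G htl hφ' hg' h3 ?_ ?_
  · intro V hV a ha h'
    obtain ⟨Z, hZ, c, hc, rfl⟩ := key V hV
    rw [pt_pt hc ha.le] at h'
    have := h.injX Z hZ _ _ (by positivity) hc h'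
    have : 0 < (1 + c) * a := by positivity
    linarith
  · intro V hV a ha h'
    obtain ⟨V', hV', hne, -⟩ := h3.exists_ne (φ V) (φ V)
    have hp := cr_pos htl hV' hV (fun h => hne (h ▸ rfl))
    have hp' := div_pos hp ha
    have h2 := (collapse_iff G (pos_comm htl) hφ'.comm (fun h => hg' (G.symm h))
      (mem_Sph_comm.1 hV) (mem_Sph_comm.1 hV') hne.symm ha hp'
      (by rw [mul_div_cancel₀ _ ha.ne', cr_comm, cr_swap])).1 h'
    obtain ⟨Z, hZ, c, hc, rfl⟩ := key V' hV'
    rw [pt_pt hc hp'.le] at h2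
    exact h.neX Z hZ _ (by positivity) h2

theorem ND3.pt' (G : IsGQ r) (h : ND3 r φ X Y) (hφ : Pres r φ (Dia X Y)) {Z₂ : Mink}
    (hZ₂ : Z₂ ∈ Sph X Y) {a : ℝ} (ha : 0 < a) : ND3 r φ (Coherency.pt Z₂ X a) Y :=
  ((h.comm G).pt G hφ.comm (mem_Sph_comm.1 hZ₂) ha).comm G

theorem mem_Dia_of_coh (hXY : 0 < mq (X - Y)) {W V : Mink} (hW : W ∈ Mid X Y)
    (hVY : mq (V - Y) = 0) (hWV : mq (W - V) = 0) : W ∈ Dia X V := by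
  have aux : ∀ A : Mink, mq A = 0 → ∀ B, Fut B → ∀ C, mq C = 0 → C = B + A → Caus (-A) := by
    intro A hA B hB C hC h
    rcases caus_or_neg hA.ge with h1 | h1
    · have := (hB.add_caus h1).2
      rw [← h, hC] at this
      exact absurd this (lt_irrefl _)
    · exact h1
  refine ⟨hW.1.le, hWV.ge, ?_⟩
  rcases fut_or_fut hXY with h | h
  · obtain ⟨h1, h2⟩ := (Mid_iff h).1 hW
    have := aux (W - V) hWV (Y - W) h2 (Y - V) (by rwa [mq_sub_comm]) (by abel)
    rw [neg_sub] at this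
    exact h1.caus.mb_nonneg this
  · rw [Mid_comm] at hW
    obtain ⟨h1, h2⟩ := (Mid_iff h).1 hW
    have := aux (V - W) (by rwa [mq_sub_comm]) (W - Y) h1 (V - Y) hVY (by abel)
    rw [neg_sub] at this
    have h3 := h2.caus.mb_nonneg this
    rwa [← neg_sub W X, ← neg_sub V W, mb_neg_left, mb_neg_right, neg_neg] at h3

theorem ND3.mid (G : IsGQ r) (h : ND3 r φ X Y) (hφ : Pres r φ (Dia X Y)) {W : Mink}
    (hW : W ∈ Mid X Y) : ND3 r φ X W := by
  have hXY := h.tl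
  obtain ⟨Z, hZ, -⟩ := h.three
  obtain ⟨hb, hc⟩ := Mid_coh (X := Y) (Y := X) (by rwa [Mid_comm]) (mem_Sph_comm.1 hZ) (W := W)
  have htl := tl_pt hXY hZ hb
  have h1 := h.pt G hφ hZ hb
  have hD := mem_Dia_of_coh hXY hW (coh_pt_left (mem_Sph_comm.1 hZ) hb.le) hc
  set V := Coherency.pt Z Y (-mq (W - Z) / mq (W - Y))
  rw [Dia_comm] at hD
  have hVY : mq (V - Y) = 0 := coh_pt_left (mem_Sph_comm.1 hZ) hb.le
  obtain ⟨Z', hZ', c, hc', hWc⟩ := exists_pt (pos_comm htl) hD hc (by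
    rintro h0
    have := hW.2.1
    rw [h0, hVY] at this
    exact this.false)
  have hc0 : 0 < c := by
    refine lt_of_le_of_ne hc' ?_
    rintro rfl
    rw [pt_zero] at hWc
    have := hW.1
    rw [hWc, hZ'.2] at this
    exact this.false
  rw [hWc]
  exact h1.pt G (hφ.mono (Dia_subset hXY (pt_mem_Dia' hXY hZ hb.le) htl)) (mem_Sph_comm.1 hZ') hc0

theorem midpoint_mem_Mid (h : Fut (Y - X)) : X + (2⁻¹ : ℝ) • (Y - X) ∈ Mid X Y := by
  refine (Mid_iff h).2 ⟨?_, ?_⟩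
  · rw [add_sub_cancel_left]; exact h.smul (by norm_num)
  · rw [show Y - (X + (2⁻¹ : ℝ) • (Y - X)) = (2⁻¹ : ℝ) • (Y - X) by module]
    exact h.smul (by norm_num)

theorem ND3.inj (G : IsGQ r) (h : ND3 r φ X Y) (hφ : Pres r φ (Dia X Y)) {Z Z' : Mink}
    (hZ : Z ∈ Sph X Y) (hZ' : Z' ∈ Sph X Y) (hzz : φ Z = φ Z') : Z = Z' := by
  wlog hf : Fut (Y - X) generalizing X Y
  · exact this (h.comm G) hφ.comm (mem_Sph_comm.1 hZ) (mem_Sph_comm.1 hZ')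
      ((fut_or_fut h.tl).resolve_left hf)
  by_contra hne
  have hXY := h.tl
  have hV := midpoint_mem_Mid hf
  set V := X + (2⁻¹ : ℝ) • (Y - X)
  obtain ⟨ha, hc⟩ := Mid_coh hV hZ
  obtain ⟨ha', hc'⟩ := Mid_coh hV hZ'
  have hND' := h.pt' G hφ hZ' ha'
  have hVD := Mid_subset_Dia hV
  have hpD := pt_mem_Dia hXY hZ ha.le
  have hpD' := pt_mem_Dia hXY hZ' ha'.le
  obtain ⟨p1, p2⟩ := hφ.pt hXY hZ ha.le
  obtain ⟨p1', p2'⟩ := hφ.pt hXY hZ' ha'.le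
  have hpX : mq (Coherency.pt Z X (-mq (V - Z) / mq (V - X)) - X) = 0 := coh_pt_left hZ ha.le
  have hpX' : mq (Coherency.pt Z' X (-mq (V - Z') / mq (V - X)) - X) = 0 := coh_pt_left hZ' ha'.le
  have hPne : Coherency.pt Z X (-mq (V - Z) / mq (V - X)) ≠
      Coherency.pt Z' X (-mq (V - Z') / mq (V - X)) := by
    intro h0
    have h1 := coh_pt_self hZ ha.le
    have hz' := coh_pt_self hZ' ha'.le
    have e1 := pt_sub (Z := Z) (X := X) ha.le
    have e2 := pt_sub (Z := Z') (X := X) ha'.le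
    rw [h0, e2] at e1
    have hm1 := mb_of_mem_Sph' hZ
    have hm2 := mb_of_mem_Sph' hZ'
    have hm := congrArg (mb (Y - X)) e1
    rw [mb_smul_right, mb_smul_right, hm1, hm2] at hm
    have hi := mul_right_cancel₀ hf.2.ne' hm
    rw [hi] at e1
    have hpos : (1 + -mq (V - Z) / mq (V - X))⁻¹ ≠ 0 := by positivity
    exact hne (sub_left_inj.1 ((smul_right_injective _ hpos e1).symm))
  set P := Coherency.pt Z X (-mq (V - Z) / mq (V - X))
  set P' := Coherency.pt Z' X (-mq (V - Z') / mq (V - X))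
  have hxz : φ X ≠ φ Z := fun h0 => h.good (by rw [h0]; exact (hφ.sph hXY hZ).2)
  have hPP : φ P = φ P' := by
    refine G.eq_of (h.mid G hφ hV).good p1 (hφ _ hpD _ hVD (by rwa [mq_sub_comm])) p1'
      (hφ _ hpD' _ hVD (by rwa [mq_sub_comm])) ?_
    exact G.tri hxz (G.symm (hφ.sph hXY hZ).1) p1 p2 p1' (by rw [hzz]; exact p2')
  obtain ⟨v1, v2⟩ := (Mid_iff hf).1 hV
  have hnull : ∀ Q : Mink, mq (V - Q) = 0 → mq (Q - X) = 0 → NullF (V - Q) := by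
    intro Q h1 h2
    have h0 : V - Q ≠ 0 := by
      intro h0
      rw [sub_eq_zero] at h0
      have := v1.2
      rw [h0, h2] at this
      exact this.false
    rcases caus_or_neg h1.ge with h3 | h3
    · exact NullF.of_caus h3 h1 h0
    · have := (h3.add_fut v1).2
      rw [show -(V - Q) + (V - X) = Q - X by abel, h2] at this
      exact absurd this (lt_irrefl _)
  have hnP := hnull P hc hpX
  have hnP' := hnull P' hc' hpX'
  have hmb : 0 < mb (V - P') (V - P) := by
    refine lt_of_le_of_ne (hnP'.caus.mb_nonneg hnP.caus) fun h0 => hPne ?_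
    have htl : 0 < mq (X - V) := by rw [mq_sub_comm]; exact v1.2
    by_contra hPP'
    have := Sph_neg htl (Z := P) (Z' := P') ⟨hpX, by rwa [mq_sub_comm]⟩
      ⟨hpX', by rwa [mq_sub_comm]⟩ hPP'
    rw [show P - P' = (V - P') - (V - P) by abel, mq_sub, hc, hc', ← h0] at this
    linarith
  obtain ⟨hs, -, hs'⟩ := v2.split hnP
  set s := mq (Y - V) / mb (Y - V) (V - P)
  set W := V + (s / 2) • (V - P) with hW
  have hWP : mq (W - P) = 0 := by
    rw [show W - P = (1 + s / 2) • (V - P) by rw [hW]; module, mq_smul, hc, mul_zero]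
  have hYW : Fut (Y - W) := by
    have := hs' (s / 2) (by linarith) (by linarith)
    rwa [sub_sub] at this
  have hWP' : Fut (W - P') := by
    rw [show W - P' = (V - P') + (s / 2) • (V - P) by rw [hW]; abel]
    refine hnP'.add_fut (hnP.smul (by linarith)) ?_
    rw [mb_smul_right]; positivity
  have hfut' : Fut (Y - P') := by
    rw [show Y - P' = (Y - W) + (W - P') by abel]; exact hYW.add_caus hWP'.caus
  have hWmid : W ∈ Mid P' Y := (Mid_iff hfut').2 ⟨hWP', hYW⟩
  have hφ' : Pres r φ (Dia P' Y) := by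
    refine hφ.mono ?_
    rw [Dia_comm, Dia_comm (X := X)]
    exact Dia_subset (pos_comm hXY) (by rwa [Dia_comm]) hfut'.2
  have hWD : W ∈ Dia X Y := by
    rw [Dia_comm]
    exact Dia_subset (pos_comm hXY) (by rwa [Dia_comm]) hfut'.2 (by
      rw [Dia_comm]; exact Mid_subset_Dia hWmid)
  refine (hND'.mid G hφ' hWmid).good ?_
  rw [← hPP]
  exact hφ _ hpD _ hWD (by rwa [mq_sub_comm])

end Coherency

namespace Coherency

/-! ### Null geometry of upper sets -/

theorem mink_tri {A B C D : Mink} (hne : A ≠ B) (hAB : mq (A - B) = 0) (hCA : mq (C - A) = 0)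
    (hCB : mq (C - B) = 0) (hDA : mq (D - A) = 0) (hDB : mq (D - B) = 0) : mq (C - D) = 0 := by
  have h0 : B - A ≠ 0 := sub_ne_zero.2 hne.symm
  have hBA : mq (B - A) = 0 := by rwa [mq_sub_comm]
  obtain ⟨s, hs⟩ := null_parallel_of_sub hBA hCA
    (by rwa [sub_sub_sub_cancel_right, mq_sub_comm]) h0
  obtain ⟨t, ht⟩ := null_parallel_of_sub hBA hDA
    (by rwa [sub_sub_sub_cancel_right, mq_sub_comm]) h0
  rw [← sub_sub_sub_cancel_right C D A, hs, ht, ← sub_smul, mq_smul, hBA, mul_zero]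

theorem mink_eq_of {X Y U V : Mink} (hXY : mq (X - Y) ≠ 0) (hUX : mq (U - X) = 0)
    (hUY : mq (U - Y) = 0) (hVX : mq (V - X) = 0) (hVY : mq (V - Y) = 0) (hUV : mq (U - V) = 0) :
    U = V := by
  by_contra hne
  exact hXY (mink_tri hne hUV (by rwa [mq_sub_comm]) (by rwa [mq_sub_comm]) (by rwa [mq_sub_comm])
    (by rwa [mq_sub_comm]))

theorem fut_add_smul {D n : Mink} (hn : NullF n) (h : 0 < mb D n) :
    ∃ N : ℝ, 0 < N ∧ ∀ s, N ≤ s → Fut (D + s • n) := by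
  refine ⟨|mq D| / mb D n + 1, by positivity, fun s hs => ?_⟩
  have hq : 0 < mq (D + s • n) := by
    rw [mq_add, mq_smul, hn.2.2.1, mb_smul_right]
    have : |mq D| < s * mb D n := by
      rw [← div_lt_iff₀ h]; linarith
    have := neg_abs_le (mq D)
    linarith
  rcases caus_or_neg hq.le with h1 | h1
  · exact h1.fut hq
  · have := h1.mb_nonneg hn.caus
    rw [mb_neg_left, mb_add_left, mb_smul_left, mb_self, hn.2.2.1] at this
    linarith

theorem fut_add_smul_add_smul (D : Mink) {n m : Mink} (hn : NullF n) (hm : NullF m)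
    (h : 0 < mb n m) : ∃ N : ℝ, 0 < N ∧ ∀ s, N ≤ s → ∀ t, N ≤ t → Fut (D + s • n + t • m) := by
  set M := |mb D m| / mb n m + 1 with hM
  have hM0 : 0 < M := by positivity
  have h1 : 0 < mb (D + M • n) m := by
    rw [mb_add_left, mb_smul_left]
    have : |mb D m| < M * mb n m := by rw [← div_lt_iff₀ h]; linarith
    have := neg_abs_le (mb D m)
    linarith
  obtain ⟨N, hN, hs⟩ := fut_add_smul hm h1
  refine ⟨max M N, lt_max_of_lt_left hM0, fun s hs' t ht => ?_⟩
  have := (hs t ((le_max_right _ _).trans ht)).add_caus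
    (hn.caus.smul (t := s - M) (sub_nonneg.2 ((le_max_left _ _).trans hs')))
  rwa [show D + M • n + t • m + (s - M) • n = D + s • n + t • m by module] at this

theorem nullF_e : NullF ![1, 0, 0, 0] :=
  ⟨by simp, by simp, by simp [mq], fun h => by simpa using congrFun h 0⟩

theorem nullF_e' : NullF ![0, 0, 0, 1] :=
  ⟨by simp, by simp, by simp [mq], fun h => by simpa using congrFun h 3⟩

theorem exists_null_mb_pos {D : Mink} (h : mq D < 0) : ∃ n, NullF n ∧ 0 < mb D n := by
  rcases lt_or_ge 0 (D 0) with h0 | h0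
  · exact ⟨_, nullF_e', by simpa [mb] using h0⟩
  rcases lt_or_ge 0 (D 3) with h3 | h3
  · exact ⟨_, nullF_e, by simpa [mb] using h3⟩
  have hq : D 0 * D 3 < D 1 ^ 2 + D 2 ^ 2 := by simp only [mq] at h; linarith
  have hq0 : 0 < D 1 ^ 2 + D 2 ^ 2 := lt_of_le_of_lt (mul_nonneg_of_nonpos_of_nonpos h0 h3) hq
  have key : ∃ k : ℝ, 0 < D 0 * k ^ 2 * (D 1 ^ 2 + D 2 ^ 2) + D 3 + 2 * k * (D 1 ^ 2 + D 2 ^ 2) := by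
    rcases h0.lt_or_eq with h0 | h0
    · refine ⟨-1 / D 0, ?_⟩
      have : D 0 * (-1 / D 0) ^ 2 * (D 1 ^ 2 + D 2 ^ 2) + D 3 + 2 * (-1 / D 0) * (D 1 ^ 2 + D 2 ^ 2)
          = (D 1 ^ 2 + D 2 ^ 2 - D 0 * D 3) / (-D 0) := by
        have := h0.ne; field_simp; ring
      rw [this]
      exact div_pos (by linarith) (by linarith)
    · refine ⟨(1 - D 3) / (2 * (D 1 ^ 2 + D 2 ^ 2)), ?_⟩
      rw [h0]
      have : (0:ℝ) * ((1 - D 3) / (2 * (D 1 ^ 2 + D 2 ^ 2))) ^ 2 * (D 1 ^ 2 + D 2 ^ 2) + D 3 +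
          2 * ((1 - D 3) / (2 * (D 1 ^ 2 + D 2 ^ 2))) * (D 1 ^ 2 + D 2 ^ 2) = 1 := by
        field_simp; ring
      rw [this]; exact one_pos
  obtain ⟨k, hk⟩ := key
  refine ⟨![1, -k * D 1, -k * D 2, k ^ 2 * (D 1 ^ 2 + D 2 ^ 2)], ⟨by simp, ?_, ?_, ?_⟩, ?_⟩
  · simp; positivity
  · simp [mq]; ring
  · intro h; simpa using congrFun h 0
  · simp [mb]; linarith

theorem NullF.exists_transverse {n : Mink} (hn : NullF n) : ∃ m, NullF m ∧ 0 < mb n m := by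
  rcases hn.1.lt_or_eq with h | h
  · exact ⟨_, nullF_e', by simpa [mb] using h⟩
  · refine ⟨_, nullF_e, ?_⟩
    have h3 : 0 < n 3 := by
      refine lt_of_le_of_ne hn.2.1 fun h3 => hn.2.2.2 ?_
      have hq := hn.2.2.1
      simp only [mq, ← h, ← h3] at hq
      have h1 : n 1 = 0 := by nlinarith [sq_nonneg (n 1), sq_nonneg (n 2)]
      have h2 : n 2 = 0 := by nlinarith [sq_nonneg (n 1), sq_nonneg (n 2)]
      exact mink_ext (by simp [← h]) (by simp [h1]) (by simp [h2]) (by simp [← h3])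
    simpa [mb] using h3

/-- `𝒰` contains everything above its points. -/
def IsUpperM (𝒰 : Set Mink) : Prop := ∀ X ∈ 𝒰, ∀ Y, Caus (Y - X) → Y ∈ 𝒰

theorem common_infinite {𝒰 : Set Mink} (hU : IsUpperM 𝒰) {X Y : Mink} (hX : X ∈ 𝒰) (hY : Y ∈ 𝒰)
    (h : mq (X - Y) ≠ 0) : {V | V ∈ 𝒰 ∧ mq (V - X) = 0 ∧ mq (V - Y) = 0}.Infinite := by
  rcases h.lt_or_gt with h | h
  · rw [mq_sub_comm] at h
    obtain ⟨n₁, hn, hp⟩ := exists_null_mb_pos h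
    obtain ⟨n₂, hm, hnm⟩ := hn.exists_transverse
    obtain ⟨m₁, m₂, F⟩ := exists_frame hn hm hnm
    set p : ℝ → ℝ := fun u => mb (Y - X) (nd n₁ n₂ m₁ m₂ u 0)
    have hpc : Continuous p := by
      simp only [p, nd, mb_add_right, mb_smul_right]
      fun_prop
    have hp0 : 0 < p 0 := by simp only [p, nd_zero]; exact hp
    have hev : ∀ᶠ u in nhds 0, 0 < p u := hpc.continuousAt.eventually (lt_mem_nhds hp0)
    obtain ⟨δ, hδ, hb⟩ := Metric.eventually_nhds_iff.1 hev
    refine Set.infinite_of_injOn_mapsTo (s := Set.Ioo 0 δ)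
      (f := fun u => Y + (-mq (Y - X) / p u) • nd n₁ n₂ m₁ m₂ u 0) ?_ ?_ (Set.Ioo_infinite hδ)
    · intro u hu u' hu' he
      have hpu := hb (y := u) (by rw [Real.dist_eq, sub_zero, abs_of_pos hu.1]; exact hu.2)
      simp only [add_right_inj] at he
      have h2 := congrArg (fun x => mb x n₂) he
      simp only [mb_smul_left, F.mb_nd_n2] at h2
      have h3 := mul_right_cancel₀ F.pos.ne' h2
      have h4 : -mq (Y - X) / p u ≠ 0 := (div_pos (neg_pos.2 h) hpu).ne'
      rw [← h3] at he
      have h5 := smul_right_injective _ h4 he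
      have h6 := F.mb_nd u 0 u' 0
      rw [← h5, mb_self, F.mq_nd] at h6
      have h7 : (u - u') ^ 2 = 0 := by
        have := F.pos
        have h8 : mb n₁ n₂ * (u - u') ^ 2 = 0 := by linarith
        exact (mul_eq_zero.1 h8).resolve_left this.ne'
      exact sub_eq_zero.1 (by simpa using h7)
    · intro u hu
      have hpu := hb (y := u) (by rw [Real.dist_eq, sub_zero, abs_of_pos hu.1]; exact hu.2)
      have hc : 0 < -mq (Y - X) / p u := div_pos (neg_pos.2 h) hpu
      refine ⟨hU Y hY _ ?_, ?_, ?_⟩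
      · rw [add_sub_cancel_left]; exact (F.nullF_nd hn hm u 0).caus.smul hc.le
      · rw [add_sub_right_comm, mq_add, mq_smul, F.mq_nd, mb_smul_right, div_mul_cancel₀ _ hpu.ne']
        ring
      · rw [add_sub_cancel_left, mq_smul, F.mq_nd, mul_zero]
  · refine (Sph_infinite h).mono fun V hV => ⟨?_, hV.1, hV.2⟩
    rcases fut_or_fut h with h' | h'
    · exact hU X hX _ ((Dia_iff h').1 (mem_Dia_of_Sph h hV)).1
    · rw [mem_Sph_comm] at hV
      exact hU Y hY _ ((Dia_iff h').1 (mem_Dia_of_Sph (by rwa [mq_sub_comm]) hV)).1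

theorem exists_common {𝒰 : Set Mink} (hU : IsUpperM 𝒰) {X Y : Mink} (hX : X ∈ 𝒰) (hY : Y ∈ 𝒰)
    (h : mq (X - Y) ≠ 0) {P Q : Mink → Prop}
    (hP : ∀ V ∈ 𝒰, ∀ V' ∈ 𝒰, P V → P V' → mq (V - X) = 0 → mq (V' - X) = 0 → mq (V - Y) = 0 →
      mq (V' - Y) = 0 → mq (V - V') = 0)
    (hQ : ∀ V ∈ 𝒰, ∀ V' ∈ 𝒰, Q V → Q V' → mq (V - X) = 0 → mq (V' - X) = 0 → mq (V - Y) = 0 →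
      mq (V' - Y) = 0 → mq (V - V') = 0) :
    ∃ V ∈ 𝒰, mq (V - X) = 0 ∧ mq (V - Y) = 0 ∧ ¬ P V ∧ ¬ Q V := by
  set S := {V | V ∈ 𝒰 ∧ mq (V - X) = 0 ∧ mq (V - Y) = 0}
  have hS := common_infinite hU hX hY h
  have h1 : (S ∩ {V | P V}).Subsingleton := fun V hV V' hV' =>
    mink_eq_of h hV.1.2.1 hV.1.2.2 hV'.1.2.1 hV'.1.2.2
      (hP V hV.1.1 V' hV'.1.1 hV.2 hV'.2 hV.1.2.1 hV'.1.2.1 hV.1.2.2 hV'.1.2.2)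
  have h2 : (S ∩ {V | Q V}).Subsingleton := fun V hV V' hV' =>
    mink_eq_of h hV.1.2.1 hV.1.2.2 hV'.1.2.1 hV'.1.2.2
      (hQ V hV.1.1 V' hV'.1.1 hV.2 hV'.2 hV.1.2.1 hV'.1.2.1 hV.1.2.2 hV'.1.2.2)
  obtain ⟨V, hV, hn⟩ := hS.exists_notMem_finite (h1.finite.union h2.finite)
  refine ⟨V, hV.1, hV.2.1, hV.2.2, fun h => hn (Or.inl ⟨hV, h⟩), fun h => hn (Or.inr ⟨hV, h⟩)⟩

end Coherency

namespace Coherency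

/-! ### Large points -/

theorem Fut.trans {A B C : Mink} (h : Fut (B - A)) (h' : Fut (C - B)) : Fut (C - A) := by
  have := h'.add_caus h.caus
  rwa [sub_add_sub_cancel] at this

theorem Fut.trans_caus {A B C : Mink} (h : Fut (B - A)) (h' : Caus (C - B)) : Fut (C - A) := by
  have := h'.add_fut h
  rwa [sub_add_sub_cancel] at this

theorem exists_mem_Sph_up {X Y n : Mink} (h : Fut (Y - X)) (hn : NullF n) :
    ∃ s : ℝ, 0 < s ∧ X + s • n ∈ Sph X Y ∧ Caus (Y - (X + s • n)) := by
  obtain ⟨h1, h2, -⟩ := h.split hn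
  refine ⟨_, h1, ⟨?_, ?_⟩, ?_⟩
  · rw [add_sub_cancel_left, mq_smul, hn.2.2.1, mul_zero]
  · rw [mq_sub_comm, ← sub_sub]; exact h2.2.2.1
  · rw [← sub_sub]; exact h2.caus

theorem exists_mem_Sph_down {X Y n : Mink} (h : Fut (Y - X)) (hn : NullF n) :
    ∃ s : ℝ, 0 < s ∧ Y - s • n ∈ Sph X Y ∧ Caus (Y - s • n - X) := by
  obtain ⟨h1, h2, -⟩ := h.split hn
  refine ⟨_, h1, ⟨?_, ?_⟩, ?_⟩
  · rw [sub_right_comm]; exact h2.2.2.1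
  · rw [sub_sub_cancel_left, mq_neg, mq_smul, hn.2.2.1, mul_zero]
  · rw [sub_right_comm]; exact h2.caus

theorem IsUpperM.fut {𝒰 : Set Mink} (hU : IsUpperM 𝒰) {X Y : Mink} (hX : X ∈ 𝒰) (h : Fut (Y - X)) :
    Y ∈ 𝒰 := hU X hX Y h.caus

variable {T : Type*} {r : T → T → Prop} {X Y : Mink} {φ : Mink → T} {𝒰 : Set Mink}

/-- `φ` is degenerate with a centre, up to one exceptional point. -/
def PointDeg (r : T → T → Prop) (φ : Mink → T) (𝒰 : Set Mink) : Prop :=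
  ∃ A ∈ 𝒰, ∃ B ∈ 𝒰, ∀ X ∈ 𝒰, X ≠ A → r (φ X) (φ B)

/-- `φ` is degenerate with image on a line, up to one exceptional line. -/
def LineDeg (r : T → T → Prop) (φ : Mink → T) (𝒰 : Set Mink) : Prop :=
  ∃ P ∈ 𝒰, ∃ Q ∈ 𝒰, P ≠ Q ∧ mq (P - Q) = 0 ∧ ∃ a b, a ≠ b ∧ r a b ∧
    ∀ X ∈ 𝒰, ¬ (mq (X - P) = 0 ∧ mq (X - Q) = 0) → r (φ X) a ∧ r (φ X) b

/-- The image of the future of `M` is a clique. -/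
def CliqueAbove (r : T → T → Prop) (φ : Mink → T) (M : Mink) : Prop :=
  ∀ A B, Fut (A - M) → Fut (B - M) → r (φ A) (φ B)

theorem const_of_coclique (G : IsGQ r) (hU : IsUpperM 𝒰) (hφ : Pres r φ 𝒰) {M : Mink} (hM : M ∈ 𝒰)
    {c₁ c₂ : T} (hc : ¬ r c₁ c₂) (h : ∀ A, Fut (A - M) → r (φ A) c₁ ∧ r (φ A) c₂) {A B : Mink}
    (hA : Fut (A - M)) (hB : Fut (B - M)) : φ A = φ B := by
  have step : ∀ C D, Fut (C - M) → Fut (D - M) → mq (C - D) = 0 → φ C = φ D := fun C D hC hD h0 =>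
    G.eq_of hc (h C hC).1 (h C hC).2 (h D hD).1 (h D hD).2
      (hφ C (hU.fut hM hC) D (hU.fut hM hD) h0)
  have up : ∀ C D, Fut (C - M) → Fut (D - C) → φ C = φ D := by
    intro C D hC hD
    obtain ⟨s, hs, hS, -⟩ := exists_mem_Sph_up hD nullF_e
    have hS' : Fut (C + s • ![1, 0, 0, 0] - M) :=
      hC.trans_caus (by rw [add_sub_cancel_left]; exact nullF_e.caus.smul hs.le)
    rw [← step _ _ hS' hC hS.1, step _ _ hS' (hC.trans hD) hS.2]
  obtain ⟨N, h1, h2⟩ := exists_upper_pair A B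
  rw [up A N hA h1, up B N hB h2]

theorem cliqueAbove_of_coclique (G : IsGQ r) (hU : IsUpperM 𝒰) (hφ : Pres r φ 𝒰) {M : Mink}
    (hM : M ∈ 𝒰) {c₁ c₂ : T} (hc : ¬ r c₁ c₂) (h : ∀ A, Fut (A - M) → r (φ A) c₁ ∧ r (φ A) c₂) :
    CliqueAbove r φ M := fun _ _ hA hB =>
  const_of_coclique G hU hφ hM hc h hA hB ▸ G.refl _

theorem exists_good_above (G : IsGQ r) (hU : IsUpperM 𝒰) (hφ : Pres r φ 𝒰)
    (hN : ∀ M ∈ 𝒰, ¬ CliqueAbove r φ M) {M : Mink} (hM : M ∈ 𝒰) :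
    ∃ X Y, Fut (X - M) ∧ Fut (Y - X) ∧ ¬ r (φ X) (φ Y) := by
  by_contra hcon
  push Not at hcon
  have := hN M hM
  simp only [CliqueAbove, not_forall] at this
  obtain ⟨A, B, hA, hB, hAB⟩ := this
  obtain ⟨N, h1, h2⟩ := exists_upper_pair A B
  exact hN N (hU.fut hM (hA.trans h1)) (cliqueAbove_of_coclique G hU hφ (hU.fut hM (hA.trans h1))
    hAB fun C hC => ⟨G.symm (hcon A C hA (h1.trans hC)), G.symm (hcon B C hB (h2.trans hC))⟩)

theorem Sph_nullF (h : Fut (Y - X)) {R : Mink} (hR : R ∈ Sph X Y) :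
    NullF (R - X) ∧ NullF (Y - R) := by
  have hd := (Dia_iff h).1 (mem_Dia_of_Sph (by rw [mq_sub_comm]; exact h.2) hR)
  refine ⟨NullF.of_caus hd.1 hR.1 ?_, NullF.of_caus hd.2 (by rw [mq_sub_comm]; exact hR.2) ?_⟩
  · intro h0
    rw [sub_eq_zero] at h0
    have := hR.2
    rw [h0, mq_sub_comm] at this
    exact h.2.ne' this
  · intro h0
    rw [sub_eq_zero] at h0
    have := hR.1
    rw [← h0] at this
    exact h.2.ne' this

theorem pointDeg_of_const (G : IsGQ r) (hU : IsUpperM 𝒰) (hφ : Pres r φ 𝒰) (hne : 𝒰.Nonempty)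
    (hN : ∀ M ∈ 𝒰, ¬ CliqueAbove r φ M)
    (hc : ∀ X ∈ 𝒰, ∀ Y, Fut (Y - X) → ¬ r (φ X) (φ Y) → ∀ Z ∈ Sph X Y, ∀ Z' ∈ Sph X Y, φ Z = φ Z') :
    PointDeg r φ 𝒰 := by
  have above : ∀ X ∈ 𝒰, ∀ Y, Fut (Y - X) → ¬ r (φ X) (φ Y) → ∀ R ∈ Sph X Y, ∀ M, Fut (M - R) →
      r (φ M) (φ R) := by
    intro X hX Y h hXY R hR M hM
    by_contra hcon
    obtain ⟨n₁, n₂⟩ := Sph_nullF h hR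
    have hRU := hU X hX R n₁.caus
    have hYU := hU.fut hX h
    obtain ⟨s, hs, hS, -⟩ := exists_mem_Sph_up hM n₁
    obtain ⟨t, ht, hT, -⟩ := exists_mem_Sph_up hM n₂
    have hSU : R + s • (R - X) ∈ 𝒰 :=
      hU R hRU _ (by rw [add_sub_cancel_left]; exact n₁.caus.smul hs.le)
    have hTU : R + t • (Y - R) ∈ 𝒰 :=
      hU R hRU _ (by rw [add_sub_cancel_left]; exact n₂.caus.smul ht.le)
    have he := hc R hRU M hM (fun h => hcon (G.symm h)) _ hS _ hT
    have hSX := hφ _ hSU X hX (by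
      rw [show R + s • (R - X) - X = (1 + s) • (R - X) by module, mq_smul, n₁.2.2.1, mul_zero])
    have hTY := hφ _ hTU Y hYU (by
      rw [show R + t • (Y - R) - Y = (t - 1) • (Y - R) by module, mq_smul, n₂.2.2.1, mul_zero])
    have hSR := hφ _ hSU R hRU hS.1
    have hSM := hφ _ hSU M (hU.fut hRU hM) hS.2
    rw [← he] at hTY
    have := G.eq_of hXY hSX hTY (hφ R hRU X hX hR.1) (hφ R hRU Y hYU hR.2) hSR
    rw [this] at hSM
    exact hcon (G.symm hSM)
  have below : ∀ X ∈ 𝒰, ∀ Y, Fut (Y - X) → ¬ r (φ X) (φ Y) → ∀ R ∈ Sph X Y, ∀ W ∈ 𝒰, Fut (R - W) →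
      r (φ W) (φ R) := by
    intro X hX Y h hXY R hR W hW hM
    by_contra hcon
    obtain ⟨n₁, n₂⟩ := Sph_nullF h hR
    have hRU := hU X hX R n₁.caus
    have hYU := hU.fut hX h
    obtain ⟨s, hs, hS, hS'⟩ := exists_mem_Sph_down hM n₁
    obtain ⟨t, ht, hT, hT'⟩ := exists_mem_Sph_down hM n₂
    have hSU := hU W hW _ hS'
    have hTU := hU W hW _ hT'
    have he := hc W hW R hM hcon _ hS _ hT
    have hSX := hφ _ hSU X hX (by
      rw [show R - s • (R - X) - X = (1 - s) • (R - X) by module, mq_smul, n₁.2.2.1, mul_zero])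
    have hTY := hφ _ hTU Y hYU (by
      rw [show R - t • (Y - R) - Y = (-t - 1) • (Y - R) by module, mq_smul, n₂.2.2.1, mul_zero])
    have hSR := hφ _ hSU R hRU hS.2
    have hSM := hφ _ hSU W hW hS.1
    rw [← he] at hTY
    have := G.eq_of hXY hSX hTY (hφ R hRU X hX hR.1) (hφ R hRU Y hYU hR.2) hSR
    rw [this] at hSM
    exact hcon (G.symm hSM)
  obtain ⟨M, hM⟩ := hne
  obtain ⟨X, Y, hMX, hXY, hg⟩ := exists_good_above G hU hφ hN hM
  obtain ⟨s, hs, hR, -⟩ := exists_mem_Sph_up hXY nullF_e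
  set R := X + s • ![1, 0, 0, 0] with hRd
  have hXU := hU.fut hM hMX
  have hRU := hU X hXU R (Sph_nullF hXY hR).1.caus
  refine ⟨R, hRU, R, hRU, fun W hW _ => ?_⟩
  obtain ⟨N, hNW, hNR⟩ := exists_upper_pair W R
  obtain ⟨X', Y', hMX', hXY', hg'⟩ := exists_good_above G hU hφ hN (hU.fut hW hNW)
  obtain ⟨s', hs', hR', -⟩ := exists_mem_Sph_up hXY' nullF_e
  set R' := X' + s' • ![1, 0, 0, 0] with hRd'
  have hXU' := hU.fut hW (hNW.trans hMX')
  have hXR' := (Sph_nullF hXY' hR').1.caus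
  have hRU' := hU X' hXU' R' hXR'
  have hW' := below X' hXU' Y' hXY' hg' R' hR' W hW ((hNW.trans hMX').trans_caus hXR')
  have hRR' : Fut (R' - R) := (hNR.trans hMX').trans_caus hXR'
  by_cases he : φ R' = φ R
  · rwa [he] at hW'
  · exfalso
    have h1 := above X hXU Y hXY hg R hR R' hRR'
    exact hN R' hRU' fun A B hA hB => G.tri he h1
      (above X' hXU' Y' hXY' hg' R' hR' A hA) (above X hXU Y hXY hg R hR A (hRR'.trans hA))
      (above X' hXU' Y' hXY' hg' R' hR' B hB) (above X hXU Y hXY hg R hR B (hRR'.trans hB))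

theorem Dia_subset_upper (hU : IsUpperM 𝒰) (hX : X ∈ 𝒰) (h : Fut (Y - X)) : Dia X Y ⊆ 𝒰 :=
  fun W hW => hU X hX W ((Dia_iff h).1 hW).1

theorem mid_clique_or_nd3 (G : IsGQ r) (hU : IsUpperM 𝒰) (hφ : Pres r φ 𝒰) (hX : X ∈ 𝒰)
    {Z Z' n n' M : Mink} (hZ : Z ∈ 𝒰) (hZ' : Z' ∈ 𝒰) (hn : NullF n) (hn' : NullF n')
    (h : ∀ s : ℝ, mq (X + s • n - Z) = 0) (h' : ∀ s : ℝ, mq (X + s • n' - Z') = 0)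
    (hzz : ¬ r (φ Z) (φ Z')) (hM : Fut (M - X)) (hg : ¬ r (φ X) (φ M)) :
    (∀ W ∈ Mid X M, ∀ W' ∈ Mid X M, r (φ W) (φ W')) ∨ ND3 r φ X M := by
  by_cases hcl : ∀ W ∈ Mid X M, ∀ W' ∈ Mid X M, r (φ W) (φ W')
  · exact Or.inl hcl
  right
  obtain ⟨s, hs, hS, -⟩ := exists_mem_Sph_up hM hn
  obtain ⟨s', hs', hS', -⟩ := exists_mem_Sph_up hM hn'
  have hSU := hU X hX _ (Sph_nullF hM hS).1.caus
  have hSU' := hU X hX _ (Sph_nullF hM hS').1.caus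
  refine nd3_of_nonconstant G (by rw [mq_sub_comm]; exact hM.2)
    (hφ.mono (Dia_subset_upper hU hX hM)) hg hS hS' (fun he => ?_) hcl
  have hx : φ (X + s • n) = φ X := by
    refine G.eq_of hzz (hφ _ hSU Z hZ (h s)) ?_ (hφ X hX Z hZ (by simpa using h 0))
      (hφ X hX Z' hZ' (by simpa using h' 0)) (hφ _ hSU X hX hS.1)
    rw [he]; exact hφ _ hSU' Z' hZ' (h' s')
  have := hφ _ hSU M (hU.fut hX hM) hS.2
  rw [hx] at this
  exact hg this

theorem exists_nd3_of_nonconst (G : IsGQ r) (hU : IsUpperM 𝒰) (hφ : Pres r φ 𝒰)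
    (hN : ∀ M ∈ 𝒰, ¬ CliqueAbove r φ M) (hX : X ∈ 𝒰) (hXY : Fut (Y - X)) (hg : ¬ r (φ X) (φ Y))
    {Z Z' : Mink} (hZ : Z ∈ Sph X Y) (hZ' : Z' ∈ Sph X Y) (hne : φ Z ≠ φ Z') :
    ∃ A ∈ 𝒰, ∃ B, Fut (B - A) ∧ ND3 r φ A B := by
  by_contra hcon
  push Not at hcon
  have hYU := hU.fut hX hXY
  obtain ⟨n, m⟩ := Sph_nullF hXY hZ
  obtain ⟨n', m'⟩ := Sph_nullF hXY hZ'
  have hZU := hU X hX Z n.caus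
  have hZU' := hU X hX Z' n'.caus
  have hzz : ¬ r (φ Z) (φ Z') := fun h => hne (G.eq_of hg (hφ Z hZU X hX hZ.1) (hφ Z hZU Y hYU hZ.2)
    (hφ Z' hZU' X hX hZ'.1) (hφ Z' hZU' Y hYU hZ'.2) h)
  have key : ∀ A ∈ 𝒰, (∀ M, Fut (M - A) → ¬ r (φ A) (φ M) →
      ∀ W ∈ Mid A M, ∀ W' ∈ Mid A M, r (φ W) (φ W')) →
      ∃ N, ∀ M, Fut (M - N) → r (φ M) (φ A) := by
    intro A hA h
    by_contra hc
    push Not at hc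
    refine hN A hA fun C D hC hD => ?_
    obtain ⟨N, h1, h2⟩ := exists_upper_pair C D
    obtain ⟨M, hM, hMA⟩ := hc N
    have hAM := (hC.trans h1).trans hM
    exact h M hAM (fun h => hMA (G.symm h)) C ((Mid_iff hAM).2 ⟨hC, h1.trans hM⟩) D
      ((Mid_iff hAM).2 ⟨hD, h2.trans hM⟩)
  obtain ⟨N, hNX⟩ := key X hX fun M hM hg' => (mid_clique_or_nd3 G hU hφ hX hZU hZU' n n'
    (fun s => by rw [show X + s • (Z - X) - Z = (s - 1) • (Z - X) by module, mq_smul, n.2.2.1, mul_zero])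
    (fun s => by
      rw [show X + s • (Z' - X) - Z' = (s - 1) • (Z' - X) by module, mq_smul, n'.2.2.1, mul_zero])
    hzz hM hg').resolve_right (hcon X hX M hM)
  obtain ⟨N', hNY⟩ := key Y hYU fun M hM hg' => (mid_clique_or_nd3 G hU hφ hYU hZU hZU' m m'
    (fun s => by rw [show Y + s • (Y - Z) - Z = (s + 1) • (Y - Z) by module, mq_smul, m.2.2.1, mul_zero])
    (fun s => by
      rw [show Y + s • (Y - Z') - Z' = (s + 1) • (Y - Z') by module, mq_smul, m'.2.2.1, mul_zero])
    hzz hM hg').resolve_right (hcon Y hYU M hM)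
  obtain ⟨K, h1, h2⟩ := exists_upper_pair N N'
  obtain ⟨L, h3, h4⟩ := exists_upper_pair K X
  exact hN L (hU.fut hX h4) (cliqueAbove_of_coclique G hU hφ (hU.fut hX h4) hg fun A hA =>
    ⟨hNX A ((h1.trans h3).trans hA), hNY A ((h2.trans h3).trans hA)⟩)

end Coherency

namespace Coherency

/-! ### Maps that send a future into a line -/

variable {T : Type*} {r : T → T → Prop} {X Y : Mink} {φ : Mink → T} {𝒰 : Set Mink}

theorem IsGQ.line_unique (G : IsGQ r) {y₁ y₂ u u' w : T} (hy : y₁ ≠ y₂) (hyy : r y₁ y₂)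
    (hw : ¬ (r w y₁ ∧ r w y₂)) (hu : r u y₁ ∧ r u y₂) (hu' : r u' y₁ ∧ r u' y₂) (huw : r u w)
    (huw' : r u' w) : u = u' := by
  by_contra hne
  have h := G.tri hy hyy hu.1 hu.2 hu'.1 hu'.2
  exact hw ⟨G.tri hne h (G.symm huw) (G.symm huw') (G.symm hu.1) (G.symm hu'.1),
    G.tri hne h (G.symm huw) (G.symm huw') (G.symm hu.2) (G.symm hu'.2)⟩

theorem exists_nullF_of_null {V W : Mink} (h : mq (V - W) = 0) (hne : V ≠ W) :
    ∃ n, NullF n ∧ ∃ ε : ℝ, V = W + ε • n ∧ ε ≠ 0 := by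
  rcases caus_or_neg h.ge with h1 | h1
  · exact ⟨V - W, NullF.of_caus h1 h (sub_ne_zero.2 hne), 1, by module, one_ne_zero⟩
  · exact ⟨-(V - W), NullF.of_caus h1 (by rwa [mq_neg]) (neg_ne_zero.2 (sub_ne_zero.2 hne)), -1,
      by module, by norm_num⟩

theorem mq_line {W n : Mink} (hn : mq n = 0) (s t : ℝ) : mq (W + s • n - (W + t • n)) = 0 := by
  rw [add_sub_add_left_eq_sub, ← sub_smul, mq_smul, hn, mul_zero]

theorem mq_line_self {W n : Mink} (hn : mq n = 0) (s : ℝ) : mq (W + s • n - W) = 0 := by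
  rw [add_sub_cancel_left, mq_smul, hn, mul_zero]

theorem lineDeg_or_pointDeg (G : IsGQ r) (hU : IsUpperM 𝒰) (hφ : Pres r φ 𝒰) {M : Mink} (hM : M ∈ 𝒰)
    (hcl : CliqueAbove r φ M) (hnc : ∀ K ∈ 𝒰, ∃ A B, Fut (A - K) ∧ Fut (B - K) ∧ φ A ≠ φ B) :
    LineDeg r φ 𝒰 ∨ PointDeg r φ 𝒰 := by
  obtain ⟨Y₁, Y₂, hY₁, hY₂, hy⟩ := hnc M hM
  set y₁ := φ Y₁
  set y₂ := φ Y₂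
  have hyy : r y₁ y₂ := hcl _ _ hY₁ hY₂
  have hL : ∀ A, Fut (A - M) → r (φ A) y₁ ∧ r (φ A) y₂ := fun A hA =>
    ⟨hcl _ _ hA hY₁, hcl _ _ hA hY₂⟩
  have uniq : ∀ {u u' w : T}, ¬ (r w y₁ ∧ r w y₂) → (r u y₁ ∧ r u y₂) → (r u' y₁ ∧ r u' y₂) →
      r u w → r u' w → u = u' := fun h1 h2 h3 h4 h5 => G.line_unique hy hyy h1 h2 h3 h4 h5
  have Lcl : ∀ {u u' : T}, (r u y₁ ∧ r u y₂) → (r u' y₁ ∧ r u' y₂) → r u u' := fun h h' =>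
    G.tri hy hyy h.1 h.2 h'.1 h'.2
  have Lmem : ∀ {u u' v : T}, u ≠ u' → (r u y₁ ∧ r u y₂) → (r u' y₁ ∧ r u' y₂) → r v u → r v u' →
      (r v y₁ ∧ r v y₂) := fun hne h h' hv hv' =>
    ⟨G.tri hne (Lcl h h') hv hv' (G.symm h.1) (G.symm h'.1),
      G.tri hne (Lcl h h') hv hv' (G.symm h.2) (G.symm h'.2)⟩
  have bad_coh : ∀ W ∈ 𝒰, ∀ u, ¬ (r (φ W) y₁ ∧ r (φ W) y₂) → (r u y₁ ∧ r u y₂) → r u (φ W) →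
      ∀ V ∈ 𝒰, ∀ V' ∈ 𝒰, ¬ r (φ V) u → ¬ r (φ V') u → mq (V - W) = 0 → mq (V' - W) = 0 →
      mq (V - V') = 0 := by
    intro W hW u hoff hu huw V hV V' hV' hb hb' hVW hVW'
    by_contra hVV
    have ne : ∀ V, ¬ r (φ V) u → V ≠ W := fun V hb h => hb (h ▸ G.symm huw)
    obtain ⟨n, hn, ε, hε, -⟩ := exists_nullF_of_null hVW (ne V hb)
    obtain ⟨n', hn', ε', hε', -⟩ := exists_nullF_of_null hVW' (ne V' hb')
    have hnn : 0 < mb n n' := by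
      refine lt_of_le_of_ne (hn.caus.mb_nonneg hn'.caus) fun h0 => hVV ?_
      rw [hε, hε', add_sub_add_left_eq_sub, mq_sub, mq_smul, mq_smul, mb_smul_left, mb_smul_right,
        ← h0, hn.2.2.1, hn'.2.2.1]
      ring
    have lineU : ∀ {n : Mink}, NullF n → ∀ s : ℝ, 0 ≤ s → ∀ A ∈ 𝒰, A + s • n ∈ 𝒰 :=
      fun hn s hs A hA => hU A hA _ (by rw [add_sub_cancel_left]; exact hn.caus.smul hs)
    have off : ∀ {V n : Mink} {ε : ℝ}, V ∈ 𝒰 → ¬ r (φ V) u → NullF n → V = W + ε • n → ∀ s : ℝ,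
        0 ≤ s → ¬ (r (φ (W + s • n)) y₁ ∧ r (φ (W + s • n)) y₂) := by
      intro V n ε hV hb hn hε s hs hcon
      have hS := lineU hn s hs W hW
      have h1 := hφ _ hS W hW (mq_line_self hn.2.2.1 s)
      have h2 := hφ V hV _ hS (by rw [hε]; exact mq_line hn.2.2.1 _ _)
      rw [uniq hoff hcon hu h1 huw] at h2
      exact hb h2
    obtain ⟨N, hN, hbig⟩ := fut_add_smul_add_smul (W - M) hn hn' hnn
    have big : ∀ s, N ≤ s → ∀ t, N ≤ t → Fut (W + s • n + t • n' - M) := by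
      intro s hs t ht
      convert hbig s hs t ht using 1
      abel
    set K := W + N • n + N • n'
    have hKU : K ∈ 𝒰 := hU.fut hM (big N le_rfl N le_rfl)
    have hWK : ∀ A, Fut (A - K) → φ A = φ K := by
      intro A hA
      have hKW : Fut (K - W) := by
        have : K - W = N • n + N • n' := by simp only [K]; abel
        rw [this]
        exact (hn.smul hN).add_fut (hn'.smul hN) (by
          rw [mb_smul_left, mb_smul_right]; positivity)
      have hAW := hKW.trans hA
      obtain ⟨s, hs, hS, -⟩ := exists_mem_Sph_up hAW hn
      have hNs : N ≤ s := by
        have h1 : Fut (A - W - N • n) := by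
          have := hA.add_caus (hn'.caus.smul hN.le)
          rwa [show A - K + N • n' = A - W - N • n by simp only [K]; abel] at this
        have h2 := h1.2
        have h3 := hS.2
        rw [mq_sub_comm, ← sub_sub, mq_sub, mq_smul, hn.2.2.1, mb_smul_right] at h3
        rw [mq_sub, mq_smul, hn.2.2.1, mb_smul_right] at h2
        have h4 := hAW.mb_pos hn.caus hn.2.2.2
        nlinarith
      have hSU := lineU hn s hs.le W hW
      have hTU := hU.fut hM (big s hNs N le_rfl)
      have hRU := lineU hn' N hN.le W hW
      have e1 : φ A = φ (W + s • n + N • n') :=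
        uniq (off hV hb hn hε s hs.le) (hL A ((big N le_rfl N le_rfl).trans hA))
          (hL _ (big s hNs N le_rfl))
          (G.symm (hφ _ hSU A (hU.fut hKU hA) hS.2))
          (hφ _ hTU _ hSU (mq_line_self hn'.2.2.1 N))
      have e2 : φ (W + s • n + N • n') = φ K :=
        uniq (off hV' hb' hn' hε' N hN.le) (hL _ (big s hNs N le_rfl)) (hL _ (big N le_rfl N le_rfl))
          (hφ _ hTU _ hRU (by
            rw [add_right_comm]; exact mq_line_self hn.2.2.1 s))
          (hφ _ hKU _ hRU (by
            simp only [K]; rw [add_right_comm]; exact mq_line_self hn.2.2.1 N))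
      rw [e1, e2]
    obtain ⟨A, B, hA, hB, hAB⟩ := hnc K hKU
    exact hAB (by rw [hWK A hA, hWK B hB])
  have diff : ∀ W ∈ 𝒰, ∀ W' ∈ 𝒰, ∀ u u', ¬ (r (φ W) y₁ ∧ r (φ W) y₂) → (r u y₁ ∧ r u y₂) →
      r u (φ W) → ¬ (r (φ W') y₁ ∧ r (φ W') y₂) → (r u' y₁ ∧ r u' y₂) → r u' (φ W') → u ≠ u' →
      mq (W - W') = 0 := by
    intro W hW W' hW' u u' ho hu huw ho' hu' huw' hne
    by_contra h
    obtain ⟨V, hV, hVW, hVW', h1, h2⟩ := exists_common hU hW hW' h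
      (P := fun V => ¬ r (φ V) u) (Q := fun V => ¬ r (φ V) u')
      (fun V hV V' hV' hb hb' h1 h1' _ _ => bad_coh W hW u ho hu huw V hV V' hV' hb hb' h1 h1')
      (fun V hV V' hV' hb hb' _ _ h1 h1' => bad_coh W' hW' u' ho' hu' huw' V hV V' hV' hb hb' h1 h1')
    rw [not_not] at h1 h2
    have hv := Lmem hne hu hu' h1 h2
    exact hne ((uniq ho hu hv huw (hφ V hV W hW hVW)).trans
      (uniq ho' hv hu' (hφ V hV W' hW' hVW') huw'))
  have foot : ∀ w, ∃ u, (r u y₁ ∧ r u y₂) ∧ r u w := fun w =>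
    let ⟨u, h1, h2, h3⟩ := G.proj hy hyy w; ⟨u, ⟨h1, h2⟩, h3⟩
  by_cases hex : ∃ W ∈ 𝒰, ∃ W' ∈ 𝒰, ∃ u u', ¬ (r (φ W) y₁ ∧ r (φ W) y₂) ∧ (r u y₁ ∧ r u y₂) ∧
      r u (φ W) ∧ ¬ (r (φ W') y₁ ∧ r (φ W') y₂) ∧ (r u' y₁ ∧ r u' y₂) ∧ r u' (φ W') ∧ u ≠ u'
  · left
    obtain ⟨W, hW, W', hW', u, u', ho, hu, huw, ho', hu', huw', hne⟩ := hex
    have hWW := diff W hW W' hW' u u' ho hu huw ho' hu' huw' hne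
    refine ⟨W, hW, W', hW', fun h => hne (uniq ho hu hu' huw (h ▸ huw')), hWW, y₁, y₂, hy, hyy,
      fun X hX hXW => ?_⟩
    by_contra hoX
    obtain ⟨v, hv, hvX⟩ := foot (φ X)
    apply hXW
    by_cases h1 : u = v
    · have h2 : v ≠ u' := h1 ▸ hne
      have h3 := diff X hX W' hW' v u' hoX hv hvX ho' hu' huw' h2
      refine ⟨?_, h3⟩
      exact bad_coh W' hW' u' ho' hu' huw' X hX W hW
        (fun h => h2 (uniq hoX hv hu' hvX (G.symm h))) (fun h => hne (uniq ho hu hu' huw (G.symm h)))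
        h3 hWW
    · have h3 := diff X hX W hW v u hoX hv hvX ho hu huw (Ne.symm h1)
      refine ⟨h3, ?_⟩
      exact bad_coh W hW u ho hu huw X hX W' hW'
        (fun h => h1 (uniq hoX hu hv (G.symm h) hvX))
        (fun h => hne (uniq ho' hu hu' (G.symm h) huw')) h3 (by rwa [mq_sub_comm])
  · right
    by_cases hno : ∀ W ∈ 𝒰, r (φ W) y₁ ∧ r (φ W) y₂
    · exact ⟨M, hM, M, hM, fun X hX _ => Lcl (hno X hX) (hno M hM)⟩
    simp only [not_forall] at hno
    obtain ⟨W, hW, ho⟩ := hno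
    obtain ⟨u, hu, huw⟩ := foot (φ W)
    have hall : ∀ X ∈ 𝒰, r (φ X) u := by
      intro X hX
      by_cases hoX : r (φ X) y₁ ∧ r (φ X) y₂
      · exact Lcl hoX hu
      · obtain ⟨v, hv, hvX⟩ := foot (φ X)
        have : u = v := by
          by_contra hne
          exact hex ⟨W, hW, X, hX, u, v, ho, hu, huw, hoX, hv, hvX, hne⟩
        exact this ▸ G.symm hvX
    have hnn : 0 < mb (![1, 0, 0, 0] : Mink) ![0, 0, 0, 1] := by simp [mb]
    obtain ⟨N, hN, hbig⟩ := fut_add_smul_add_smul (W - M) nullF_e nullF_e' hnn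
    set S := W + N • (![1, 0, 0, 0] : Mink)
    have hSU : S ∈ 𝒰 := hU W hW _ (by
      rw [add_sub_cancel_left]; exact nullF_e.caus.smul hN.le)
    by_cases hoS : r (φ S) y₁ ∧ r (φ S) y₂
    · have := uniq ho hu hoS huw (hφ S hSU W hW (mq_line_self nullF_e.2.2.1 N))
      exact ⟨M, hM, S, hSU, fun X hX _ => this ▸ hall X hX⟩
    · set K := S + N • (![0, 0, 0, 1] : Mink)
      have hK : Fut (K - M) := by
        convert hbig N le_rfl N le_rfl using 1
        simp only [K, S]; abel
      have hKU := hU.fut hM hK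
      have := uniq hoS hu (hL K hK) (G.symm (hall S hSU))
        (hφ K hKU S hSU (mq_line_self nullF_e'.2.2.1 N))
      exact ⟨M, hM, K, hKU, fun X hX _ => this ▸ hall X hX⟩

end Coherency

namespace Coherency

/-! ### Maps that are constant on a future -/

variable {T : Type*} {r : T → T → Prop} {X Y : Mink} {φ : Mink → T} {𝒰 : Set Mink}

/-- `φ` preserves coherency on the upper set `𝒰` and takes the value `b` on the future of `M`. -/
structure EvConst (r : T → T → Prop) (φ : Mink → T) (𝒰 : Set Mink) (M : Mink) (b : T) : Prop where
  gq : IsGQ r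
  upper : IsUpperM 𝒰
  pres : Pres r φ 𝒰
  mem : M ∈ 𝒰
  const : ∀ A, Fut (A - M) → φ A = b

theorem IsUpperM.add_smul (hU : IsUpperM 𝒰) {n : Mink} (hn : NullF n) {s : ℝ} (hs : 0 ≤ s)
    (hX : X ∈ 𝒰) : X + s • n ∈ 𝒰 :=
  hU X hX _ (by rw [add_sub_cancel_left]; exact hn.caus.smul hs)

namespace EvConst
variable {M : Mink} {b : T}

theorem nonbad (E : EvConst r φ 𝒰 M b) {Z q : Mink} (hZ : Z ∈ 𝒰) (hq : NullF q)
    (h : 0 < mb (Z - M) q) : r (φ Z) b := by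
  obtain ⟨N, hN, hs⟩ := fut_add_smul hq h
  have h1 : Fut (Z + N • q - M) := by
    convert hs N le_rfl using 1; abel
  rw [← E.const _ h1]
  exact E.pres _ hZ _ (E.upper.fut E.mem h1) (by rw [mq_sub_comm]; exact mq_line_self hq.2.2.1 N)

theorem nbr_eq (E : EvConst r φ 𝒰 M b) {V V' : Mink} (hX : X ∈ 𝒰) (hXb : ¬ r (φ X) b)
    (hV : V ∈ 𝒰) (hV' : V' ∈ 𝒰) (h : r (φ V) b) (h' : r (φ V') b) (hVX : mq (V - X) = 0)
    (hVX' : mq (V' - X) = 0) (hVV : mq (V - V') = 0) : φ V = φ V' :=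
  E.gq.eq_of hXb (E.pres _ hV _ hX hVX) h (E.pres _ hV' _ hX hVX') h' (E.pres _ hV _ hV' hVV)

theorem far (E : EvConst r φ 𝒰 M b) {W n : Mink} (hW : W ∈ 𝒰) (hn : NullF n) :
    ∃ N : ℝ, 0 < N ∧ ∀ t, N ≤ t → r (φ (W + t • n)) b := by
  obtain ⟨q, hq, hnq⟩ := hn.exists_transverse
  refine ⟨|mb (W - M) q| / mb n q + 1, by positivity, fun t ht => ?_⟩
  have h0 : 0 < t := lt_of_lt_of_le (by positivity) ht
  refine E.nonbad (E.upper.add_smul hn h0.le hW) hq ?_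
  rw [add_sub_right_comm, mb_add_left, mb_smul_left]
  have : |mb (W - M) q| < t * mb n q := by rw [← div_lt_iff₀ hnq]; linarith
  have := neg_abs_le (mb (W - M) q)
  linarith

theorem pointDeg_of_isolated (E : EvConst r φ 𝒰 M b)
    (hiso : ∀ A ∈ 𝒰, ∀ B ∈ 𝒰, A ≠ B → ¬ r (φ A) b → mq (A - B) = 0 → r (φ B) b) {X X' : Mink}
    (hX : X ∈ 𝒰) (hX' : X' ∈ 𝒰) (hXb : ¬ r (φ X) b) (hXb' : ¬ r (φ X') b) (hne : X ≠ X')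
    (hnf : ¬ Fut (X - X')) : PointDeg r φ 𝒰 := by
  have hW : ∃ n s, NullF n ∧ (0:ℝ) < s ∧ Fut (X' + s • n - X) := by
    have h0 : mq (X' - X) ≠ 0 := fun h => hXb (hiso X' hX' X hX hne.symm hXb' h)
    rcases h0.lt_or_gt with h | h
    · obtain ⟨n, hn, hb⟩ := exists_null_mb_pos h
      obtain ⟨N, hN, hs⟩ := fut_add_smul hn hb
      exact ⟨n, N, hn, hN, by convert hs N le_rfl using 1; abel⟩
    · have := (fut_or_fut h).resolve_left hnf
      refine ⟨_, 1, nullF_e, one_pos, this.trans_caus ?_⟩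
      rw [add_sub_cancel_left]; exact nullF_e.caus.smul zero_le_one
  obtain ⟨m, s, hm, hs, hfut⟩ := hW
  set W := X' + s • m
  have hWU : W ∈ 𝒰 := E.upper.add_smul hm hs.le hX'
  have hWX : mq (W - X') = 0 := mq_line_self hm.2.2.1 s
  have hWne : X' ≠ W := fun h => by
    have : s • m = 0 := by simpa [W] using h
    exact (hm.smul hs).2.2.2 this
  have hWb : r (φ W) b := hiso X' hX' W hWU hWne hXb' (by rwa [mq_sub_comm])
  have hnb : ∀ V ∈ 𝒰, V ≠ X → mq (V - X) = 0 → r (φ V) b := fun V hV hne h =>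
    hiso X hX V hV hne.symm hXb (by rwa [mq_sub_comm])
  have hVW : ∀ V ∈ 𝒰, V ≠ X → mq (V - X) = 0 → r (φ V) (φ W) := by
    intro V hV hVne hVX
    obtain ⟨n, hn, ε, hε, -⟩ := exists_nullF_of_null hVX hVne
    obtain ⟨t, ht, hS, -⟩ := exists_mem_Sph_up hfut hn
    have hSU := E.upper.add_smul hn ht.le hX
    have hSne : X + t • n ≠ X := fun h => (hn.smul ht).2.2.2 (by simpa using h)
    rw [E.nbr_eq hX hXb hV hSU (hnb V hV hVne hVX) (hnb _ hSU hSne hS.1) hVX hS.1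
      (by rw [hε]; exact mq_line hn.2.2.1 _ _)]
    exact E.pres _ hSU _ hWU hS.2
  have heq : ∀ V ∈ 𝒰, V ≠ X → mq (V - X) = 0 → ∀ V' ∈ 𝒰, V' ≠ X → mq (V' - X) = 0 → φ V = φ V' := by
    intro V hV hVne hVX V' hV' hVne' hVX'
    by_contra hcon
    have h1 : ¬ r (φ V) (φ V') := fun h => hcon (E.gq.eq_of hXb (E.pres _ hV _ hX hVX)
      (hnb V hV hVne hVX) (E.pres _ hV' _ hX hVX') (hnb V' hV' hVne' hVX') h)
    have h2 := E.gq.eq_of h1 (E.gq.symm (hVW V hV hVne hVX)) (E.gq.symm (hVW V' hV' hVne' hVX'))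
      (E.gq.symm (hnb V hV hVne hVX)) (E.gq.symm (hnb V' hV' hVne' hVX')) hWb
    exact hXb' (h2 ▸ E.gq.symm (E.pres _ hWU _ hX' hWX))
  have h1U := E.upper.add_smul nullF_e zero_le_one hX
  have h1ne : X + (1:ℝ) • ![1, 0, 0, 0] ≠ X := fun h =>
    (nullF_e.smul one_pos).2.2.2 (add_eq_left.1 h)
  have h1c := mq_line_self (W := X) nullF_e.2.2.1 1
  refine ⟨X, hX, _, h1U, fun V hV hVne => ?_⟩
  by_cases hVX : mq (V - X) = 0
  · rw [heq V hV hVne hVX _ h1U h1ne h1c]; exact E.gq.refl _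
  · obtain ⟨P, hPU, hPV, hPX⟩ := (common_infinite E.upper hV hX hVX).nonempty
    have hPne : P ≠ X := fun h => hVX (by rw [mq_sub_comm, ← h]; exact hPV)
    rw [← heq P hPU hPne hPX _ h1U h1ne h1c]
    exact E.gq.symm (E.pres _ hPU _ hV hPV)

/-- Two coherent points off the neighbourhood of `b` have well-defined values at their neighbours. -/
theorem line_values (E : EvConst r φ 𝒰 M b) {X X' : Mink} (hX : X ∈ 𝒰) (hX' : X' ∈ 𝒰)
    (hXb : ¬ r (φ X) b) (hXb' : ¬ r (φ X') b) (hne : X ≠ X') (h0 : mq (X - X') = 0) :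
    ∃ u u', r u u' ∧ (∃ V ∈ 𝒰, φ V = u ∧ r u b ∧ mq (V - X) = 0 ∧ mq (V - X') ≠ 0) ∧
      (∃ V ∈ 𝒰, φ V = u' ∧ r u' b ∧ mq (V - X') = 0 ∧ mq (V - X) ≠ 0) ∧
      (∀ V ∈ 𝒰, r (φ V) b → mq (V - X) = 0 → mq (V - X') ≠ 0 → φ V = u) ∧
      (∀ V ∈ 𝒰, r (φ V) b → mq (V - X') = 0 → mq (V - X) ≠ 0 → φ V = u') := by
  wlog hc : Caus (X' - X) generalizing X X'
  · have hc' : Caus (X - X') := by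
      have := (caus_or_neg (X := X' - X) (by rw [mq_sub_comm]; exact h0.ge)).resolve_left hc
      rwa [neg_sub] at this
    obtain ⟨u, u', h1, h2, h3, h4, h5⟩ := this hX' hX hXb' hXb hne.symm (by rwa [mq_sub_comm]) hc'
    exact ⟨u', u, E.gq.symm h1, h3, h2, h5, h4⟩
  obtain ⟨d, rfl⟩ : ∃ d, X' = X + d := ⟨X' - X, by abel⟩
  rw [add_sub_cancel_left] at hc
  have hd : NullF d := NullF.of_caus hc (by simpa [mq_neg] using h0) (fun h => hne (by simp [h]))
  obtain ⟨n₁, hn, hnd⟩ := hd.exists_transverse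
  rw [mb_comm] at hnd
  obtain ⟨m₁, m₂, F⟩ := exists_frame hn hd hnd
  set κ := mb n₁ d
  set N : ℝ × ℝ → Mink := fun c => nd n₁ d m₁ m₂ c.1 c.2 with hNdef
  have hN : ∀ c, NullF (N c) := fun c => F.nullF_nd hn hd _ _
  have hNd : ∀ c, mb (N c) d = κ := fun c => F.mb_nd_n2 _ _
  have hNN : ∀ c c', mb (N c) (N c') = κ * ((c.1 - c'.1) ^ 2 + (c.2 - c'.2) ^ 2) := fun c c' =>
    F.mb_nd _ _ _ _
  have hκ := F.pos
  set t₀ : ℝ := |mb (X - M) d| / κ + 1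
  have ht₀ : 0 < t₀ := by positivity
  have hpos : ∀ t, t₀ ≤ t → 0 < mb (X - M) d + t * κ := by
    intro t ht
    have : |mb (X - M) d| < t * κ := by rw [← div_lt_iff₀ hκ]; linarith
    have := neg_abs_le (mb (X - M) d)
    linarith
  have hAU : ∀ c t, t₀ ≤ t → X + t • N c ∈ 𝒰 := fun c t ht =>
    E.upper.add_smul (hN c) (ht₀.le.trans ht) hX
  have hBU : ∀ c t, t₀ ≤ t → X + d + t • N c ∈ 𝒰 := fun c t ht =>
    E.upper.add_smul (hN c) (ht₀.le.trans ht) hX'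
  have hAb : ∀ c t, t₀ ≤ t → r (φ (X + t • N c)) b := fun c t ht =>
    E.nonbad (hAU c t ht) hd (by
      rw [add_sub_right_comm, mb_add_left, mb_smul_left, hNd]; exact hpos t ht)
  have hBb : ∀ c t, t₀ ≤ t → r (φ (X + d + t • N c)) b := fun c t ht =>
    E.nonbad (hBU c t ht) hd (by
      rw [show X + d + t • N c - M = X - M + d + t • N c by abel, mb_add_left, mb_add_left,
        mb_smul_left, hNd, mb_self, hd.2.2.1, mul_zero, add_zero]; exact hpos t ht)
  have hA : ∀ c t, t₀ ≤ t → φ (X + t • N c) = φ (X + t₀ • N c) := fun c t ht =>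
    E.nbr_eq hX hXb (hAU c t ht) (hAU c _ le_rfl) (hAb c t ht) (hAb c _ le_rfl)
      (mq_line_self (hN c).2.2.1 _) (mq_line_self (hN c).2.2.1 _) (mq_line (hN c).2.2.1 _ _)
  have hB : ∀ c t, t₀ ≤ t → φ (X + d + t • N c) = φ (X + d + t₀ • N c) := fun c t ht =>
    E.nbr_eq hX' hXb' (hBU c t ht) (hBU c _ le_rfl) (hBb c t ht) (hBb c _ le_rfl)
      (mq_line_self (hN c).2.2.1 _) (mq_line_self (hN c).2.2.1 _) (mq_line (hN c).2.2.1 _ _)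
  have hAX : ∀ c, r (φ (X + t₀ • N c)) (φ X) := fun c =>
    E.pres _ (hAU c _ le_rfl) _ hX (mq_line_self (hN c).2.2.1 _)
  have hBX : ∀ c, r (φ (X + d + t₀ • N c)) (φ (X + d)) := fun c =>
    E.pres _ (hBU c _ le_rfl) _ hX' (mq_line_self (hN c).2.2.1 _)
  have hcoh : ∀ c c' : ℝ × ℝ, t₀ * ((c.1 - c'.1) ^ 2 + (c.2 - c'.2) ^ 2) < 1 →
      r (φ (X + t₀ • N c)) (φ (X + d + t₀ • N c')) := by
    intro c c' hlt
    set δ := (c.1 - c'.1) ^ 2 + (c.2 - c'.2) ^ 2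
    have hδ : 0 ≤ δ := by positivity
    have h1 : 0 < 1 - t₀ * δ := by linarith
    have ht : t₀ ≤ t₀ / (1 - t₀ * δ) := by
      rw [le_div_iff₀ h1]; nlinarith [mul_nonneg ht₀.le (mul_nonneg ht₀.le hδ)]
    rw [← hB c' _ ht]
    refine E.pres _ (hAU c _ le_rfl) _ (hBU c' _ ht) ?_
    set t := t₀ / (1 - t₀ * δ)
    have htt : t * (1 - t₀ * δ) = t₀ := div_mul_cancel₀ _ h1.ne'
    have : mq (X + t₀ • N c - (X + d + t • N c')) = κ * (t * (1 - t₀ * δ) - t₀) := by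
      rw [show X + t₀ • N c - (X + d + t • N c') = t₀ • N c - t • N c' - d by abel]
      simp only [mq_sub, mq_smul, mb_sub_left, mb_smul_left, mb_smul_right, hNN, hNd, (hN _).2.2.1,
        hd.2.2.1]
      ring
    rw [this, htt, sub_self, mul_zero]
  have hsymm : ∀ c c' : ℝ × ℝ, (c.1 - c'.1) ^ 2 + (c.2 - c'.2) ^ 2 =
      (c'.1 - c.1) ^ 2 + (c'.2 - c.2) ^ 2 := fun c c' => by ring
  have ev : ∀ c : ℝ × ℝ, ∀ᶠ c' in nhds c, t₀ * ((c'.1 - c.1) ^ 2 + (c'.2 - c.2) ^ 2) < 1 := by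
    intro c
    have hcont : Continuous fun c' : ℝ × ℝ => t₀ * ((c'.1 - c.1) ^ 2 + (c'.2 - c.2) ^ 2) := by fun_prop
    exact hcont.continuousAt.eventually (gt_mem_nhds (by simp))
  have hA1 : ∀ c c', φ (X + t₀ • N c) = φ (X + t₀ • N c') := by
    have : IsLocallyConstant fun c => φ (X + t₀ • N c) := by
      rw [IsLocallyConstant.iff_eventually_eq]
      intro c
      filter_upwards [ev c] with c' hc'
      by_contra hcon
      have h1 : ¬ r (φ (X + t₀ • N c')) (φ (X + t₀ • N c)) := fun h => hcon
        (E.gq.eq_of hXb (hAX c') (hAb c' _ le_rfl) (hAX c) (hAb c _ le_rfl) h)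
      have h2 := E.gq.eq_of h1 (E.gq.symm (hcoh c' c hc'))
        (E.gq.symm (hcoh c c (by simp))) (E.gq.symm (hAb c' _ le_rfl)) (E.gq.symm (hAb c _ le_rfl))
        (hBb c _ le_rfl)
      exact hXb' (E.gq.symm (h2 ▸ hBX c))
    exact fun c c' => this.apply_eq_of_preconnectedSpace c c'
  have hB1 : ∀ c c', φ (X + d + t₀ • N c) = φ (X + d + t₀ • N c') := by
    have : IsLocallyConstant fun c => φ (X + d + t₀ • N c) := by
      rw [IsLocallyConstant.iff_eventually_eq]
      intro c
      filter_upwards [ev c] with c' hc'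
      by_contra hcon
      have h1 : ¬ r (φ (X + d + t₀ • N c')) (φ (X + d + t₀ • N c)) := fun h => hcon
        (E.gq.eq_of hXb' (hBX c') (hBb c' _ le_rfl) (hBX c) (hBb c _ le_rfl) h)
      have h2 := E.gq.eq_of h1 (hcoh c c' (by rwa [hsymm]))
        (hcoh c c (by simp)) (E.gq.symm (hBb c' _ le_rfl)) (E.gq.symm (hBb c _ le_rfl))
        (hAb c _ le_rfl)
      exact hXb (E.gq.symm (h2 ▸ hAX c))
    exact fun c c' => this.apply_eq_of_preconnectedSpace c c'
  have hAd : mq (X + t₀ • N 0 - (X + d)) ≠ 0 := by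
    rw [add_sub_add_left_eq_sub, mq_sub, mq_smul, (hN 0).2.2.1, hd.2.2.1, mb_smul_left, hNd]
    have : 0 < t₀ * κ := by positivity
    linarith
  have hBd : mq (X + d + t₀ • N 0 - X) ≠ 0 := by
    rw [show X + d + t₀ • N 0 - X = d + t₀ • N 0 by abel, mq_add, mq_smul, (hN 0).2.2.1, hd.2.2.1,
      mb_smul_right, mb_comm, hNd]
    have : 0 < t₀ * κ := by positivity
    linarith
  refine ⟨φ (X + t₀ • N 0), φ (X + d + t₀ • N 0), hcoh 0 0 (by simp),
    ⟨_, hAU 0 _ le_rfl, rfl, hAb 0 _ le_rfl, mq_line_self (hN 0).2.2.1 _, hAd⟩,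
    ⟨_, hBU 0 _ le_rfl, rfl, hBb 0 _ le_rfl, mq_line_self (hN 0).2.2.1 _, hBd⟩, ?_, ?_⟩
  · intro V hV hVb hVX hVX'
    have hb : mb (V - X) d ≠ 0 := by
      intro h; apply hVX'
      rw [← sub_sub, mq_sub, hVX, hd.2.2.1, h]; ring
    obtain ⟨c, c', hcc⟩ := F.exists_nd hVX hb
    have hVe : V = X + (mb (V - X) d / κ) • N (c, c') := by rw [← hcc]; abel
    rw [hA1 0 (c, c')]
    refine E.nbr_eq hX hXb hV (hAU _ _ le_rfl) hVb (hAb _ _ le_rfl) hVX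
      (mq_line_self (hN _).2.2.1 _) ?_
    rw [hVe]; exact mq_line (hN _).2.2.1 _ _
  · intro V hV hVb hVX hVX'
    have hb : mb (V - (X + d)) d ≠ 0 := by
      intro h; apply hVX'
      rw [show V - X = V - (X + d) + d by abel, mq_add, hVX, hd.2.2.1, h]; ring
    obtain ⟨c, c', hcc⟩ := F.exists_nd hVX hb
    have hVe : V = X + d + (mb (V - (X + d)) d / κ) • N (c, c') := by rw [← hcc]; abel
    rw [hB1 0 (c, c')]
    refine E.nbr_eq hX' hXb' hV (hBU _ _ le_rfl) hVb (hBb _ _ le_rfl) hVX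
      (mq_line_self (hN _).2.2.1 _) ?_
    rw [hVe]; exact mq_line (hN _).2.2.1 _ _

end EvConst
end Coherency

namespace Coherency

variable {T : Type*} {r : T → T → Prop} {X Y : Mink} {φ : Mink → T} {𝒰 : Set Mink}

/-- `V` lies on the line through the coherent points `X` and `X'`. -/
def OnL (X X' V : Mink) : Prop := mq (V - X) = 0 ∧ mq (V - X') = 0

theorem OnL.coh {X X' V V' : Mink} (hne : X ≠ X') (h0 : mq (X - X') = 0) (h : OnL X X' V)
    (h' : OnL X X' V') : mq (V - V') = 0 := mink_tri hne h0 h.1 h.2 h'.1 h'.2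

theorem OnL.of_two {X X' S S' P : Mink} (hne : X ≠ X') (h0 : mq (X - X') = 0) (h : OnL X X' S)
    (h' : OnL X X' S') (hSS : S ≠ S') (hP : mq (P - S) = 0) (hP' : mq (P - S') = 0) :
    OnL X X' P :=
  ⟨mink_tri hSS (h.coh hne h0 h') hP hP' (by rw [mq_sub_comm]; exact h.1)
      (by rw [mq_sub_comm]; exact h'.1),
    mink_tri hSS (h.coh hne h0 h') hP hP' (by rw [mq_sub_comm]; exact h.2)
      (by rw [mq_sub_comm]; exact h'.2)⟩

namespace EvConst
variable {M : Mink} {b : T}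

theorem lineDeg_of_onL (E : EvConst r φ 𝒰 M b) {X X' : Mink} (hX : X ∈ 𝒰) (hX' : X' ∈ 𝒰)
    (hXb : ¬ r (φ X) b) (hXb' : ¬ r (φ X') b) (hne : X ≠ X') (h0 : mq (X - X') = 0)
    (hall : ∀ V ∈ 𝒰, ¬ r (φ V) b → OnL X X' V) : LineDeg r φ 𝒰 := by
  obtain ⟨u, u', -, ⟨V₀, hV₀, hV₀u, hub, hV₀X, -⟩, -, hval, -⟩ :=
    E.line_values hX hX' hXb hXb' hne h0
  have hux : r u (φ X) := hV₀u ▸ E.pres _ hV₀ _ hX hV₀X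
  refine ⟨X, hX, X', hX', hne, h0, b, u, fun h => hXb (E.gq.symm (h ▸ hux)), E.gq.symm hub,
    fun V hV hoff => ?_⟩
  have nb : ∀ V ∈ 𝒰, ¬ OnL X X' V → r (φ V) b := fun V hV h => by
    by_contra hc; exact h (hall V hV hc)
  refine ⟨nb V hV hoff, ?_⟩
  by_cases hVX : mq (V - X) = 0
  · rw [hval V hV (nb V hV hoff) hVX fun h => hoff ⟨hVX, h⟩]
    exact E.gq.refl _
  · obtain ⟨W, hW, hWV, hWX, hWX', -⟩ := exists_common E.upper hV hX hVX (P := OnL X X')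
      (Q := OnL X X') (fun _ _ _ _ h h' _ _ _ _ => h.coh hne h0 h')
      (fun _ _ _ _ h h' _ _ _ _ => h.coh hne h0 h')
    rw [← hval W hW (nb W hW hWX') hWX fun h => hWX' ⟨hWX, h⟩]
    exact E.pres _ hV _ hW (by rwa [mq_sub_comm])

/-- On a line other than `OnL X X'` there are points that map to neighbours of `b`. -/
theorem far_off (E : EvConst r φ 𝒰 M b) {X X' : Mink} (hne : X ≠ X') (h0 : mq (X - X') = 0)
    {P V : Mink} (hP : P ∈ 𝒰) (hPV : V ≠ P) (h : mq (V - P) = 0) (hoff : ¬ (OnL X X' P ∧ OnL X X' V)) :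
    ∃ S ∈ 𝒰, r (φ S) b ∧ mq (S - P) = 0 ∧ mq (S - V) = 0 ∧ ¬ OnL X X' S := by
  obtain ⟨n, hn, ε, hε, -⟩ := exists_nullF_of_null h hPV
  obtain ⟨N, hN, hb⟩ := E.far hP hn
  have hN1 : 0 < N + 1 := by linarith
  have hl : ∀ t : ℝ, mq (P + t • n - V) = 0 := fun t => by rw [hε]; exact mq_line hn.2.2.1 _ _
  by_cases h1 : OnL X X' (P + N • n)
  · refine ⟨_, E.upper.add_smul hn hN1.le hP, hb _ (by linarith), mq_line_self hn.2.2.1 _, hl _,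
      fun h2 => hoff ?_⟩
    have hSS : P + N • n ≠ P + (N + 1) • n := fun h => hn.2.2.2 (by
      have := add_left_cancel h
      rw [add_smul, one_smul, left_eq_add] at this
      exact this)
    refine ⟨h1.of_two hne h0 h2 hSS ?_ ?_, h1.of_two hne h0 h2 hSS ?_ ?_⟩ <;> rw [mq_sub_comm]
    · exact mq_line_self hn.2.2.1 _
    · exact mq_line_self hn.2.2.1 _
    · exact hl _
    · exact hl _
  · exact ⟨_, E.upper.add_smul hn hN.le hP, hb N le_rfl, mq_line_self hn.2.2.1 _, hl _, h1⟩

theorem nbr_off_line (E : EvConst r φ 𝒰 M b) {X X' : Mink} (hX : X ∈ 𝒰)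
    (hne : X ≠ X') (h0 : mq (X - X') = 0) {u : T}
    (hval : ∀ V ∈ 𝒰, r (φ V) b → mq (V - X) = 0 → mq (V - X') ≠ 0 → φ V = u) {W V : Mink}
    (hW : W ∈ 𝒰) (hWb : ¬ r (φ W) b) (hWoff : ¬ OnL X X' W) (hV : V ∈ 𝒰) (hVb : r (φ V) b)
    (hVW : mq (V - W) = 0) : r (φ V) u := by
  have hVne : V ≠ W := fun h => hWb (h ▸ hVb)
  obtain ⟨n, hn, ε, hε, -⟩ := exists_nullF_of_null hVW hVne
  obtain ⟨q₁, hq₁, hnq⟩ := hn.exists_transverse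
  rw [mb_comm] at hnq
  obtain ⟨m₁, m₂, F⟩ := exists_frame hq₁ hn hnq
  set q : ℝ → Mink := fun c => nd q₁ n m₁ m₂ c 0 with hqd
  have hq : ∀ c, NullF (q c) := fun c => F.nullF_nd hq₁ hn _ _
  have hqn : ∀ c, mb n (q c) = mb q₁ n := fun c => by rw [mb_comm]; exact F.mb_nd_n2 _ _
  have hqq : 0 < mb (q 0) (q 1) := by
    have := F.mb_nd 0 0 1 0
    simp only [hqd, this]
    have := F.pos
    norm_num; exact this
  have hlarge : ∀ A : ℝ, ∃ N : ℝ, 0 < N ∧ ∀ t, N ≤ t → 0 < A + t * mb q₁ n := by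
    intro A
    refine ⟨|A| / mb q₁ n + 1, by positivity, fun t ht => ?_⟩
    have : |A| < t * mb q₁ n := by rw [← div_lt_iff₀ hnq]; linarith
    have := neg_abs_le A
    linarith
  obtain ⟨N₁, hN₁, hL₁⟩ := hlarge (mb (W - M) (q 0))
  obtain ⟨N₂, -, hL₂⟩ := hlarge (mb (W - M) (q 1))
  obtain ⟨N₃, -, hL₃⟩ := hlarge (mb (W - X) (q 0))
  obtain ⟨N₄, -, hL₄⟩ := hlarge (mb (W - X) (q 1))
  have main : ∀ t, N₁ ≤ t → N₂ ≤ t → N₃ ≤ t → N₄ ≤ t → ¬ OnL X X' (W + t • n) → r (φ V) u := by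
    intro t h1 h2 h3 h4 hoff
    set Z := W + t • n
    have hZU : Z ∈ 𝒰 := E.upper.add_smul hn (hN₁.le.trans h1) hW
    have hZM : ∀ c, mb (Z - M) (q c) = mb (W - M) (q c) + t * mb q₁ n := fun c => by
      rw [show Z - M = W - M + t • n by simp only [Z]; abel, mb_add_left, mb_smul_left, hqn]
    have hZX : ∀ c, mb (Z - X) (q c) = mb (W - X) (q c) + t * mb q₁ n := fun c => by
      rw [show Z - X = W - X + t • n by simp only [Z]; abel, mb_add_left, mb_smul_left, hqn]
    have hZM0 : 0 < mb (Z - M) (q 0) := by rw [hZM]; exact hL₁ t h1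
    have hZM1 : 0 < mb (Z - M) (q 1) := by rw [hZM]; exact hL₂ t h2
    have hZX0 : 0 < mb (Z - X) (q 0) := by rw [hZX]; exact hL₃ t h3
    have hZX1 : 0 < mb (Z - X) (q 1) := by rw [hZX]; exact hL₄ t h4
    have hZb : r (φ Z) b := E.nonbad hZU (hq 0) hZM0
    rw [E.nbr_eq hW hWb hV hZU hVb hZb hVW (mq_line_self hn.2.2.1 _)
      (by rw [hε]; exact mq_line hn.2.2.1 _ _)]
    by_cases hc : mq (Z - X) = 0
    · rw [hval Z hZU hZb hc fun h => hoff ⟨hc, h⟩]; exact E.gq.refl _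
    set A : ℝ → Mink := fun c => Z - (mq (Z - X) / mb (Z - X) (q c)) • q c with hAd
    have hAX : ∀ c, 0 < mb (Z - X) (q c) → mq (A c - X) = 0 := fun c hp => by
      simp only [hAd]
      rw [sub_right_comm, mq_sub, mq_smul, (hq c).2.2.1, mb_smul_right, div_mul_cancel₀ _ hp.ne']
      ring
    have hAZ : ∀ c, mq (A c - Z) = 0 := fun c => by
      simp only [hAd]
      rw [sub_sub_cancel_left, mq_neg, mq_smul, (hq c).2.2.1, mul_zero]
    have hAU : ∀ c, 0 < mb (Z - X) (q c) → A c ∈ 𝒰 := by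
      intro c hp
      rcases lt_or_gt_of_ne hc with h | h
      · have : A c = Z + (-(mq (Z - X) / mb (Z - X) (q c))) • q c := by simp only [hAd]; module
        rw [this]
        exact E.upper.add_smul (hq c) (neg_nonneg.2 (div_nonpos_of_nonpos_of_nonneg h.le hp.le)) hZU
      · have hf : Fut (Z - X) := by
          rcases caus_or_neg h.le with h' | h'
          · exact h'.fut h
          · have := h'.mb_nonneg (hq c).caus
            rw [mb_neg_left] at this
            linarith
        refine E.upper X hX _ ?_
        have := (hf.split (hq c)).2.1.caus
        simp only [hAd]
        rwa [sub_right_comm]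
    have fin : ∀ c, 0 < mb (Z - X) (q c) → 0 < mb (Z - M) (q c) → ¬ OnL X X' (A c) → r (φ Z) u := by
      intro c hp hp' hoffA
      have hAb : r (φ (A c)) b := E.nonbad (hAU c hp) (hq c) (by
        simp only [hAd]
        rwa [sub_right_comm, mb_sub_left, mb_smul_left, mb_self, (hq c).2.2.1, mul_zero, mul_zero,
          sub_zero])
      rw [← hval _ (hAU c hp) hAb (hAX c hp) fun h => hoffA ⟨hAX c hp, h⟩]
      exact E.pres _ hZU _ (hAU c hp) (by rw [mq_sub_comm]; exact hAZ c)
    by_cases hA0 : OnL X X' (A 0)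
    · refine fin 1 hZX1 hZM1 fun hA1 => ?_
      have he : A 0 = A 1 := mink_eq_of hc (hAZ 0) (hAX 0 hZX0) (hAZ 1) (hAX 1 hZX1)
        (hA0.coh hne h0 hA1)
      have := congrArg (fun v => mb (Z - v) (q 1)) he
      simp only [hAd, sub_sub_cancel, mb_smul_left, mb_self, (hq 1).2.2.1, mul_zero] at this
      have h5 := (mul_eq_zero.1 this).resolve_right hqq.ne'
      exact (div_ne_zero hc hZX0.ne') h5
    · exact fin 0 hZX0 hZM0 hA0
  set t := max (max N₁ N₂) (max N₃ N₄) with ht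
  have ht1 : N₁ ≤ t := (le_max_left _ _).trans (le_max_left _ _)
  have ht2 : N₂ ≤ t := (le_max_right _ _).trans (le_max_left _ _)
  have ht3 : N₃ ≤ t := (le_max_left _ _).trans (le_max_right _ _)
  have ht4 : N₄ ≤ t := (le_max_right _ _).trans (le_max_right _ _)
  by_cases h1 : OnL X X' (W + t • n)
  · refine main (t + 1) (by linarith) (by linarith) (by linarith) (by linarith) fun h2 => hWoff ?_
    refine h1.of_two hne h0 h2 (fun h => hn.2.2.2 ?_) ?_ ?_
    · have := add_left_cancel h
      rw [add_smul, one_smul, left_eq_add] at this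
      exact this
    · rw [mq_sub_comm]; exact mq_line_self hn.2.2.1 _
    · rw [mq_sub_comm]; exact mq_line_self hn.2.2.1 _
  · exact main t ht1 ht2 ht3 ht4 h1

theorem pointDeg_of_off_line (E : EvConst r φ 𝒰 M b) {X X' P₀ : Mink} (hX : X ∈ 𝒰) (hX' : X' ∈ 𝒰)
    (hXb : ¬ r (φ X) b) (hXb' : ¬ r (φ X') b) (hne : X ≠ X') (h0 : mq (X - X') = 0)
    (hP₀ : P₀ ∈ 𝒰) (hPb : ¬ r (φ P₀) b) (hPoff : ¬ OnL X X' P₀) : PointDeg r φ 𝒰 := by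
  obtain ⟨w, -, -, ⟨V₀, hV₀, hV₀u, hwb, hV₀X, -⟩, -, hval, -⟩ :=
    E.line_values hX hX' hXb hXb' hne h0
  have hwx : r w (φ X) := hV₀u ▸ E.pres _ hV₀ _ hX hV₀X
  have hbw : b ≠ w := fun h => hXb (E.gq.symm (h ▸ hwx))
  have hrbw : r b w := E.gq.symm hwb
  have nbr : ∀ P ∈ 𝒰, ¬ r (φ P) b → ∀ V ∈ 𝒰, r (φ V) b → mq (V - P) = 0 →
      ¬ (OnL X X' P ∧ OnL X X' V) → r (φ V) w := by
    intro P hP hPb V hV hVb hVP hoff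
    by_cases hPon : OnL X X' P
    · have hVoff : ¬ OnL X X' V := fun h => hoff ⟨hPon, h⟩
      by_cases hPX : X = P
      · subst hPX
        rw [hval V hV hVb hVP fun h => hVoff ⟨hVP, h⟩]; exact E.gq.refl _
      obtain ⟨v, v', hvv, ⟨S, hS, hSv, hvb, hSX, hSP⟩, -, -, hv'⟩ :=
        E.line_values hX hP hXb hPb hPX (by rw [mq_sub_comm]; exact hPon.1)
      have h1 : v = w := by
        rw [← hSv] at hvb ⊢
        refine hval S hS hvb hSX fun h => hSP ?_
        exact mink_tri hne h0 hSX h hPon.1 hPon.2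
      rw [hv' V hV hVb hVP fun h => hVoff ?_, ← h1]
      · exact E.gq.symm hvv
      · refine ⟨h, mink_tri hPX (by rw [mq_sub_comm]; exact hPon.1) h hVP
          (by rw [mq_sub_comm]; exact h0) (by rw [mq_sub_comm]; exact hPon.2)⟩
    · exact E.nbr_off_line hX hne h0 hval hP hPb hPon hV hVb hVP
  have uniq : ∀ {c u u' : T}, ¬ r c b → (r u b ∧ r u w) → (r u' b ∧ r u' w) → r u c → r u' c →
      u = u' := fun hc h1 h2 h3 h4 => E.gq.line_unique hbw hrbw (fun h => hc h.1) h1 h2 h3 h4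
  have far : ∀ P ∈ 𝒰, ¬ r (φ P) b → ∀ u, (r u b ∧ r u w) → r u (φ P) → ∀ V ∈ 𝒰,
      mq (V - P) = 0 → ¬ (OnL X X' P ∧ OnL X X' V) → r (φ V) u := by
    intro P hP hPb u hu huP V hV hVP hoff
    by_cases hVe : V = P
    · rw [hVe]; exact E.gq.symm huP
    obtain ⟨S, hS, hSb, hSP, hSV, hSoff⟩ := E.far_off hne h0 hP hVe hVP hoff
    have : φ S = u := uniq hPb ⟨hSb, nbr P hP hPb S hS hSb hSP fun h => hSoff h.2⟩ hu
      (E.pres _ hS _ hP hSP) huP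
    rw [← this]
    exact E.pres _ hV _ hS (by rwa [mq_sub_comm])
  obtain ⟨u, hub, huw, huP⟩ := E.gq.proj hbw hrbw (φ P₀)
  have hu : r u b ∧ r u w := ⟨hub, huw⟩
  have avoid : ∀ {A B : Mink}, A ∈ 𝒰 → B ∈ 𝒰 → mq (A - B) ≠ 0 →
      ∃ V ∈ 𝒰, mq (V - A) = 0 ∧ mq (V - B) = 0 ∧ ¬ OnL X X' V := fun hA hB h =>
    let ⟨V, hV, h1, h2, h3, _⟩ := exists_common E.upper hA hB h (P := OnL X X') (Q := OnL X X')
      (fun _ _ _ _ h h' _ _ _ _ => h.coh hne h0 h') (fun _ _ _ _ h h' _ _ _ _ => h.coh hne h0 h')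
    ⟨V, hV, h1, h2, h3⟩
  have bads : ∀ P ∈ 𝒰, ¬ r (φ P) b → r (φ P) u := by
    intro P hP hPb'
    obtain ⟨v, hvb, hvw, hvP⟩ := E.gq.proj hbw hrbw (φ P)
    have hv : r v b ∧ r v w := ⟨hvb, hvw⟩
    by_cases hvu : v = u
    · rw [← hvu]; exact E.gq.symm hvP
    by_cases hPP : mq (P - P₀) = 0
    · exact far P₀ hP₀ hPb u hu huP P hP hPP fun h => hPoff h.1
    · obtain ⟨V, hV, hVP, hVP₀, hVoff⟩ := avoid hP hP₀ hPP
      have h1 := far P hP hPb' v hv hvP V hV hVP fun h => hVoff h.2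
      have h2 := far P₀ hP₀ hPb u hu huP V hV hVP₀ fun h => hVoff h.2
      have hvu' : r v u := E.gq.tri hbw hrbw hv.1 hv.2 hu.1 hu.2
      have hVb : r (φ V) b := E.gq.tri hvu hvu' h1 h2 (E.gq.symm hv.1) (E.gq.symm hu.1)
      have hVw : r (φ V) w := E.gq.tri hvu hvu' h1 h2 (E.gq.symm hv.2) (E.gq.symm hu.2)
      exact absurd ((uniq hPb' hv ⟨hVb, hVw⟩ hvP (E.pres _ hV _ hP hVP)).trans
        (uniq hPb ⟨hVb, hVw⟩ hu (E.pres _ hV _ hP₀ hVP₀) huP)) hvu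
  obtain ⟨N, hN, hfar⟩ := E.far hP₀ nullF_e
  have hSU := E.upper.add_smul nullF_e hN.le hP₀
  have hSc := mq_line_self (W := P₀) nullF_e.2.2.1 N
  have hSu : φ (P₀ + N • ![1, 0, 0, 0]) = u := uniq hPb ⟨hfar N le_rfl,
    nbr P₀ hP₀ hPb _ hSU (hfar N le_rfl) hSc fun h => hPoff h.1⟩ hu (E.pres _ hSU _ hP₀ hSc) huP
  refine ⟨X, hX, _, hSU, fun W hW _ => ?_⟩
  rw [hSu]
  by_cases hWb : r (φ W) b
  swap
  · exact bads W hW hWb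
  by_cases hWP : mq (W - P₀) = 0
  · exact far P₀ hP₀ hPb u hu huP W hW hWP fun h => hPoff h.1
  obtain ⟨V, hV, hVW, hVP, hVoff⟩ := avoid hW hP₀ hWP
  by_cases hVb : r (φ V) b
  · have : φ V = u := uniq hPb ⟨hVb, nbr P₀ hP₀ hPb V hV hVb hVP fun h => hPoff h.1⟩ hu
      (E.pres _ hV _ hP₀ hVP) huP
    rw [← this]
    exact E.pres _ hW _ hV (by rwa [mq_sub_comm])
  · exact far V hV hVb u hu (E.gq.symm (bads V hV hVb)) W hW (by rwa [mq_sub_comm]) fun h => hVoff h.1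

theorem deg (E : EvConst r φ 𝒰 M b) : LineDeg r φ 𝒰 ∨ PointDeg r φ 𝒰 := by
  by_cases h1 : ∃ X ∈ 𝒰, ∃ X' ∈ 𝒰, X ≠ X' ∧ ¬ r (φ X) b ∧ ¬ r (φ X') b ∧ mq (X - X') = 0
  · obtain ⟨X, hX, X', hX', hne, hb, hb', h0⟩ := h1
    by_cases h2 : ∀ V ∈ 𝒰, ¬ r (φ V) b → OnL X X' V
    · exact Or.inl (E.lineDeg_of_onL hX hX' hb hb' hne h0 h2)
    · push Not at h2
      obtain ⟨P, hP, hPb, hPoff⟩ := h2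
      exact Or.inr (E.pointDeg_of_off_line hX hX' hb hb' hne h0 hP hPb hPoff)
  right
  have hiso : ∀ A ∈ 𝒰, ∀ B ∈ 𝒰, A ≠ B → ¬ r (φ A) b → mq (A - B) = 0 → r (φ B) b := by
    intro A hA B hB hne hAb h0
    by_contra hBb
    exact h1 ⟨A, hA, B, hB, hne, hAb, hBb, h0⟩
  by_cases h2 : ∃ X ∈ 𝒰, ∃ X' ∈ 𝒰, X ≠ X' ∧ ¬ r (φ X) b ∧ ¬ r (φ X') b
  · obtain ⟨X, hX, X', hX', hne, hb, hb'⟩ := h2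
    by_cases hf : Fut (X - X')
    · refine E.pointDeg_of_isolated hiso hX' hX hb' hb hne.symm fun h => ?_
      have := (hf.trans h).2
      rw [sub_self, mq_zero] at this
      exact this.false
    · exact E.pointDeg_of_isolated hiso hX hX' hb hb' hne hf
  obtain ⟨K, hK, -⟩ := exists_upper_pair M M
  have hKU := E.upper.fut E.mem hK
  rw [← E.const K hK] at h2
  by_cases h3 : ∃ X ∈ 𝒰, ¬ r (φ X) (φ K)
  · obtain ⟨X, hX, hXb⟩ := h3
    refine ⟨X, hX, K, hKU, fun V hV hne => ?_⟩
    by_contra hVb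
    exact h2 ⟨V, hV, X, hX, hne, hVb, hXb⟩
  · push Not at h3
    exact ⟨K, hKU, K, hKU, fun V hV _ => h3 V hV⟩

end EvConst

/-- A coherency preserver on an upper set is degenerate or nondegenerate on some interval. -/
theorem trichotomy (G : IsGQ r) (hU : IsUpperM 𝒰) (hφ : Pres r φ 𝒰) (hne : 𝒰.Nonempty) :
    LineDeg r φ 𝒰 ∨ PointDeg r φ 𝒰 ∨ ∃ A ∈ 𝒰, ∃ B, Fut (B - A) ∧ ND3 r φ A B := by
  by_cases hN : ∀ M ∈ 𝒰, ¬ CliqueAbove r φ M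
  · right
    by_cases hc : ∀ X ∈ 𝒰, ∀ Y, Fut (Y - X) → ¬ r (φ X) (φ Y) →
        ∀ Z ∈ Sph X Y, ∀ Z' ∈ Sph X Y, φ Z = φ Z'
    · exact Or.inl (pointDeg_of_const G hU hφ hne hN hc)
    · push Not at hc
      obtain ⟨X, hX, Y, hXY, hg, Z, hZ, Z', hZ', hzz⟩ := hc
      exact Or.inr (exists_nd3_of_nonconst G hU hφ hN hX hXY hg hZ hZ' hzz)
  · push Not at hN
    obtain ⟨M, hM, hcl⟩ := hN
    rw [← or_assoc]
    left
    by_cases hnc : ∀ K ∈ 𝒰, ∃ A B, Fut (A - K) ∧ Fut (B - K) ∧ φ A ≠ φ B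
    · exact lineDeg_or_pointDeg G hU hφ hM hcl hnc
    · push Not at hnc
      obtain ⟨K, hK, hc⟩ := hnc
      obtain ⟨L, hL, -⟩ := exists_upper_pair K K
      exact EvConst.deg (b := φ L) ⟨G, hU, hφ, hK, fun A hA => hc A L hA hL⟩

end Coherency

namespace Coherency

/-! ### The quadric model -/

/-- The six-dimensional space containing the Lie quadric. -/
abbrev Vec : Type := ℝ × Mink × ℝ

/-- The quadratic form of signature `(2, 4)`. -/
def vq (v : Vec) : ℝ := mq v.2.1 - v.1 * v.2.2

/-- The bilinear form with `vb v v = 2 * vq v`. -/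
def vb (v w : Vec) : ℝ := mb v.2.1 w.2.1 - v.1 * w.2.2 - w.1 * v.2.2

/-- The point of the quadric corresponding to `X`. -/
def emb (X : Mink) : Vec := (1, X, mq X)

theorem vb_comm (v w : Vec) : vb v w = vb w v := by simp only [vb, mb_comm]; ring
theorem vb_self (v : Vec) : vb v v = 2 * vq v := by simp only [vb, vq, mb_self]; ring
theorem vb_add_left (u v w : Vec) : vb (u + v) w = vb u w + vb v w := by
  simp only [vb, Prod.fst_add, Prod.snd_add, mb_add_left]; ring
theorem vb_add_right (u v w : Vec) : vb u (v + w) = vb u v + vb u w := by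
  simp only [vb, Prod.fst_add, Prod.snd_add, mb_add_right]; ring
theorem vb_smul_left (t : ℝ) (v w : Vec) : vb (t • v) w = t * vb v w := by
  simp only [vb, Prod.smul_fst, Prod.smul_snd, mb_smul_left, smul_eq_mul]; ring
theorem vb_smul_right (t : ℝ) (v w : Vec) : vb v (t • w) = t * vb v w := by
  simp only [vb, Prod.smul_fst, Prod.smul_snd, mb_smul_right, smul_eq_mul]; ring
theorem vb_sub_left (u v w : Vec) : vb (u - v) w = vb u w - vb v w := by
  simp only [vb, Prod.fst_sub, Prod.snd_sub, mb_sub_left]; ring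
theorem vq_add (v w : Vec) : vq (v + w) = vq v + vq w + vb v w := by
  simp only [vq, vb, Prod.fst_add, Prod.snd_add, mq_add]; ring
theorem vq_smul (t : ℝ) (v : Vec) : vq (t • v) = t ^ 2 * vq v := by
  simp only [vq, Prod.smul_fst, Prod.smul_snd, mq_smul, smul_eq_mul]; ring
theorem vb_zero_left (v : Vec) : vb 0 v = 0 := by simp [vb, mb_zero_left]

theorem vq_emb (X : Mink) : vq (emb X) = 0 := by simp [vq, emb]
theorem vb_emb (X Y : Mink) : vb (emb X) (emb Y) = -mq (X - Y) := by
  simp only [vb, emb, mq_sub]; ring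
theorem emb_ne_zero (X : Mink) : emb X ≠ 0 := fun h => by simpa [emb] using congrArg Prod.fst h

theorem vec_ext {v w : Vec} (h : v.1 = w.1) (h0 : v.2.1 0 = w.2.1 0) (h1 : v.2.1 1 = w.2.1 1)
    (h2 : v.2.1 2 = w.2.1 2) (h3 : v.2.1 3 = w.2.1 3) (h' : v.2.2 = w.2.2) : v = w :=
  Prod.ext h (Prod.ext (mink_ext h0 h1 h2 h3) h')

theorem vb_nondeg {v : Vec} (h : ∀ w, vb v w = 0) : v = 0 := by
  have h1 := h (1, 0, 0)
  have h2 := h (0, 0, 1)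
  have h3 := h (0, ![1, 0, 0, 0], 0)
  have h4 := h (0, ![0, 1, 0, 0], 0)
  have h5 := h (0, ![0, 0, 1, 0], 0)
  have h6 := h (0, ![0, 0, 0, 1], 0)
  simp [vb, mb] at h1 h2 h3 h4 h5 h6
  exact vec_ext h2 h6 h4 h5 h3 h1

/-- An isotropic vector whose positive part vanishes is zero. -/
theorem eq_zero_of_isotropic {v : Vec} (h : vq v = 0) (h1 : v.1 = v.2.2)
    (h2 : v.2.1 0 = -v.2.1 3) : v = 0 := by
  simp only [vq, mq, h1, h2] at h
  have a : v.2.2 = 0 := by nlinarith [sq_nonneg v.2.2, sq_nonneg (v.2.1 3), sq_nonneg (v.2.1 1), sq_nonneg (v.2.1 2)]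
  have b : v.2.1 3 = 0 := by nlinarith [sq_nonneg v.2.2, sq_nonneg (v.2.1 3), sq_nonneg (v.2.1 1), sq_nonneg (v.2.1 2)]
  have c : v.2.1 1 = 0 := by nlinarith [sq_nonneg v.2.2, sq_nonneg (v.2.1 3), sq_nonneg (v.2.1 1), sq_nonneg (v.2.1 2)]
  have d : v.2.1 2 = 0 := by nlinarith [sq_nonneg v.2.2, sq_nonneg (v.2.1 3), sq_nonneg (v.2.1 1), sq_nonneg (v.2.1 2)]
  exact vec_ext (h1.trans a) (by rw [h2, b]; simp) c d b a

/-- Totally isotropic subspaces have dimension at most two. -/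
theorem mem_span_of_isotropic {p q u : Vec} (hp : vq p = 0) (hq : vq q = 0) (hu : vq u = 0)
    (hpq : vb p q = 0) (hup : vb u p = 0) (huq : vb u q = 0) (hp0 : p ≠ 0)
    (hne : ∀ c : ℝ, q ≠ c • p) : ∃ α β : ℝ, u = α • p + β • q := by
  have iso : ∀ a b c : ℝ, vq (a • p + b • q + c • u) = 0 := fun a b c => by
    simp only [vq_add, vq_smul, vb_add_left, vb_smul_left, vb_smul_right, hp, hq, hu, hpq,
      vb_comm p u, vb_comm q u, hup, huq]
    ring
  set f : Vec → ℝ := fun v => v.1 - v.2.2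
  set g : Vec → ℝ := fun v => v.2.1 0 + v.2.1 3
  have hf : ∀ a b c : ℝ, f (a • p + b • q + c • u) = a * f p + b * f q + c * f u := fun a b c => by
    simp [f]; ring
  have hg : ∀ a b c : ℝ, g (a • p + b • q + c • u) = a * g p + b * g q + c * g u := fun a b c => by
    simp [g]; ring
  have zero : ∀ a b c : ℝ, a * f p + b * f q + c * f u = 0 → a * g p + b * g q + c * g u = 0 →
      a • p + b • q + c • u = 0 := by
    intro a b c h1 h2
    rw [← hf] at h1
    rw [← hg] at h2
    exact eq_zero_of_isotropic (iso a b c) (sub_eq_zero.1 h1) (eq_neg_of_add_eq_zero_left h2)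
  have hdet : f p * g q - f q * g p ≠ 0 := by
    intro hd
    by_cases hfp : f p = 0
    · by_cases hgp : g p = 0
      · exact hp0 (by simpa using zero 1 0 0 (by simp [hfp]) (by simp [hgp]))
      · have hfq : f q = 0 := by
          have : f q * g p = 0 := by rw [hfp] at hd; linarith
          exact (mul_eq_zero.1 this).resolve_right hgp
        have := zero (g q) (-g p) 0 (by simp [hfp, hfq]) (by ring)
        refine hne (g q / g p) ?_
        have h2 : g p • q = g q • p := by
          have h3 : g q • p - g p • q = 0 := by rw [← this]; module
          exact (sub_eq_zero.1 h3).symm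
        rw [div_eq_inv_mul, mul_smul, ← h2, smul_smul, inv_mul_cancel₀ hgp, one_smul]
    · have := zero (f q) (-f p) 0 (by ring) (by linarith)
      refine hne (f q / f p) ?_
      have h2 : f p • q = f q • p := by
        have h3 : f q • p - f p • q = 0 := by rw [← this]; module
        exact (sub_eq_zero.1 h3).symm
      rw [div_eq_inv_mul, mul_smul, ← h2, smul_smul, inv_mul_cancel₀ hfp, one_smul]
  set D := f p * g q - f q * g p
  have := zero ((f u * g q - f q * g u) / D) ((f p * g u - f u * g p) / D) (-1)
    (by field_simp; simp only [D]; ring) (by field_simp; simp only [D]; ring)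
  rw [neg_one_smul] at this
  exact ⟨_, _, (add_neg_eq_zero.1 this).symm⟩

/-- `ν` identifies `T` with the set of isotropic lines, in such a way that `r` is orthogonality. -/
structure Model {T : Type*} (r : T → T → Prop) (ν : T → Vec) : Prop where
  ne_zero : ∀ t, ν t ≠ 0
  null : ∀ t, vq (ν t) = 0
  coh : ∀ s t, r s t ↔ vb (ν s) (ν t) = 0
  inj : ∀ s t, ∀ c : ℝ, ν s = c • ν t → s = t
  surj : ∀ v, v ≠ 0 → vq v = 0 → ∃ t, ∃ c : ℝ, c ≠ 0 ∧ ν t = c • v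

namespace Model
variable {T : Type*} {r : T → T → Prop} {ν : T → Vec}

theorem mem_span (N : Model r ν) {a b c : T} (hne : a ≠ b) (hab : r a b) (hca : r c a) (hcb : r c b) :
    ∃ α β : ℝ, ν c = α • ν a + β • ν b :=
  mem_span_of_isotropic (N.null a) (N.null b) (N.null c) ((N.coh _ _).1 hab) ((N.coh _ _).1 hca)
    ((N.coh _ _).1 hcb) (N.ne_zero a) fun t h => hne (N.inj b a t h).symm

theorem isGQ (N : Model r ν) : IsGQ r where
  refl a := by rw [N.coh, vb_self, N.null, mul_zero]
  symm := by intro a b h; rw [N.coh] at h ⊢; rwa [vb_comm]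
  tri := by
    intro a b c d hne hab hca hcb hda hdb
    obtain ⟨α, β, h⟩ := N.mem_span hne hab hca hcb
    rw [N.coh] at hda hdb ⊢
    rw [h, vb_add_left, vb_smul_left, vb_smul_left, vb_comm (ν a), vb_comm (ν b), hda, hdb]
    ring
  proj := by
    intro a b hne hab w
    have hab' := (N.coh _ _).1 hab
    by_cases h0 : vb (ν b) (ν w) • ν a - vb (ν a) (ν w) • ν b = 0
    · refine ⟨a, by rw [N.coh, vb_self, N.null, mul_zero], hab, (N.coh _ _).2 ?_⟩
      by_contra h
      refine hne (N.inj b a (vb (ν b) (ν w) / vb (ν a) (ν w)) ?_).symm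
      rw [div_eq_inv_mul, mul_smul, sub_eq_zero.1 h0, smul_smul, inv_mul_cancel₀ h, one_smul]
    · obtain ⟨t, c, -, ht⟩ := N.surj _ h0 (by
        have h1 := N.null a
        have h2 := N.null b
        rw [sub_eq_add_neg, ← neg_smul, vq_add, vq_smul, vq_smul, vb_smul_left, vb_smul_right, h1, h2,
          hab']
        ring)
      refine ⟨t, ?_, ?_, ?_⟩ <;> rw [N.coh, ht, vb_smul_left, vb_sub_left, vb_smul_left, vb_smul_left]
      · rw [vb_self, N.null, vb_comm (ν b) (ν a), hab']; ring
      · rw [vb_self, N.null, hab']; ring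
      · ring

end Model
end Coherency

namespace Coherency

/-! ### Parametrized lines are mapped projectively -/

theorem eq_self_of_mul_add {f : ℝ → ℝ} (hpos : ∀ a, 0 < a → 0 < f a) (h1 : f 1 = 1)
    (hmul : ∀ a b, 0 < a → 0 < b → f (a * b) = f a * f b)
    (hadd : ∀ a b, 0 < a → 0 < b → f (a + b) = f a + f b) : ∀ a, 0 < a → f a = a := by
  have hnat : ∀ n : ℕ, f (n + 1) = n + 1 := by
    intro n
    induction n with
    | zero => simpa using h1
    | succ k ih => push_cast; rw [hadd _ _ (by positivity) one_pos, ih, h1]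
  have hrat : ∀ q : ℚ, 0 < q → f q = q := by
    intro q hq
    have hn : 0 < q.num := Rat.num_pos.2 hq
    obtain ⟨m, hm⟩ : ∃ m : ℕ, q.num = m + 1 := ⟨q.num.toNat - 1, by omega⟩
    obtain ⟨k, hk⟩ : ∃ k : ℕ, q.den = k + 1 := ⟨q.den - 1, by have := q.pos; omega⟩
    have e : (q : ℝ) * (k + 1) = m + 1 := by
      have := Rat.mul_den_eq_num q
      rw [hm, hk] at this
      exact_mod_cast this
    have := hmul q (k + 1) (by exact_mod_cast hq) (by positivity)
    rw [e, hnat, hnat, ← e] at this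
    exact (mul_right_cancel₀ (by positivity) this).symm
  have hmono : ∀ a b, 0 < a → a < b → f a < f b := by
    intro a b ha hab
    have := hadd a (b - a) ha (sub_pos.2 hab)
    rw [add_sub_cancel] at this
    linarith [hpos (b - a) (sub_pos.2 hab)]
  intro a ha
  by_contra hne
  rcases lt_or_gt_of_ne hne with h | h
  · obtain ⟨q, h1, h2⟩ := exists_rat_btwn h
    have hq : (0 : ℝ) < q := (hpos a ha).trans h1
    have := hmono q a hq h2
    rw [hrat q (by exact_mod_cast hq)] at this
    linarith
  · obtain ⟨q, h1, h2⟩ := exists_rat_btwn h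
    have hq : (0 : ℝ) < q := ha.trans h1
    have := hmono a q ha h1
    rw [hrat q (by exact_mod_cast hq)] at this
    linarith

/-- A function that is homogeneous with respect to two base points is linear. -/
theorem linear_of_homogeneous {s : ℝ → ℝ} (hne : ∀ a, 0 < a → s a ≠ 0)
    (hinj : ∀ a b, 0 < a → 0 < b → s a = s b → a = b)
    (hs : ∀ t, 0 < t → ∃ χ, ∀ a, 0 < a → s (t * a) = χ * s a)
    (hs' : ∀ t, 0 < t → ∃ χ, ∀ a, 0 < a → s (1 + t * a) - s 1 = χ * (s (1 + a) - s 1)) :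
    ∀ a, 0 < a → s a = s 1 * a := by
  have hs1 := hne 1 one_pos
  have hmul : ∀ t a, 0 < t → 0 < a → s (t * a) * s 1 = s t * s a := by
    intro t a ht ha
    obtain ⟨χ, h⟩ := hs t ht
    have h1 := h 1 one_pos
    rw [mul_one] at h1
    rw [h a ha, h1]; ring
  have hmul' : ∀ t a, 0 < t → 0 < a →
      (s (1 + t * a) - s 1) * (s 2 - s 1) = (s (1 + t) - s 1) * (s (1 + a) - s 1) := by
    intro t a ht ha
    obtain ⟨χ, h⟩ := hs' t ht
    have h1 := h 1 one_pos
    rw [mul_one] at h1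
    rw [h a ha, h1, one_add_one_eq_two]; ring
  set f : ℝ → ℝ := fun a => s a / s 1 with hf
  have fmul : ∀ a b, 0 < a → 0 < b → f (a * b) = f a * f b := by
    intro a b ha hb
    have := hmul a b ha hb
    simp only [hf]; field_simp; linarith
  have f1 : f 1 = 1 := div_self hs1
  have fpos : ∀ a, 0 < a → 0 < f a := by
    intro a ha
    have := fmul (√a) (√a) (Real.sqrt_pos.2 ha) (Real.sqrt_pos.2 ha)
    rw [Real.mul_self_sqrt ha.le] at this
    rw [this]
    exact mul_self_pos.2 (div_ne_zero (hne _ (Real.sqrt_pos.2 ha)) hs1)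
  have finj : ∀ a b, 0 < a → 0 < b → f a = f b → a = b := fun a b ha hb h =>
    hinj a b ha hb (by simp only [hf] at h; field_simp at h; exact h)
  set D := f 2 - 1 with hD
  have hD0 : D ≠ 0 := fun h0 => by
    have := finj 2 1 two_pos one_pos (by rw [f1]; linarith)
    norm_num at this
  set h : ℝ → ℝ := fun a => (f (1 + a) - 1) / D with hh
  have fh : ∀ a, f (1 + a) = 1 + D * h a := fun a => by simp only [hh]; field_simp; ring
  have h1 : h 1 = 1 := by simp only [hh, one_add_one_eq_two]; exact div_self hD0
  have hm : ∀ a b, 0 < a → 0 < b → h (a * b) = h a * h b := by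
    intro a b ha hb
    have e := hmul' a b ha hb
    have t : ∀ x, s x = s 1 * f x := fun x => by simp only [hf]; field_simp
    rw [t (1 + a * b), t (1 + a), t (1 + b), t 2, fh, fh, fh, show f 2 = 1 + D by rw [hD]; ring] at e
    have e' : s 1 ^ 2 * D ^ 2 * (h (a * b) - h a * h b) = 0 := by linear_combination e
    have : s 1 ^ 2 * D ^ 2 ≠ 0 := by positivity
    exact sub_eq_zero.1 ((mul_eq_zero.1 e').resolve_left this)
  have hinjh : ∀ a b, 0 < a → 0 < b → h a = h b → a = b := fun a b ha hb e => by
    have := finj (1 + a) (1 + b) (by linarith) (by linarith) (by rw [fh, fh, e])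
    linarith
  have hh0 : ∀ a, 0 < a → h a ≠ 0 := by
    intro a ha h0
    have := hm a a⁻¹ ha (inv_pos.2 ha)
    rw [mul_inv_cancel₀ ha.ne', h1, h0, zero_mul] at this
    exact one_ne_zero this
  have hpos : ∀ a, 0 < a → 0 < h a := by
    intro a ha
    have := hm (√a) (√a) (Real.sqrt_pos.2 ha) (Real.sqrt_pos.2 ha)
    rw [Real.mul_self_sqrt ha.le] at this
    rw [this]
    exact mul_self_pos.2 (hh0 _ (Real.sqrt_pos.2 ha))
  have key : ∀ b, 0 < b → f b * (h b + D) = h b * (1 + D * h b) := by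
    intro b hb
    have e1 := fmul (1 + b⁻¹) b (by positivity) hb
    rw [show (1 + b⁻¹) * b = 1 + b by field_simp; ring, fh, fh] at e1
    have e2 := hm b b⁻¹ hb (inv_pos.2 hb)
    rw [mul_inv_cancel₀ hb.ne', h1] at e2
    linear_combination (-h b) * e1 + D * f b * e2
  have D1 : D = 1 := by
    have k2 := key 2 two_pos
    have k4 := key (2 * 2) (by norm_num)
    rw [fmul 2 2 two_pos two_pos, hm 2 2 two_pos two_pos] at k4
    have y0 := hpos 2 two_pos
    have y1 : h 2 ≠ 1 := fun e => by
      have := hinjh 2 1 two_pos one_pos (by rw [e, h1])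
      norm_num at this
    have x0 := fpos 2 two_pos
    set x := f 2
    set y := h 2
    have e : y ^ 2 * (D * (1 - D) * (y - 1) ^ 3 * (y + 1)) = 0 := by
      linear_combination ((x * (y + D) + y * (1 + D * y)) * (y * y + D)) * k2 - (y + D) ^ 2 * k4
    have n1 : y ^ 2 ≠ 0 := by positivity
    have n2 : (y - 1) ^ 3 ≠ 0 := pow_ne_zero _ (sub_ne_zero.2 y1)
    have n3 : y + 1 ≠ 0 := by positivity
    have := (mul_eq_zero.1 ((mul_eq_zero.1 ((mul_eq_zero.1 e).resolve_left n1)).resolve_right n3)).resolve_right n2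
    have := (mul_eq_zero.1 this).resolve_left hD0
    linarith
  have fadd1 : ∀ b, 0 < b → f (1 + b) = 1 + f b := by
    intro b hb
    have := key b hb
    rw [D1] at this
    have e : f b = h b := by
      have h2 := hpos b hb
      have : (f b - h b) * (h b + 1) = 0 := by linear_combination this
      exact sub_eq_zero.1 ((mul_eq_zero.1 this).resolve_right (by positivity))
    rw [fh, D1, e]; ring
  have fadd : ∀ a b, 0 < a → 0 < b → f (a + b) = f a + f b := by
    intro a b ha hb
    rw [show a + b = a * (1 + b / a) by field_simp, fmul _ _ ha (by positivity),
      fadd1 _ (by positivity), mul_add, mul_one, ← fmul _ _ ha (by positivity), mul_div_cancel₀ _ ha.ne']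
  intro a ha
  have := eq_self_of_mul_add fpos f1 fmul fadd a ha
  simp only [hf] at this
  field_simp at this
  rw [this]

/-- `p` represents the point of the line through `z` and `x` with affine coordinate `s`. -/
def Slope (x z p : Vec) (s : ℝ) : Prop := ∃ c : ℝ, c ≠ 0 ∧ p = c • (z + s • x)

theorem Slope.unique {x z p : Vec} {s s' : ℝ} (hx : x ≠ 0) (hz : ∀ c : ℝ, z ≠ c • x)
    (h : Slope x z p s) (h' : Slope x z p s') : s = s' := by
  obtain ⟨c, hc, e⟩ := h
  obtain ⟨c', hc', e'⟩ := h'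
  rw [e] at e'
  have h1 : (c - c') • z = (c' * s' - c * s) • x := by
    have : c • (z + s • x) - c' • (z + s' • x) = 0 := sub_eq_zero.2 e'
    rw [← sub_eq_zero, ← this]; module
  have h2 : c = c' := by
    by_contra hne
    refine hz ((c - c')⁻¹ * (c' * s' - c * s)) ?_
    rw [mul_smul, ← h1, smul_smul, inv_mul_cancel₀ (sub_ne_zero.2 hne), one_smul]
  rw [h2, sub_self, zero_smul] at h1
  have h3 := (smul_eq_zero.1 h1.symm).resolve_right hx
  exact (mul_left_cancel₀ hc' (by linarith)).symm

variable {T : Type*} {r : T → T → Prop} {ν : T → Vec} {X Y : Mink} {φ : Mink → T}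

/-- The coordinates on the lines through `X`, for the image of `φ`. -/
def Slopes (ν : T → Vec) (φ : Mink → T) (X Y : Mink) (s : Mink → ℝ → ℝ) : Prop :=
  ∀ Z ∈ Sph X Y, ∀ a, 0 ≤ a → Slope (ν (φ X)) (ν (φ Z)) (ν (φ (pt Z X a))) (s Z a)

theorem ND3.exists_slopes (N : Model r ν) (h : ND3 r φ X Y) (hφ : Pres r φ (Dia X Y)) :
    ∃ s, Slopes ν φ X Y s := by
  have G := N.isGQ
  have : ∀ Z a, ∃ s, Z ∈ Sph X Y → 0 ≤ a → Slope (ν (φ X)) (ν (φ Z)) (ν (φ (Coherency.pt Z X a))) s := by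
    intro Z a
    by_cases hc : Z ∈ Sph X Y ∧ 0 ≤ a
    · obtain ⟨hZ, ha⟩ := hc
      have hne : φ Z ≠ φ X := by simpa [pt_zero] using h.neX Z hZ 0 le_rfl
      obtain ⟨α, β, e⟩ := N.mem_span hne (hφ.sph h.tl hZ).1 (hφ.pt h.tl hZ ha).2 (hφ.pt h.tl hZ ha).1
      have hα : α ≠ 0 := by
        rintro rfl
        rw [zero_smul, zero_add] at e
        exact h.neX Z hZ a ha (N.inj _ _ _ e)
      refine ⟨β / α, fun _ _ => ⟨α, hα, ?_⟩⟩
      rw [e, smul_add, smul_smul, mul_div_cancel₀ _ hα]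
    · exact ⟨0, fun h1 h2 => absurd ⟨h1, h2⟩ hc⟩
  choose s hs using this
  exact ⟨s, fun Z hZ a ha => hs Z a hZ ha⟩

section
variable {s ρ : Mink → ℝ → ℝ} {Z Z' : Mink} {a b : ℝ}

theorem ND3.not_smul (N : Model r ν) (h : ND3 r φ X Y) (hZ : Z ∈ Sph X Y) (c : ℝ) :
    ν (φ Z) ≠ c • ν (φ X) := fun e => by
  have := h.neX Z hZ 0 le_rfl
  rw [pt_zero] at this
  exact this (N.inj _ _ _ e)

theorem Slopes.mul (N : Model r ν) (h : ND3 r φ X Y) (hφ : Pres r φ (Dia X Y))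
    (hs : Slopes ν φ X Y s) (hρ : Slopes ν φ Y X ρ) (hZ : Z ∈ Sph X Y) (hZ' : Z' ∈ Sph X Y)
    (ha : 0 ≤ a) (hb : 0 ≤ b) (hab : a * b = cr X Y Z Z') :
    s Z a * ρ Z' b * vb (ν (φ X)) (ν (φ Y)) = -vb (ν (φ Z)) (ν (φ Z')) := by
  obtain ⟨c, hc, e⟩ := hs Z hZ a ha
  obtain ⟨c', hc', e'⟩ := hρ Z' (mem_Sph_comm.1 hZ') b hb
  have h1 := (N.coh _ _).1 (hφ.pt_pt h.tl hZ hZ' ha hb hab)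
  have h2 := (N.coh _ _).1 (hφ.sph h.tl hZ).2
  have h3 := (N.coh _ _).1 (hφ.sph h.tl hZ').1
  rw [e, e', vb_smul_left, vb_smul_right, vb_add_left, vb_add_right, vb_add_right, vb_smul_left,
    vb_smul_right, vb_smul_left, vb_smul_right, h2, vb_comm (ν (φ X)) (ν (φ Z')), h3] at h1
  have := (mul_eq_zero.1 ((mul_eq_zero.1 h1).resolve_left hc)).resolve_left hc'
  linarith

theorem ND3.vb_ne (N : Model r ν) (h : ND3 r φ X Y) : vb (ν (φ X)) (ν (φ Y)) ≠ 0 :=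
  fun e => h.good ((N.coh _ _).2 e)

theorem ND3.vb_sph_ne (N : Model r ν) (h : ND3 r φ X Y) (hφ : Pres r φ (Dia X Y))
    (hZ : Z ∈ Sph X Y) (hZ' : Z' ∈ Sph X Y) (hne : Z ≠ Z') : vb (ν (φ Z)) (ν (φ Z')) ≠ 0 := by
  intro e
  refine hne (h.inj N.isGQ hφ hZ hZ' (N.isGQ.eq_of h.good ?_ ?_ ?_ ?_ ((N.coh _ _).2 e)))
  exacts [(hφ.sph h.tl hZ).1, (hφ.sph h.tl hZ).2, (hφ.sph h.tl hZ').1, (hφ.sph h.tl hZ').2]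

theorem exists_mem_Sph_ne (hXY : 0 < mq (X - Y)) (Z : Mink) : ∃ Z' ∈ Sph X Y, Z ≠ Z' := by
  obtain ⟨Z', h, hn⟩ := (Sph_infinite hXY).exists_notMem_finset {Z}
  exact ⟨Z', h, fun e => hn (by simp [e])⟩

theorem Slopes.ne_zero (N : Model r ν) (h : ND3 r φ X Y) (hφ : Pres r φ (Dia X Y))
    (hs : Slopes ν φ X Y s) (hZ : Z ∈ Sph X Y) (ha : 0 < a) : s Z a ≠ 0 := by
  obtain ⟨Z', hZ', hne⟩ := exists_mem_Sph_ne h.tl Z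
  obtain ⟨ρ, hρ⟩ := (h.comm N.isGQ).exists_slopes N hφ.comm
  intro h0
  have := hs.mul N h hφ hρ hZ hZ' ha.le (div_pos (cr_pos h.tl hZ hZ' hne) ha).le
    (mul_div_cancel₀ _ ha.ne')
  rw [h0, zero_mul, zero_mul] at this
  exact h.vb_sph_ne N hφ hZ hZ' hne (by linarith)

theorem Slopes.inj (N : Model r ν) (h : ND3 r φ X Y) (hs : Slopes ν φ X Y s) (hZ : Z ∈ Sph X Y)
    (ha : 0 ≤ a) (hb : 0 ≤ b) (e : s Z a = s Z b) : a = b := by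
  obtain ⟨c, hc, e1⟩ := hs Z hZ a ha
  obtain ⟨c', hc', e2⟩ := hs Z hZ b hb
  refine h.injX Z hZ a b ha hb (N.inj _ _ (c / c') ?_)
  rw [e1, e2, smul_smul, div_mul_cancel₀ _ hc', e]

theorem Slopes.homogeneous (N : Model r ν) (h : ND3 r φ X Y) (hφ : Pres r φ (Dia X Y))
    (hs : Slopes ν φ X Y s) (hZ : Z ∈ Sph X Y) {t : ℝ} (ht : 0 < t) :
    ∃ χ, ∀ a, 0 < a → s Z (t * a) = χ * s Z a := by
  obtain ⟨e₁, he₁, hne⟩ := exists_mem_Sph_ne h.tl Z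
  obtain ⟨ρ, hρ⟩ := (h.comm N.isGQ).exists_slopes N hφ.comm
  obtain ⟨κ, τ, P, hκ, hτ, hP, hP0, hτ0, hPP, hPe, -⟩ : ∃ (κ : ℝ) (t : ℝ → ℝ → ℝ)
      (P : ℝ → ℝ → Mink), 0 < κ ∧ (∀ u v, 0 < t u v) ∧
      (∀ u v, P u v ∈ Sph X Y) ∧ P 0 0 = e₁ ∧ t 0 0 = 1 ∧
      (∀ u v u' v', mq (P u v - P u' v') =
        -(t u v * t u' v' * κ * ((u - u') ^ 2 + (v - v') ^ 2))) ∧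
      (∀ u v, mq (P u v - Z) = -(t u v * κ)) ∧ (∀ Q ∈ Sph X Y, Q ≠ Z → ∃ u v, Q = P u v) := by
    rcases fut_or_fut h.tl with hf | hf
    · exact Sph_coords hf he₁ hZ hne.symm
    · rw [Sph_comm] at he₁ hZ ⊢
      exact Sph_coords hf he₁ hZ hne.symm
  have key : ∀ q : ℝ, q ≠ 0 → ∃ K, K ≠ 0 ∧ ∀ a, 0 < a → s e₁ (q ^ 2 * a) = K * s Z a := by
    intro q hq
    have hQ := hP q 0
    have c1 : cr X Y e₁ (P q 0) = q ^ 2 * cr X Y Z (P q 0) := by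
      rw [cr_comm, cr_comm (Z := Z), cr, cr, hPe, ← hP0, hPP, hτ0]; ring
    have hZQ : Z ≠ P q 0 := fun e => by
      have := hPe q 0
      rw [← e, sub_self, mq_zero] at this
      have := mul_pos (hτ q 0) hκ
      linarith
    have hc := cr_pos h.tl hZ hQ hZQ
    refine ⟨vb (ν (φ e₁)) (ν (φ (P q 0))) / vb (ν (φ Z)) (ν (φ (P q 0))), ?_, ?_⟩
    · refine div_ne_zero (h.vb_sph_ne N hφ he₁ hQ fun e => ?_) (h.vb_sph_ne N hφ hZ hQ hZQ)
      have := cr_pos h.tl hZ hQ hZQ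
      have c2 : 0 < q ^ 2 * cr X Y Z (P q 0) := by positivity
      rw [← c1, ← e, cr, sub_self, mq_zero] at c2
      simp at c2
    · intro a ha
      have m1 := hs.mul N h hφ hρ hZ hQ ha.le (div_pos hc ha).le (mul_div_cancel₀ _ ha.ne')
      have m2 := hs.mul N h hφ hρ he₁ hQ (a := q ^ 2 * a) (by positivity) (div_pos hc ha).le
        (by rw [c1]; field_simp)
      have n1 := h.vb_sph_ne N hφ hZ hQ hZQ
      have n2 := h.vb_ne N
      have n3 : ρ (P q 0) (cr X Y Z (P q 0) / a) ≠ 0 := by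
        intro h0; rw [h0] at m1; exact n1 (by linarith)
      rw [div_mul_eq_mul_div, eq_div_iff n1]
      refine mul_right_cancel₀ (mul_ne_zero n3 n2) ?_
      linear_combination vb (ν (φ Z)) (ν (φ (P q 0))) * m2 -
        vb (ν (φ e₁)) (ν (φ (P q 0))) * m1
  obtain ⟨K, hK, h1⟩ := key 1 one_ne_zero
  obtain ⟨L, hL, h2⟩ := key (√t) (Real.sqrt_pos.2 ht).ne'
  refine ⟨L / K, fun a ha => ?_⟩
  have e1 := h1 (t * a) (mul_pos ht ha)
  have e2 := h2 a ha
  rw [Real.sq_sqrt ht.le] at e2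
  rw [one_pow, one_mul, e2] at e1
  field_simp
  linarith

theorem Slopes.linear (N : Model r ν) (h : ND3 r φ X Y) (hφ : Pres r φ (Dia X Y))
    (hs : Slopes ν φ X Y s) (hZ : Z ∈ Sph X Y) : ∀ a, 0 < a → s Z a = s Z 1 * a := by
  refine linear_of_homogeneous (fun a ha => hs.ne_zero N h hφ hZ ha)
    (fun a b ha hb => hs.inj N h hZ ha.le hb.le) (fun t ht => hs.homogeneous N h hφ hZ ht) ?_
  obtain ⟨Z₂, hZ₂, hne⟩ := exists_mem_Sph_ne h.tl Z
  have hc := cr_pos h.tl hZ hZ₂ hne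
  have h' := h.pt N.isGQ hφ hZ₂ hc
  have hV := mem_Sph_pt h.tl hZ hZ₂ zero_le_one hc.le (one_mul _)
  have hφ' : Pres r φ (Dia X (pt Z₂ Y (cr X Y Z Z₂))) :=
    hφ.mono (Dia_subset h.tl (pt_mem_Dia' h.tl hZ₂ hc.le) h'.tl)
  obtain ⟨s₁, hs₁⟩ := h'.exists_slopes N hφ'
  obtain ⟨c, hc0, e⟩ := hs Z hZ 1 zero_le_one
  have key : ∀ b, 0 < b → s Z (1 + b) = s Z 1 + c⁻¹ * s₁ (pt Z X 1) (b / 2) := by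
    intro b hb
    refine (hs Z hZ (1 + b) (by positivity)).unique (N.ne_zero _) (h.not_smul N hZ) ?_
    obtain ⟨d, hd, e'⟩ := hs₁ _ hV (b / 2) (by positivity)
    rw [pt_pt zero_le_one (by positivity), show 1 + (1 + 1) * (b / 2) = 1 + b by ring] at e'
    refine ⟨d * c, mul_ne_zero hd hc0, ?_⟩
    rw [e', e]
    match_scalars <;> field_simp
  intro t ht
  obtain ⟨χ, hχ⟩ := hs₁.homogeneous N h' hφ' hV ht
  refine ⟨χ, fun a ha => ?_⟩
  rw [key _ (mul_pos ht ha), key _ ha, mul_div_assoc, hχ _ (by positivity)]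
  ring

end
end Coherency

namespace Coherency

/-! ### Linearization near a nondegenerate pair -/

/-- The bilinear form, as a linear functional. -/
def vbLin (v : Vec) : Vec →ₗ[ℝ] ℝ where
  toFun := vb v
  map_add' := vb_add_right v
  map_smul' t w := by rw [vb_smul_right, smul_eq_mul, RingHom.id_apply]

@[simp] theorem vbLin_apply (v w : Vec) : vbLin v w = vb v w := rfl

/-- `g` multiplies the form by the factor `μ`. -/
structure Conf (g : Vec →ₗ[ℝ] Vec) (μ : ℝ) : Prop where
  ne : μ ≠ 0
  map : ∀ u v, vb (g u) (g v) = μ * vb u v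

section
variable {g : Vec →ₗ[ℝ] Vec} {μ : ℝ}

theorem Conf.injective (hg : Conf g μ) : Function.Injective g := by
  rw [injective_iff_map_eq_zero]
  intro v hv
  refine vb_nondeg fun w => ?_
  have := hg.map v w
  rw [hv, vb_zero_left] at this
  exact (mul_eq_zero.1 this.symm).resolve_left hg.ne

theorem Conf.surjective (hg : Conf g μ) : Function.Surjective g :=
  LinearMap.injective_iff_surjective.1 hg.injective

theorem Conf.vq (hg : Conf g μ) (v : Vec) : vq (g v) = μ * vq v := by
  have h1 := vb_self (g v)
  rw [hg.map, vb_self] at h1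
  linarith

end

/-- `X`, `Y` and the points of the sphere they determine. -/
def Star (X Y : Mink) : Set Mink := {P | P = X ∨ P = Y ∨ P ∈ Sph X Y}

theorem star_separates {X Y : Mink} (h : 0 < mq (X - Y)) (f : Vec →ₗ[ℝ] ℝ)
    (hf : ∀ P ∈ Star X Y, f (emb P) = 0) : f = 0 := by
  have hX := hf X (Or.inl rfl)
  have hY := hf Y (Or.inr (Or.inl rfl))
  rw [mq_sub_comm] at h
  have hn : ∀ n, NullF n → f (0, n, mb X n) = 0 := by
    intro n hn
    have hb : mb (Y - X) n ≠ 0 := fun h0 => hn.2.2.2 ((mq_orthogonal_nonpos h h0).2 hn.2.2.1)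
    have hb' : mb (Y - X) (X + n - X) ≠ 0 := by rwa [add_sub_cancel_left]
    have hP := hf _ (Or.inr (Or.inr (line_meets_Sph (V := X + n) (Y := Y)
      (by rw [add_sub_cancel_left]; exact hn.2.2.1) hb')))
    rw [add_sub_cancel_left] at hP
    have ht : mq (Y - X) / mb (Y - X) n ≠ 0 := div_ne_zero h.ne' hb
    set t := mq (Y - X) / mb (Y - X) n
    have e : emb (X + t • n) = emb X + t • ((0, n, mb X n) : Vec) := by
      simp [emb, mq_add, mq_smul, hn.2.2.1, mb_smul_right]
    rw [e, map_add, hX, zero_add, map_smul, smul_eq_mul] at hP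
    exact (mul_eq_zero.1 hP).resolve_left ht
  have hv : ∀ v, f (0, v, mb X v) = 0 := by
    intro v
    have n1 := hn _ nullF_e
    have n2 := hn _ nullF_e'
    have n3 := hn ![1, 1, 0, 1] ⟨by simp, by simp, by simp [mq], fun h => by simpa using congrFun h 0⟩
    have n4 := hn ![1, 0, 1, 1] ⟨by simp, by simp, by simp [mq], fun h => by simpa using congrFun h 0⟩
    have e : ((0, v, mb X v) : Vec) = (v 0 - v 1 - v 2) • ((0, ![1, 0, 0, 0], mb X ![1, 0, 0, 0]) : Vec)
        + (v 3 - v 1 - v 2) • ((0, ![0, 0, 0, 1], mb X ![0, 0, 0, 1]) : Vec)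
        + v 1 • ((0, ![1, 1, 0, 1], mb X ![1, 1, 0, 1]) : Vec)
        + v 2 • ((0, ![1, 0, 1, 1], mb X ![1, 0, 1, 1]) : Vec) := by
      apply vec_ext <;> simp [mb]
      all_goals ring
    rw [e, map_add, map_add, map_add, map_smul, map_smul, map_smul, map_smul, n1, n2, n3, n4]
    simp
  have h1 : f (0, 0, 1) = 0 := by
    have e : emb Y = emb X + ((0, Y - X, mb X (Y - X)) : Vec) + mq (Y - X) • ((0, 0, 1) : Vec) := by
      have : mq Y = mq X + mb X (Y - X) + mq (Y - X) := by
        rw [mq_sub, mb_sub_right, mb_self, mb_comm Y X]; ring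
      simp [emb, this]
    rw [e, map_add, map_add, hX, hv, map_smul, smul_eq_mul] at hY
    exact (mul_eq_zero.1 (by linarith : mq (Y - X) * f (0, 0, 1) = 0)).resolve_left h.ne'
  have h2 : ∀ v, f (0, v, 0) = 0 := by
    intro v
    have e : ((0, v, 0) : Vec) = (0, v, mb X v) - mb X v • ((0, 0, 1) : Vec) := by simp
    rw [e, map_sub, hv, map_smul, h1]; simp
  ext1
  · apply LinearMap.ext_ring
    have e : ((1, 0, 0) : Vec) = emb X - (0, X, 0) - mq X • ((0, 0, 1) : Vec) := by simp [emb]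
    change f (1, 0, 0) = 0
    rw [e, map_sub, map_sub, hX, h2, map_smul, h1]; simp
  · apply LinearMap.ext
    rintro ⟨v, c⟩
    change f (0, v, c) = 0
    have e : ((0, v, c) : Vec) = (0, v, 0) + c • ((0, 0, 1) : Vec) := by simp
    rw [e, map_add, h2, map_smul, h1]; simp

theorem star_span {X Y : Mink} (h : 0 < mq (X - Y)) : ⊤ ≤ Submodule.span ℝ (emb '' Star X Y) := by
  by_contra hlt
  obtain ⟨f, hf, hle⟩ := Submodule.exists_le_ker_of_lt_top _ (lt_top_iff_ne_top.2 fun h => hlt h.ge)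
  exact hf (star_separates h f fun P hP => hle (Submodule.subset_span ⟨P, hP, rfl⟩))

theorem eq_zero_of_star {X Y : Mink} (h : 0 < mq (X - Y)) {v : Vec}
    (hv : ∀ P ∈ Star X Y, vb v (emb P) = 0) : v = 0 := by
  have := star_separates h (vbLin v) hv
  exact vb_nondeg fun w => by rw [← vbLin_apply, this]; rfl

/-- A map of a spanning set which multiplies the form by a factor is linear. -/
theorem exists_conf {S : Set Mink} (hS : ⊤ ≤ Submodule.span ℝ (emb '' S)) {w : Mink → Vec} {μ : ℝ}
    (hμ : μ ≠ 0) (hw : ∀ P ∈ S, ∀ Q ∈ S, vb (w P) (w Q) = μ * vb (emb P) (emb Q)) :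
    ∃ g : Vec →ₗ[ℝ] Vec, Conf g μ ∧ ∀ P ∈ S, w P = g (emb P) := by
  set b := Module.Basis.ofSpan hS
  have hb : ∀ i, ∃ P ∈ S, emb P = b i := fun i => Module.Basis.ofSpan_subset hS ⟨i, rfl⟩
  choose p hp he using hb
  set g := b.constr ℝ fun i => w (p i)
  have hg : ∀ i, g (b i) = w (p i) := fun i => b.constr_basis ℝ _ i
  have ext : ∀ f f' : Vec →ₗ[ℝ] ℝ, (∀ i, f (b i) = f' (b i)) → f = f' := fun f f' h => b.ext h
  have h1 : ∀ i, ∀ P ∈ S, vb (w P) (g (b i)) = μ * vb (emb P) (b i) := by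
    intro i P hP
    rw [hg, hw P hP _ (hp i), he]
  have h2 : ∀ P ∈ S, ∀ v, vb (w P) (g v) = μ * vb (emb P) v := by
    intro P hP v
    have := ext (vbLin (w P) ∘ₗ g) (μ • vbLin (emb P)) fun i => h1 i P hP
    exact LinearMap.congr_fun this v
  have hc : Conf g μ := by
    refine ⟨hμ, fun u v => ?_⟩
    have := ext (vbLin (g v) ∘ₗ g) (μ • vbLin v) fun i => by
      have := h2 _ (hp i) v
      simp only [LinearMap.comp_apply, vbLin_apply, LinearMap.smul_apply, smul_eq_mul]
      rw [vb_comm, hg, this, he, vb_comm]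
    have := LinearMap.congr_fun this u
    rw [vb_comm, vb_comm u]
    exact this
  refine ⟨g, hc, fun P hP => sub_eq_zero.1 (vb_nondeg fun u => ?_)⟩
  obtain ⟨v, rfl⟩ := hc.surjective u
  rw [vb_sub_left, h2 P hP, hc.map, sub_self]

variable {T : Type*} {r : T → T → Prop} {ν : T → Vec} {X Y : Mink} {φ : Mink → T}

theorem ND3.exists_normalized (N : Model r ν) (h : ND3 r φ X Y) (hφ : Pres r φ (Dia X Y)) :
    ∃ μ : ℝ, μ ≠ 0 ∧ ∃ w : Mink → Vec,
      (∀ P ∈ Star X Y, ∀ Q ∈ Star X Y, vb (w P) (w Q) = μ * vb (emb P) (emb Q)) ∧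
      (∃ c : ℝ, c ≠ 0 ∧ ν (φ X) = c • w X) ∧
      ∀ Z ∈ Sph X Y, ∀ a, 0 ≤ a → ∃ c : ℝ, c ≠ 0 ∧ ν (φ (Coherency.pt Z X a)) = c • (w Z + a • w X) := by
  classical
  have h' := h.comm N.isGQ
  obtain ⟨s, hs⟩ := h.exists_slopes N hφ
  obtain ⟨ρ, hρ⟩ := h'.exists_slopes N hφ.comm
  have hsl := fun Z (hZ : Z ∈ Sph X Y) => hs.linear N h hφ hZ
  have hρl := fun Z (hZ : Z ∈ Sph X Y) => hρ.linear N h' hφ.comm (mem_Sph_comm.1 hZ)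
  have hs0 := fun Z (hZ : Z ∈ Sph X Y) => hs.ne_zero N h hφ hZ one_pos
  have hρ0 := fun Z (hZ : Z ∈ Sph X Y) => hρ.ne_zero N h' hφ.comm (mem_Sph_comm.1 hZ) one_pos
  have hxy := h.vb_ne N
  have hM := h.tl
  have prod : ∀ Z ∈ Sph X Y, ∀ Z' ∈ Sph X Y, Z ≠ Z' →
      s Z 1 * ρ Z' 1 * cr X Y Z Z' * vb (ν (φ X)) (ν (φ Y)) = -vb (ν (φ Z)) (ν (φ Z')) := by
    intro Z hZ Z' hZ' hne
    have hc := cr_pos h.tl hZ hZ' hne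
    have := hs.mul N h hφ hρ hZ hZ' zero_le_one hc.le (one_mul _)
    rw [hρl Z' hZ' _ hc] at this
    linarith
  obtain ⟨Z₀, hZ₀, -⟩ := exists_mem_Sph_ne h.tl X
  set k := ρ Z₀ 1 / s Z₀ 1
  have hk : k ≠ 0 := div_ne_zero (hρ0 _ hZ₀) (hs0 _ hZ₀)
  have hρk : ∀ Z ∈ Sph X Y, ρ Z 1 = k * s Z 1 := by
    intro Z hZ
    have n0 := hs0 _ hZ₀
    by_cases hne : Z = Z₀
    · rw [hne]; simp only [k]; field_simp
    · have p1 := prod Z hZ Z₀ hZ₀ hne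
      have p2 := prod Z₀ hZ₀ Z hZ (Ne.symm hne)
      rw [vb_comm (ν (φ Z₀)), cr_comm] at p2
      have hc := (cr_pos h.tl hZ hZ₀ hne).ne'
      have : (s Z 1 * ρ Z₀ 1 - s Z₀ 1 * ρ Z 1) * (cr X Y Z Z₀ * vb (ν (φ X)) (ν (φ Y))) = 0 := by
        linear_combination p1 - p2
      have := (mul_eq_zero.1 this).resolve_right (mul_ne_zero hc hxy)
      simp only [k]; field_simp; linarith
  have sx := fun Z (hZ : Z ∈ Sph X Y) => (N.coh _ _).1 (hφ.sph h.tl hZ).1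
  have sy := fun Z (hZ : Z ∈ Sph X Y) => (N.coh _ _).1 (hφ.sph h.tl hZ).2
  have hXs : X ∉ Sph X Y := fun hX => h.tl.ne' hX.2
  have hYs : Y ∉ Sph X Y := fun hY => h.tl.ne' (by rw [mq_sub_comm]; exact hY.1)
  have hYX : Y ≠ X := fun e => by rw [e, sub_self, mq_zero] at hM; exact lt_irrefl _ hM
  set w : Mink → Vec := fun P => if P = X then ν (φ X) else if P = Y then k • ν (φ Y) else
    (s P 1)⁻¹ • ν (φ P)
  have wX : w X = ν (φ X) := if_pos rfl
  have wY : w Y = k • ν (φ Y) := (if_neg hYX).trans (if_pos rfl)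
  have wZ : ∀ Z ∈ Sph X Y, w Z = (s Z 1)⁻¹ • ν (φ Z) := fun Z hZ => by
    have h1 : Z ≠ X := fun e => hXs (by rw [e] at hZ; exact hZ)
    have h2 : Z ≠ Y := fun e => hYs (by rw [e] at hZ; exact hZ)
    exact (if_neg h1).trans (if_neg h2)
  set μ := -(k * vb (ν (φ X)) (ν (φ Y)) / mq (X - Y)) with hμ
  have null : ∀ Z, vb (ν Z) (ν Z) = 0 := fun Z => by rw [vb_self, N.null, mul_zero]
  have xz : ∀ Z ∈ Sph X Y, vb (w X) (w Z) = μ * vb (emb X) (emb Z) := fun Z hZ => by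
    rw [wX, wZ Z hZ, vb_smul_right, vb_comm, sx Z hZ, vb_emb, mq_sub_comm, hZ.1]; simp
  have yz : ∀ Z ∈ Sph X Y, vb (w Y) (w Z) = μ * vb (emb Y) (emb Z) := fun Z hZ => by
    rw [wY, wZ Z hZ, vb_smul_left, vb_smul_right, vb_comm, sy Z hZ, vb_emb, mq_sub_comm, hZ.2]; simp
  have xy : vb (w X) (w Y) = μ * vb (emb X) (emb Y) := by
    rw [wX, wY, vb_smul_right, vb_emb, hμ]; field_simp
  refine ⟨μ, neg_ne_zero.2 (div_ne_zero (mul_ne_zero hk hxy) hM.ne'), w, ?_, ⟨1, one_ne_zero, by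
    rw [wX, one_smul]⟩, ?_⟩
  · rintro P (rfl | rfl | hP) Q (rfl | rfl | hQ)
    · rw [wX, null, vb_emb, sub_self, mq_zero]; simp
    · exact xy
    · exact xz Q hQ
    · rw [vb_comm, vb_comm (emb P)]; exact xy
    · rw [wY, vb_smul_left, vb_smul_right, null, vb_emb, sub_self, mq_zero]; simp
    · exact yz Q hQ
    · rw [vb_comm, vb_comm (emb P)]; exact xz P hP
    · rw [vb_comm, vb_comm (emb P)]; exact yz P hP
    · by_cases hne : P = Q
      · rw [hne, vb_emb, sub_self, mq_zero, wZ Q hQ, vb_smul_left, vb_smul_right, null]; simp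
      · have p1 := prod P hP Q hQ hne
        have n1 := hs0 P hP
        have n2 := hs0 Q hQ
        rw [hρk Q hQ, cr] at p1
        rw [wZ P hP, wZ Q hQ, vb_smul_left, vb_smul_right, vb_emb, hμ]
        field_simp at p1 ⊢
        linarith
  · intro Z hZ a ha
    have n1 := hs0 Z hZ
    rw [wX, wZ Z hZ]
    rcases ha.lt_or_eq with ha | rfl
    · obtain ⟨c, hc, e⟩ := hs Z hZ a ha.le
      refine ⟨c * s Z 1, mul_ne_zero hc n1, ?_⟩
      rw [e, hsl Z hZ a ha]
      match_scalars <;> field_simp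
    · refine ⟨s Z 1, n1, ?_⟩
      rw [pt_zero, zero_smul, add_zero, smul_smul, mul_inv_cancel₀ n1, one_smul]

/-- The value of `φ` at `W` is the one given by `g`. -/
def Known (ν : T → Vec) (φ : Mink → T) (g : Vec →ₗ[ℝ] Vec) (W : Mink) : Prop :=
  ∃ c : ℝ, c ≠ 0 ∧ ν (φ W) = c • g (emb W)

theorem emb_pt {Z X : Mink} (h : mq (Z - X) = 0) {a : ℝ} (ha : 0 ≤ a) :
    emb Z + a • emb X = (1 + a) • emb (pt Z X a) := by
  have h1 : 1 + a ≠ 0 := by positivity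
  have : mq (pt Z X a) = (1 + a)⁻¹ * (mq Z + a * mq X) := by
    rw [mq_sub] at h
    rw [pt, mq_smul, mq_add, mq_smul, mb_smul_right]
    field_simp
    linear_combination (-a) * h
  refine Prod.ext (by simp [emb]) (Prod.ext ?_ ?_)
  · simp only [emb, pt, Prod.snd_add, Prod.fst_add, Prod.smul_snd, Prod.smul_fst, smul_smul]
    rw [mul_inv_cancel₀ h1, one_smul]
  · simp only [emb, Prod.snd_add, Prod.smul_snd, smul_eq_mul, this]
    field_simp

theorem ND3.exists_known (N : Model r ν) (h : ND3 r φ X Y) (hφ : Pres r φ (Dia X Y)) :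
    ∃ g μ, Conf g μ ∧ ∀ W ∈ Mid X Y, Known ν φ g W := by
  obtain ⟨μ, hμ, w, hw, ⟨c₀, hc₀, hX⟩, hZ⟩ := h.exists_normalized N hφ
  obtain ⟨g, hg, hgw⟩ := exists_conf (star_span h.tl) hμ hw
  refine ⟨g, μ, hg, fun W hW => ?_⟩
  have hND := h.mid N.isGQ hφ hW
  have hsub := Dia_subset h.tl (Mid_subset_Dia hW) hND.tl
  obtain ⟨u, hu⟩ := hg.surjective (ν (φ W))
  have hwX := hgw X (Or.inl rfl)
  have hu0 : u ≠ 0 := fun e => N.ne_zero (φ W) (by rw [← hu, e, map_zero])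
  have hort : ∀ V ∈ Sph X W, vb u (emb V) = 0 := by
    intro V hV
    have hVD := mem_Dia_of_Sph hND.tl hV
    have hVX : V ≠ X := fun e => hND.tl.ne' (by rw [← e]; exact hV.2)
    obtain ⟨Z, hZm, a, ha, rfl⟩ := exists_pt h.tl (hsub hVD) hV.1 hVX
    obtain ⟨c, hc, e⟩ := hZ Z hZm a ha
    have h1 := (N.coh _ _).1 (hφ.mono hsub |>.sph hND.tl hV).2
    rw [hwX, hgw Z (Or.inr (Or.inr hZm)), ← map_smul, ← map_add, emb_pt hZm.1 ha] at e
    rw [e, ← hu, vb_smul_left, map_smul, vb_smul_left, hg.map, vb_comm] at h1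
    have : 1 + a ≠ 0 := by positivity
    simpa [hc, this, hμ] using h1
  have hXW : vb (emb X) (emb W) ≠ 0 := by rw [vb_emb]; exact neg_ne_zero.2 hND.tl.ne'
  set D := vb (emb X) (emb W)
  have key : u - (vb u (emb W) / D) • emb X - (vb u (emb X) / D) • emb W = 0 := by
    refine eq_zero_of_star hND.tl ?_
    rintro P (rfl | rfl | hP) <;> rw [vb_sub_left, vb_sub_left, vb_smul_left, vb_smul_left]
    · rw [vb_self, vq_emb, vb_comm (emb W)]
      simp only [D] at hXW ⊢
      field_simp; ring
    · rw [vb_self, vq_emb]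
      simp only [D] at hXW ⊢
      field_simp; ring
    · rw [hort P hP, vb_emb, vb_emb, mq_sub_comm X, mq_sub_comm W, hP.1, hP.2]; ring
  set α := vb u (emb W) / D
  set β := vb u (emb X) / D
  have hβ : β ≠ 0 := by
    have := hND.good
    rw [N.coh, hX, ← hu, hwX, vb_smul_left, hg.map, vb_comm] at this
    refine div_ne_zero (fun e => this ?_) hXW
    rw [e]; ring
  have hu' : u = α • emb X + β • emb W := by
    rw [sub_sub] at key; exact sub_eq_zero.1 key
  have hnull : α * β * D = 0 := by
    have h1 := hg.vq u
    rw [hu, N.null] at h1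
    have h2 := (mul_eq_zero.1 h1.symm).resolve_left hμ
    rw [hu', vq_add, vq_smul, vq_smul, vq_emb, vq_emb, vb_smul_left, vb_smul_right] at h2
    linarith
  have hα : α = 0 := by simpa [hβ, hXW] using hnull
  exact ⟨β, hβ, by rw [← hu, hu', hα, zero_smul, zero_add, map_smul]⟩

end Coherency

namespace Coherency

/-! ### Extension to the whole domain -/

variable {T : Type*} {r : T → T → Prop} {ν : T → Vec} {φ : Mink → T} {𝒰 : Set Mink}
  {g : Vec →ₗ[ℝ] Vec} {μ : ℝ}

theorem Known.extend (N : Model r ν) (hg : Conf g μ) (hφ : Pres r φ 𝒰) {A B C W : Mink}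
    (hA : A ∈ 𝒰) (hB : B ∈ 𝒰) (hC : C ∈ 𝒰) (hW : W ∈ 𝒰) (kA : Known ν φ g A) (kB : Known ν φ g B)
    (kC : Known ν φ g C) (hne : A ≠ B) (hAB : mq (A - B) = 0) (hAC : mq (A - C) ≠ 0)
    (hWA : mq (W - A) = 0) (hWB : mq (W - B) = 0) (hWC : mq (W - C) = 0) : Known ν φ g W := by
  obtain ⟨u, hu⟩ := hg.surjective (ν (φ W))
  have orth : ∀ P ∈ 𝒰, Known ν φ g P → mq (W - P) = 0 → vb u (emb P) = 0 := by
    rintro P hP ⟨c, hc, e⟩ h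
    have := (N.coh _ _).1 (hφ W hW P hP h)
    rw [e, ← hu, vb_smul_right, hg.map] at this
    simpa [hc, hg.ne] using this
  have hu0 : u ≠ 0 := fun e => N.ne_zero (φ W) (by rw [← hu, e, map_zero])
  have hu' : vq u = 0 := by
    have := hg.vq u
    rw [hu, N.null] at this
    exact (mul_eq_zero.1 this.symm).resolve_left hg.ne
  have hpar : ∀ c : ℝ, emb B ≠ c • emb A := by
    intro c hc
    have h1 : (1 : ℝ) = c := by simpa [emb] using congrArg Prod.fst hc
    have h2 : B = c • A := congrArg (fun v : Vec => v.2.1) hc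
    rw [← h1, one_smul] at h2
    exact hne h2.symm
  have hAB' : vb (emb A) (emb B) = 0 := by rw [vb_emb, hAB, neg_zero]
  have span : ∀ v, vq v = 0 → v ≠ 0 → vb v (emb A) = 0 → vb v (emb B) = 0 → vb v (emb C) = 0 →
      ∃ β : ℝ, β ≠ 0 ∧ v = β • (emb B - (vb (emb B) (emb C) / vb (emb A) (emb C)) • emb A) := by
    intro v h0 hv hvA hvB hvC
    obtain ⟨α, β, rfl⟩ := mem_span_of_isotropic (vq_emb A) (vq_emb B) h0 hAB' hvA hvB (emb_ne_zero A)
      hpar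
    have ha : vb (emb A) (emb C) ≠ 0 := by rw [vb_emb]; exact neg_ne_zero.2 hAC
    rw [vb_add_left, vb_smul_left, vb_smul_left] at hvC
    have hα : α = -(β * (vb (emb B) (emb C) / vb (emb A) (emb C))) := by
      field_simp; linarith
    have e : α • emb A + β • emb B =
        β • (emb B - (vb (emb B) (emb C) / vb (emb A) (emb C)) • emb A) := by
      rw [hα]; module
    exact ⟨β, fun hβ => hv (by rw [e, hβ, zero_smul]), e⟩
  obtain ⟨β, hβ, e⟩ := span u hu' hu0 (orth A hA kA hWA) (orth B hB kB hWB) (orth C hC kC hWC)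
  obtain ⟨γ, hγ, e'⟩ := span (emb W) (vq_emb W) (emb_ne_zero W) (by rw [vb_emb, hWA, neg_zero])
    (by rw [vb_emb, hWB, neg_zero]) (by rw [vb_emb, hWC, neg_zero])
  refine ⟨β / γ, div_ne_zero hβ hγ, ?_⟩
  rw [← hu, ← map_smul]
  congr 1
  rw [e, e', smul_smul, div_mul_cancel₀ _ hγ]

open Topology Filter

theorem Known.step (N : Model r ν) (hg : Conf g μ) (hφ : Pres r φ 𝒰) {V n : Mink} (hn : NullF n)
    {t : ℝ} (hV : ∀ᶠ W in 𝓝 V, W ∈ 𝒰 ∧ Known ν φ g W) (hW : V + t • n ∈ 𝒰) :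
    Known ν φ g (V + t • n) := by
  obtain ⟨hV0, kV⟩ := hV.self_of_nhds
  by_cases ht : t = 0
  · rwa [ht, zero_smul, add_zero]
  obtain ⟨m, hm, hnm⟩ := hn.exists_transverse
  obtain ⟨m₁, m₂, F⟩ := exists_frame hn hm hnm
  have near : ∀ f : ℝ → Mink, Continuous f → f 0 = V →
      ∃ ε : ℝ, ε ≠ 0 ∧ f ε ∈ 𝒰 ∧ Known ν φ g (f ε) := by
    intro f hf h0
    have h1 := hf.tendsto 0
    rw [h0] at h1
    have h2 := ((h1.eventually hV).filter_mono nhdsWithin_le_nhds).and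
      (self_mem_nhdsWithin : {0}ᶜ ∈ 𝓝[≠] (0 : ℝ))
    obtain ⟨ε, h3, h4⟩ := h2.exists
    exact ⟨ε, h4, h3⟩
  obtain ⟨ε, hε, hB, kB⟩ := near (fun ε => V + ε • n) (by fun_prop) (by simp)
  obtain ⟨u, hu, hC, kC⟩ := near (fun u => V + t • (n - nd n m m₁ m₂ u 0))
    (by unfold nd; fun_prop) (by simp [nd_zero])
  refine Known.extend N hg hφ hV0 hB hC hW kV kB kC ?_ ?_ ?_ ?_ ?_ ?_
  · intro e
    exact smul_ne_zero hε hn.2.2.2 (by simpa using e)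
  · rw [show V - (V + ε • n) = (-ε) • n by module, mq_smul, hn.2.2.1, mul_zero]
  · rw [show V - (V + t • (n - nd n m m₁ m₂ u 0)) = t • (nd n m m₁ m₂ u 0 - n) by module, mq_smul,
      mq_sub, F.mq_nd, F.n1, F.mb_nd_n1]
    have := F.pos
    have : mb n m * (u ^ 2 + 0 ^ 2) ≠ 0 := by positivity
    have ht2 : t ^ 2 ≠ 0 := pow_ne_zero 2 ht
    refine mul_ne_zero ht2 ?_
    rw [zero_add, zero_sub]
    exact neg_ne_zero.2 this
  · rw [add_sub_cancel_left, mq_smul, hn.2.2.1, mul_zero]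
  · rw [show V + t • n - (V + ε • n) = (t - ε) • n by module, mq_smul, hn.2.2.1, mul_zero]
  · rw [show V + t • n - (V + t • (n - nd n m m₁ m₂ u 0)) = t • nd n m m₁ m₂ u 0 by module, mq_smul,
      F.mq_nd, mul_zero]

theorem Known.step_nhds (N : Model r ν) (hg : Conf g μ) (hφ : Pres r φ 𝒰) (hO : IsOpen 𝒰)
    {V n : Mink} (hn : NullF n) {t : ℝ} (hV : ∀ᶠ W in 𝓝 V, W ∈ 𝒰 ∧ Known ν φ g W)
    (hW : V + t • n ∈ 𝒰) : ∀ᶠ W in 𝓝 (V + t • n), W ∈ 𝒰 ∧ Known ν φ g W := by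
  have hc : Tendsto (fun W : Mink => W - t • n) (𝓝 (V + t • n)) (𝓝 V) := by
    have : Continuous fun W : Mink => W - t • n := by fun_prop
    simpa using this.tendsto (V + t • n)
  filter_upwards [hc.eventually (eventually_eventually_nhds.2 hV), hO.mem_nhds hW] with W h1 h2
  have := Known.step N hg hφ hn (t := t) h1 (by rwa [sub_add_cancel])
  rw [sub_add_cancel] at this
  exact ⟨h2, this⟩

theorem Known.step_null (N : Model r ν) (hg : Conf g μ) (hφ : Pres r φ 𝒰) {V W : Mink}
    (hV : ∀ᶠ W in 𝓝 V, W ∈ 𝒰 ∧ Known ν φ g W) (hW : W ∈ 𝒰) (h : mq (W - V) = 0) :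
    Known ν φ g W := by
  by_cases h0 : W - V = 0
  · rw [sub_eq_zero.1 h0]; exact hV.self_of_nhds.2
  rcases caus_or_neg h.ge with hc | hc
  · have := Known.step N hg hφ (NullF.of_caus hc h h0) (t := 1) hV (by simpa using hW)
    simpa using this
  · have := Known.step N hg hφ (NullF.of_caus hc (by rwa [mq_neg]) (neg_ne_zero.2 h0)) (t := -1) hV
      (by simpa using hW)
    simpa using this

/-- From a neighbourhood on which `φ` is given by `g` one reaches every point in two null steps. -/
theorem known_of_nhds (N : Model r ν) (hg : Conf g μ) (hU : IsUpperM 𝒰) (hO : IsOpen 𝒰)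
    (hφ : Pres r φ 𝒰) {V : Mink} (hV : ∀ᶠ W in 𝓝 V, W ∈ 𝒰 ∧ Known ν φ g W) :
    ∀ W ∈ 𝒰, Known ν φ g W := by
  intro W hW
  have hV0 := hV.self_of_nhds.1
  have via : ∀ n, NullF n → mb (W - V) n ≠ 0 →
      V + (mq (W - V) / mb (W - V) n) • n ∈ 𝒰 → Known ν φ g W := by
    intro n hn hb h1
    refine Known.step_null N hg hφ (Known.step_nhds N hg hφ hO hn hV h1) hW ?_
    rw [← sub_sub, mq_sub, mq_smul, hn.2.2.1, mb_smul_right]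
    field_simp; ring
  rcases lt_trichotomy (mq (W - V)) 0 with h | h | h
  · obtain ⟨n, hn, hb⟩ := exists_null_mb_pos (D := -(W - V)) (by rwa [mq_neg])
    rw [mb_neg_left] at hb
    refine via n hn (by linarith) (hU V hV0 _ ?_)
    rw [add_sub_cancel_left]
    exact hn.caus.smul (div_nonneg_of_nonpos h.le (by linarith))
  · exact Known.step_null N hg hφ hV hW h
  · have hb : mb (W - V) ![1, 0, 0, 0] ≠ 0 := fun h0 =>
      nullF_e.2.2.2 ((mq_orthogonal_nonpos h h0).2 nullF_e.2.2.1)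
    refine via _ nullF_e hb ?_
    rcases caus_or_neg h.le with hc | hc
    · refine hU V hV0 _ ?_
      rw [add_sub_cancel_left]
      exact nullF_e.caus.smul (div_nonneg h.le (hc.mb_nonneg nullF_e.caus))
    · refine hU W hW _ ?_
      have hf : Fut (-(W - V)) := hc.fut (by rwa [mq_neg])
      refine Caus.of_mb_pos hf ?_ ?_
      all_goals rw [show V + (mq (W - V) / mb (W - V) ![1, 0, 0, 0]) • ![1, 0, 0, 0] - W =
        (mq (W - V) / mb (W - V) ![1, 0, 0, 0]) • ![1, 0, 0, 0] - (W - V) by module]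
      · rw [mq_sub, mq_smul, nullF_e.2.2.1, mb_smul_left, mb_comm ![1, 0, 0, 0]]
        field_simp; simp
      · rw [mb_neg_left, mb_sub_right, mb_smul_right, mb_self]
        field_simp; linarith

theorem isOpen_fut : IsOpen {X : Mink | Fut X} := by
  have h1 : Continuous fun X : Mink => mq X := by unfold mq; fun_prop
  exact (isOpen_lt continuous_const (continuous_apply 0)).inter (isOpen_lt continuous_const h1)

/-- A coherency preserver on an open upper set is degenerate or the restriction of a linear map. -/
theorem standard_or_degenerate (N : Model r ν) (hU : IsUpperM 𝒰) (hO : IsOpen 𝒰) (hne : 𝒰.Nonempty)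
    (hφ : Pres r φ 𝒰) :
    LineDeg r φ 𝒰 ∨ PointDeg r φ 𝒰 ∨ ∃ g μ, Conf g μ ∧ ∀ W ∈ 𝒰, Known ν φ g W := by
  rcases trichotomy N.isGQ hU hφ hne with h | h | ⟨A, hA, B, hAB, h⟩
  · exact Or.inl h
  · exact Or.inr (Or.inl h)
  have hsub := Dia_subset_upper hU hA hAB
  obtain ⟨g, μ, hg, hk⟩ := h.exists_known N (hφ.mono hsub)
  refine Or.inr (Or.inr ⟨g, μ, hg, known_of_nhds N hg hU hO hφ
    (V := A + (2⁻¹ : ℝ) • (B - A)) ?_⟩)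
  have hMid : IsOpen (Mid A B) := by
    have : Mid A B = (fun W => W - A) ⁻¹' {X | Fut X} ∩ (fun W => B - W) ⁻¹' {X | Fut X} := by
      ext W; exact Mid_iff hAB
    rw [this]
    exact (isOpen_fut.preimage (by fun_prop)).inter (isOpen_fut.preimage (by fun_prop))
  filter_upwards [hMid.mem_nhds (midpoint_mem_Mid hAB)] with W hW
  exact ⟨hsub (Mid_subset_Dia hW), hk W hW⟩

end Coherency

namespace Coherency

/-! ### Automorphisms and charts -/

variable {T : Type*} {r : T → T → Prop} {ν : T → Vec} {φ κ : Mink → T} {𝒰 𝒱 : Set Mink}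
  {g h : Vec →ₗ[ℝ] Vec} {μ μ' : ℝ}

theorem Conf.comp (hg : Conf g μ) (hh : Conf h μ') : Conf (g ∘ₗ h) (μ * μ') :=
  ⟨mul_ne_zero hg.ne hh.ne, fun u v => by
    rw [LinearMap.comp_apply, LinearMap.comp_apply, hg.map, hh.map, mul_assoc]⟩

/-- A conformal linear map acts on the isotropic lines. -/
theorem Model.exists_aut (N : Model r ν) (hg : Conf g μ) :
    ∃ Φ : T → T, Function.Bijective Φ ∧ (∀ a b, r a b ↔ r (Φ a) (Φ b)) ∧
      ∀ a, ∃ c : ℝ, c ≠ 0 ∧ ν (Φ a) = c • g (ν a) := by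
  have key : ∀ a, ∃ b, ∃ c : ℝ, c ≠ 0 ∧ ν b = c • g (ν a) := fun a =>
    N.surj _ (fun h => N.ne_zero a (hg.injective (h.trans (map_zero g).symm)))
      (by rw [hg.vq, N.null, mul_zero])
  choose Φ k hk hΦ using key
  refine ⟨Φ, ⟨?_, ?_⟩, ?_, fun a => ⟨k a, hk a, hΦ a⟩⟩
  · intro a b hab
    have h1 := hΦ a
    rw [hab, hΦ b, ← map_smul, ← map_smul] at h1
    refine N.inj a b ((k a)⁻¹ * k b) ?_
    rw [mul_smul, hg.injective h1, smul_smul, inv_mul_cancel₀ (hk a), one_smul]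
  · intro b
    obtain ⟨v, hv⟩ := hg.surjective (ν b)
    have hv0 : v ≠ 0 := fun e => N.ne_zero b (by rw [← hv, e, map_zero])
    have hvq : vq v = 0 := by
      have := hg.vq v
      rw [hv, N.null] at this
      exact (mul_eq_zero.1 this.symm).resolve_left hg.ne
    obtain ⟨a, c, -, ha⟩ := N.surj v hv0 hvq
    refine ⟨a, N.inj _ _ (k a * c) ?_⟩
    rw [hΦ, ha, map_smul, hv, smul_smul]
  · intro a b
    rw [N.coh, N.coh, hΦ, hΦ, vb_smul_left, vb_smul_right, hg.map]
    simp [hk, hg.ne]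

/-- The sets `𝒰` and `𝒱` correspond to each other under a conformal linear map. -/
structure Chart (𝒰 𝒱 : Set Mink) (θ ψ : Mink → Mink) (h : Vec →ₗ[ℝ] Vec) : Prop where
  maps : ∀ X ∈ 𝒰, θ X ∈ 𝒱
  maps' : ∀ W ∈ 𝒱, ψ W ∈ 𝒰
  left : ∀ X ∈ 𝒰, ψ (θ X) = X
  right : ∀ W ∈ 𝒱, θ (ψ W) = W
  conf : ∃ μ, Conf h μ
  lin : ∀ X ∈ 𝒰, ∃ c : ℝ, c ≠ 0 ∧ emb (θ X) = c • h (emb X)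

section
variable {θ ψ : Mink → Mink}

theorem Chart.coh (C : Chart 𝒰 𝒱 θ ψ h) {X Y : Mink} (hX : X ∈ 𝒰) (hY : Y ∈ 𝒰) :
    mq (θ X - θ Y) = 0 ↔ mq (X - Y) = 0 := by
  obtain ⟨c, hc, e⟩ := C.lin X hX
  obtain ⟨d, hd, e'⟩ := C.lin Y hY
  obtain ⟨μ, hμ⟩ := C.conf
  have h1 := vb_emb (θ X) (θ Y)
  rw [e, e', vb_smul_left, vb_smul_right, hμ.map, vb_emb] at h1
  rw [← neg_eq_zero, ← h1]
  simp [hc, hd, hμ.ne]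

theorem Chart.coh' (C : Chart 𝒰 𝒱 θ ψ h) {V W : Mink} (hV : V ∈ 𝒱) (hW : W ∈ 𝒱) :
    mq (ψ V - ψ W) = 0 ↔ mq (V - W) = 0 := by
  rw [← C.coh (C.maps' V hV) (C.maps' W hW), C.right V hV, C.right W hW]

theorem Chart.standard_or_degenerate (C : Chart 𝒰 𝒱 θ ψ h) (N : Model r ν) (hU : IsUpperM 𝒱)
    (hO : IsOpen 𝒱) (hne : 𝒱.Nonempty) (hφ : Pres r φ 𝒰)
    (hκ : ∀ X, ∃ c : ℝ, c ≠ 0 ∧ ν (κ X) = c • emb X) :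
    (∃ Φ : T → T, (Function.Bijective Φ ∧ ∀ a b, r a b ↔ r (Φ a) (Φ b)) ∧ ∀ X ∈ 𝒰, φ X = Φ (κ X)) ∨
      PointDeg r φ 𝒰 ∨ LineDeg r φ 𝒰 := by
  have hφ' : Pres r (φ ∘ ψ) 𝒱 := fun V hV W hW hVW =>
    hφ _ (C.maps' V hV) _ (C.maps' W hW) ((C.coh' hV hW).2 hVW)
  rcases Coherency.standard_or_degenerate N hU hO hne hφ' with hd | hd | ⟨g, μ, hg, hk⟩
  · obtain ⟨P, hP, Q, hQ, hPQ, hc, a, b, hab, hr, hd⟩ := hd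
    refine Or.inr (Or.inr ⟨ψ P, C.maps' P hP, ψ Q, C.maps' Q hQ, fun e => hPQ ?_, (C.coh' hP hQ).2 hc,
      a, b, hab, hr, fun X hX hXP => ?_⟩)
    · rw [← C.right P hP, e, C.right Q hQ]
    · have := hd (θ X) (C.maps X hX)
      rw [← C.coh' (C.maps X hX) hP, ← C.coh' (C.maps X hX) hQ, Function.comp, C.left X hX] at this
      exact this hXP
  · obtain ⟨A, hA, B, hB, hd⟩ := hd
    refine Or.inr (Or.inl ⟨ψ A, C.maps' A hA, ψ B, C.maps' B hB, fun X hX hXA => ?_⟩)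
    have := hd (θ X) (C.maps X hX) fun e => hXA (by rw [← e, C.left X hX])
    rwa [Function.comp, C.left X hX] at this
  · obtain ⟨μ', hh⟩ := C.conf
    obtain ⟨Φ, hb, hr, hΦ⟩ := N.exists_aut (hg.comp hh)
    refine Or.inl ⟨Φ, ⟨hb, hr⟩, fun X hX => ?_⟩
    obtain ⟨a, ha, ea⟩ := hk (θ X) (C.maps X hX)
    obtain ⟨b, hb, eb⟩ := C.lin X hX
    obtain ⟨c, hc, ec⟩ := hκ X
    obtain ⟨d, hd, ed⟩ := hΦ (κ X)
    rw [Function.comp, C.left X hX, eb] at ea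
    rw [ec, map_smul, LinearMap.comp_apply, smul_smul] at ed
    refine N.inj _ _ (a * b * (d * c)⁻¹) ?_
    rw [ea, ed, map_smul, smul_smul, smul_smul, inv_mul_cancel_right₀ (mul_ne_zero hd hc)]

end

/-- The reflection `X ↦ B - X`, linearized. -/
def reflLin (B : Mink) : Vec →ₗ[ℝ] Vec where
  toFun v := (v.1, v.1 • B - v.2.1, v.1 * mq B - mb B v.2.1 + v.2.2)
  map_add' u v := by
    refine Prod.ext rfl (Prod.ext ?_ ?_)
    · simp only [Prod.fst_add, Prod.snd_add]; module
    · simp only [Prod.fst_add, Prod.snd_add, mb_add_right]; ring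
  map_smul' t v := by
    refine Prod.ext rfl (Prod.ext ?_ ?_)
    · simp only [Prod.smul_fst, Prod.smul_snd, smul_eq_mul, RingHom.id_apply]; module
    · simp only [Prod.smul_fst, Prod.smul_snd, smul_eq_mul, RingHom.id_apply, mb_smul_right]; ring

theorem reflLin_emb (B X : Mink) : reflLin B (emb X) = emb (B - X) := by
  simp [reflLin, emb, mq_sub]; ring

theorem conf_reflLin (B : Mink) : Conf (reflLin B) 1 := by
  refine ⟨one_ne_zero, fun u v => ?_⟩
  simp only [reflLin, vb, LinearMap.coe_mk, AddHom.coe_mk, mb_sub_left, mb_sub_right, mb_smul_left,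
    mb_smul_right, mb_self, mb_comm u.2.1 B]
  ring

/-- The inversion `X ↦ (mq X)⁻¹ • X`, linearized. -/
def swapLin : Vec →ₗ[ℝ] Vec where
  toFun v := (v.2.2, v.2.1, v.1)
  map_add' _ _ := rfl
  map_smul' _ _ := rfl

theorem conf_swapLin : Conf swapLin 1 :=
  ⟨one_ne_zero, fun u v => by simp only [swapLin, vb, LinearMap.coe_mk, AddHom.coe_mk]; ring⟩

/-- The conformal inversion. -/
def inversion (X : Mink) : Mink := (mq X)⁻¹ • X

theorem swapLin_emb {X : Mink} (h : mq X ≠ 0) : swapLin (emb X) = mq X • emb (inversion X) := by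
  refine Prod.ext (by simp [swapLin, emb]) (Prod.ext ?_ ?_)
  · simp [swapLin, emb, inversion, smul_smul, h]
  · simp only [swapLin, emb, inversion, mq_smul, LinearMap.coe_mk, AddHom.coe_mk, Prod.smul_snd,
      smul_eq_mul]
    field_simp

theorem Fut.inversion {X : Mink} (h : Fut X) : Fut (inversion X) := h.smul (inv_pos.2 h.2)

theorem inversion_inversion {X : Mink} (h : mq X ≠ 0) : inversion (inversion X) = X := by
  rw [inversion, inversion, mq_smul, smul_smul]
  rw [show ((mq X)⁻¹ ^ 2 * mq X)⁻¹ * (mq X)⁻¹ = 1 by field_simp, one_smul]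

theorem Fut.inversion_sub {X Y : Mink} (hX : Fut X) (hY : Fut Y) (h : Fut (Y - X)) :
    Fut (Coherency.inversion X - Coherency.inversion Y) := by
  have hx := hX.2
  have hy := hY.2
  have hq : 0 < mq (Coherency.inversion X - Coherency.inversion Y) := by
    have : mq (Coherency.inversion X - Coherency.inversion Y) = mq (Y - X) / (mq X * mq Y) := by
      rw [Coherency.inversion, Coherency.inversion, mq_sub, mq_sub, mq_smul, mq_smul, mb_smul_left,
        mb_smul_right, mb_comm Y X]
      field_simp
    rw [this]; exact div_pos h.2 (mul_pos hx hy)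
  refine (Caus.of_mb_pos hY hq.le ?_).fut hq
  have h1 := hX.mb_pos h.caus h.ne_zero
  rw [mb_sub_right, mb_self] at h1
  rw [Coherency.inversion, Coherency.inversion, mb_sub_right, mb_smul_right, mb_smul_right, mb_self,
    mb_comm Y X, inv_mul_eq_div, inv_mul_eq_div, sub_nonneg, mul_div_assoc, div_self hy.ne',
    le_div_iff₀ hx]
  linarith

theorem isUpper_fut (A : Mink) : IsUpperM {X | Fut (X - A)} := fun X hX Y hXY => by
  have h : Fut (Y - X + (X - A)) := hXY.add_fut hX
  rwa [sub_add_sub_cancel] at h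

theorem isOpen_fut_sub (A : Mink) : IsOpen {X | Fut (X - A)} :=
  isOpen_fut.preimage (f := fun X => X - A) (by fun_prop)

theorem exists_fut : ∃ E : Mink, Fut E := ⟨![1, 0, 0, 1], by simp [Fut, mq]⟩

theorem nonempty_fut (A : Mink) : {X | Fut (X - A)}.Nonempty := by
  obtain ⟨E, hE⟩ := exists_fut
  exact ⟨A + E, by rw [Set.mem_ofPred_eq, add_sub_cancel_left]; exact hE⟩

theorem chart_id (𝒰 : Set Mink) : Chart 𝒰 𝒰 id id LinearMap.id where
  maps _ h := h
  maps' _ h := h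
  left _ _ := rfl
  right _ _ := rfl
  conf := ⟨1, one_ne_zero, fun u v => by simp⟩
  lin X _ := ⟨1, one_ne_zero, by simp⟩

theorem chart_refl (A : Mink) :
    Chart {X | Fut (A - X)} {X | Fut (X - 0)} (A - ·) (A - ·) (reflLin A) where
  maps X h := by simpa using h
  maps' X h := by simpa using h
  left X _ := by simp
  right X _ := by simp
  conf := ⟨1, conf_reflLin A⟩
  lin X _ := ⟨1, one_ne_zero, by rw [reflLin_emb, one_smul]⟩

theorem chart_inversion {A B : Mink} (h : Fut (B - A)) :
    Chart {X | Fut (X - A) ∧ Fut (B - X)} {W | Fut (W - inversion (B - A))}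
      (fun X => inversion (B - X)) (fun W => B - inversion W) (swapLin ∘ₗ reflLin B) where
  maps X hX := hX.2.inversion_sub h (by simpa using hX.1)
  maps' W hW := by
    have h1 : Fut W := by simpa using hW.caus.add_fut h.inversion
    refine ⟨?_, by simpa using h1.inversion⟩
    have h2 := h.inversion.inversion_sub h1 hW
    rw [inversion_inversion h.2.ne'] at h2
    rwa [sub_right_comm]
  left X hX := by simp only [inversion_inversion hX.2.2.ne', sub_sub_cancel]
  right W hW := by
    have h1 : Fut W := by simpa using hW.caus.add_fut h.inversion
    simp only [sub_sub_cancel, inversion_inversion h1.2.ne']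
  conf := ⟨_, conf_swapLin.comp (conf_reflLin B)⟩
  lin X hX := by
    have h0 := hX.2.2.ne'
    refine ⟨(mq (B - X))⁻¹, inv_ne_zero h0, ?_⟩
    rw [LinearMap.comp_apply, reflLin_emb, swapLin_emb h0, smul_smul, inv_mul_cancel₀ h0, one_smul]

end Coherency

namespace Coherency

/-! ### Two by two matrices -/

theorem rank_le_one_iff (A : Mat2) : A.rank ≤ 1 ↔ A.det = 0 := by
  constructor
  · intro h
    by_contra h0
    rw [rank_of_det_ne_zero h0, Fintype.card_fin] at h
    omega
  · intro h
    obtain ⟨v, hv, e⟩ := exists_mulVec_eq_zero_iff.2 h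
    have h1 := A.mulVecLin.finrank_range_add_finrank_ker
    have h2 : 0 < Module.finrank ℂ (LinearMap.ker A.mulVecLin) :=
      Module.finrank_pos_iff_exists_ne_zero.2 ⟨⟨v, e⟩, fun h => hv (congrArg Subtype.val h)⟩
    rw [Module.finrank_fin_fun] at h1
    rw [Matrix.rank]
    omega

/-- The hermitian matrix with given real coordinates. -/
def herm (X : Mink) : Mat2 := !![(X 0 : ℂ), ⟨X 1, X 2⟩; ⟨X 1, -X 2⟩, (X 3 : ℂ)]

theorem herm_sub (X Y : Mink) : herm (X - Y) = herm X - herm Y := by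
  ext i j; fin_cases i <;> fin_cases j <;> apply Complex.ext <;> (simp [herm]; try ring)

theorem det_herm (X : Mink) : (herm X).det = (mq X : ℂ) := by
  rw [herm, det_fin_two_of]
  apply Complex.ext
  · rw [Complex.ofReal_re]; simp [mq]; ring
  · rw [Complex.ofReal_im]; simp; ring

theorem isHermitian_herm (X : Mink) : (herm X).IsHermitian := by
  ext i j; fin_cases i <;> fin_cases j <;> apply Complex.ext <;> simp [herm]

theorem exists_herm {A : Mat2} (h : A.IsHermitian) : ∃ X, herm X = A := by
  refine ⟨![(A 0 0).re, (A 0 1).re, (A 0 1).im, (A 1 1).re], ?_⟩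
  have h0 := h.apply 0 0
  have h1 := h.apply 1 0
  have h2 := h.apply 1 1
  rw [Complex.ext_iff] at h0 h1 h2
  simp only [Complex.star_def, Complex.conj_re, Complex.conj_im] at h0 h1 h2
  ext i j; fin_cases i <;> fin_cases j <;> apply Complex.ext <;> simp [herm] <;> linarith [h0.2, h1.1, h1.2, h2.2]

theorem coherent_herm (X Y : Mink) : Coherent (herm X) (herm Y) ↔ mq (X - Y) = 0 := by
  rw [Coherent, rank_le_one_iff, ← herm_sub, det_herm, Complex.ofReal_eq_zero]

theorem posDef_herm (X : Mink) : (herm X).PosDef ↔ Fut X := by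
  constructor
  · intro h
    have h0 := h.diag_pos (i := 0)
    have h1 := h.det_pos
    rw [det_herm] at h1
    exact ⟨by simpa [herm] using h0, by simpa using h1⟩
  · rintro ⟨h0, hq⟩
    refine PosDef.of_dotProduct_mulVec_pos (isHermitian_herm X) fun v hv => ?_
    have e : star v ⬝ᵥ herm X *ᵥ v = (((((X 0 * (v 0).re + X 1 * (v 1).re - X 2 * (v 1).im) ^ 2 +
        (X 0 * (v 0).im + X 1 * (v 1).im + X 2 * (v 1).re) ^ 2) +
        mq X * ((v 1).re ^ 2 + (v 1).im ^ 2)) / X 0 : ℝ) : ℂ) := by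
      simp only [dotProduct, mulVec, Fin.sum_univ_two, herm]
      apply Complex.ext
      · rw [Complex.ofReal_re]; simp [mq]; field_simp; ring
      · rw [Complex.ofReal_im]; simp; ring
    rw [e, Complex.zero_lt_real]
    refine div_pos ?_ h0
    by_cases h1 : v 1 = 0
    · have h2 : v 0 ≠ 0 := fun h2 => hv (by ext i; fin_cases i <;> assumption)
      have : 0 < Complex.normSq (v 0) := Complex.normSq_pos.2 h2
      rw [Complex.normSq_apply] at this
      rw [h1]
      simp only [Complex.zero_re, Complex.zero_im]
      have h3 := mul_pos (mul_pos h0 h0) this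
      nlinarith
    · have : 0 < Complex.normSq (v 1) := Complex.normSq_pos.2 h1
      rw [Complex.normSq_apply] at this
      have : 0 < (v 1).re ^ 2 + (v 1).im ^ 2 := by nlinarith
      positivity

end Coherency

namespace Coherency

/-! ### Unitary matrices as isotropic lines -/

/-- A phase times a matrix of quaternion type. -/
def umat (δ a b : ℂ) : Mat2 := !![δ * a, δ * b; -(δ * star b), δ * star a]

/-- The vector attached to `umat δ a b`. -/
def uvec (δ a b : ℂ) : Vec :=
  (δ.re - a.re, ![δ.im - a.im, -b.im, b.re, δ.im + a.im], -δ.re - a.re)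

/-- The parameters for which `umat` is unitary. -/
def UNorm (δ a b : ℂ) : Prop := δ * star δ = 1 ∧ a * star a + b * star b = 1

theorem ofReal_vb_uvec (δ a b δ' a' b' : ℂ) : (vb (uvec δ a b) (uvec δ' a' b') : ℂ) =
    δ * star δ' + δ' * star δ - (a * star a' + a' * star a + b * star b' + b' * star b) := by
  apply Complex.ext
  · rw [Complex.ofReal_re]; simp [vb, mb, uvec]; ring
  · rw [Complex.ofReal_im]; simp; ring

theorem vq_uvec {δ a b : ℂ} (h : UNorm δ a b) : vq (uvec δ a b) = 0 := by
  have h1 := ofReal_vb_uvec δ a b δ a b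
  have h2 : (vb (uvec δ a b) (uvec δ a b) : ℂ) = 0 := by
    rw [h1]; linear_combination 2 * h.1 - 2 * h.2
  rw [Complex.ofReal_eq_zero, vb_self] at h2
  linarith

theorem uvec_smul (c : ℝ) (δ a b : ℂ) : uvec (c * δ) (c * a) (c * b) = c • uvec δ a b := by
  apply vec_ext <;> simp [uvec] <;> ring

theorem uvec_coords {δ a b δ' a' b' : ℂ} {c : ℝ} (h : uvec δ a b = c • uvec δ' a' b') :
    δ = c * δ' ∧ a = c * a' ∧ b = c * b' := by
  have h1 := congrArg Prod.fst h
  have h2 := congrArg (fun v : Vec => v.2.2) h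
  have h3 := fun i => congrArg (fun v : Vec => v.2.1 i) h
  have e0 := h3 0
  have e1 := h3 1
  have e2 := h3 2
  have e3 := h3 3
  simp [uvec] at h1 h2 e0 e1 e2 e3
  refine ⟨?_, ?_, ?_⟩ <;> apply Complex.ext <;> simp <;> linarith

theorem exists_uvec (v : Vec) : ∃ δ a b, v = uvec δ a b := by
  refine ⟨⟨(v.1 - v.2.2) / 2, (v.2.1 0 + v.2.1 3) / 2⟩, ⟨-(v.1 + v.2.2) / 2, (v.2.1 3 - v.2.1 0) / 2⟩,
    ⟨v.2.1 2, -v.2.1 1⟩, ?_⟩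
  apply vec_ext <;> simp [uvec] <;> ring

theorem exists_uvec_normalized {v : Vec} (h0 : v ≠ 0) (hv : vq v = 0) :
    ∃ δ a b, UNorm δ a b ∧ ∃ c : ℝ, c ≠ 0 ∧ uvec δ a b = c • v := by
  obtain ⟨δ, a, b, rfl⟩ := exists_uvec v
  have h1 := ofReal_vb_uvec δ a b δ a b
  rw [vb_self, hv, mul_zero, Complex.ofReal_zero] at h1
  have hδ : δ ≠ 0 := by
    rintro rfl
    refine h0 (eq_zero_of_isotropic hv ?_ ?_) <;> simp [uvec]
  have hn : ‖δ‖ ≠ 0 := norm_ne_zero_iff.2 hδ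
  have hn' : (‖δ‖ : ℂ) ≠ 0 := Complex.ofReal_ne_zero.2 hn
  have e : δ * star δ = (‖δ‖ : ℂ) ^ 2 := Complex.mul_conj' δ
  have hs : star (((‖δ‖⁻¹ : ℝ) : ℂ)) = ((‖δ‖⁻¹ : ℝ) : ℂ) := Complex.conj_ofReal _
  have hi : (((‖δ‖⁻¹ : ℝ) : ℂ)) ^ 2 * (‖δ‖ : ℂ) ^ 2 = 1 := by
    rw [Complex.ofReal_inv]; field_simp
  refine ⟨_, _, _, ⟨?_, ?_⟩, ‖δ‖⁻¹, inv_ne_zero hn, uvec_smul _ _ _ _⟩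
  · rw [star_mul', hs]; linear_combination hi + (((‖δ‖⁻¹ : ℝ) : ℂ)) ^ 2 * e
  · rw [star_mul', star_mul', hs]
    linear_combination hi + (((‖δ‖⁻¹ : ℝ) : ℂ)) ^ 2 * (e + 2⁻¹ * h1)

theorem umat_mem {δ a b : ℂ} (h : UNorm δ a b) : umat δ a b ∈ unitaryGroup (Fin 2) ℂ := by
  obtain ⟨h1, h2⟩ := h
  rw [mem_unitaryGroup_iff]
  ext i j
  fin_cases i <;> fin_cases j <;> simp [umat, mul_apply, star_apply, Fin.sum_univ_two] <;>
    simp only [Complex.star_def] at h1 h2 ⊢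
  · linear_combination h1 + δ * (starRingEnd ℂ) δ * h2
  · ring
  · ring
  · linear_combination h1 + δ * (starRingEnd ℂ) δ * h2

theorem exists_umat (U : U2) : ∃ δ a b, UNorm δ a b ∧ (U : Mat2) = umat δ a b := by
  obtain ⟨U, hU⟩ := U
  have h1 : U * star U = 1 := mem_unitaryGroup_iff.1 hU
  have had : U.adjugate = U.det • star U := by
    calc U.adjugate = U.adjugate * (U * star U) := by rw [h1, mul_one]
      _ = _ := by rw [← mul_assoc, adjugate_mul, smul_mul_assoc, one_mul]
  have hd : U.det * star U.det = 1 := by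
    have := congrArg det h1
    rwa [det_mul, star_eq_conjTranspose, det_conjTranspose, det_one] at this
  obtain ⟨δ, hδ⟩ := IsAlgClosed.exists_pow_nat_eq U.det (n := 2) (by norm_num)
  have hδ1 : δ * star δ = 1 := by
    rw [← hδ, star_pow, ← mul_pow] at hd
    have e : δ * star δ = (‖δ‖ : ℂ) ^ 2 := Complex.mul_conj' δ
    rw [e] at hd ⊢
    norm_cast at hd ⊢
    rw [← pow_mul] at hd
    rw [(pow_eq_one_iff_of_nonneg (norm_nonneg δ) (by norm_num)).1 hd, one_pow]
  have e00 := congrFun (congrFun h1 0) 0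
  have a00 := congrFun (congrFun had 0) 0
  have a10 := congrFun (congrFun had 1) 0
  rw [adjugate_fin_two] at a00 a10
  simp [mul_apply, star_apply, Fin.sum_univ_two] at e00 a00 a10
  refine ⟨δ, star δ * U 0 0, star δ * U 0 1, ⟨hδ1, ?_⟩, ?_⟩
  · simp only [star_mul', star_star]
    simp only [Complex.star_def] at *
    linear_combination e00 * δ * (starRingEnd ℂ) δ + hδ1
  · ext i j
    fin_cases i <;> fin_cases j <;> simp [umat] <;> simp only [Complex.star_def] at *
    · linear_combination -U 0 0 * hδ1
    · linear_combination -U 0 1 * hδ1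
    · linear_combination -a10 + (starRingEnd ℂ) (U 0 1) * hδ
    · linear_combination a00 - (starRingEnd ℂ) (U 0 0) * hδ

theorem det_umat_sub {δ a b δ' a' b' : ℂ} (h : UNorm δ a b) (h' : UNorm δ' a' b') :
    (umat δ a b - umat δ' a' b').det = δ * δ' * (vb (uvec δ a b) (uvec δ' a' b') : ℂ) := by
  rw [ofReal_vb_uvec, det_fin_two]
  simp only [umat, Matrix.sub_apply, of_apply, cons_val', cons_val_zero, cons_val_one, cons_val_fin_one]
  linear_combination δ ^ 2 * h.2 + δ' ^ 2 * h'.2 - δ' ^ 2 * h.1 - δ ^ 2 * h'.1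

theorem UNorm.ne_zero {δ a b : ℂ} (h : UNorm δ a b) : δ ≠ 0 := by
  rintro rfl; simpa using h.1

theorem UNorm.smul_umat {δ a b δ' a' b' : ℂ} {c : ℝ} (h : UNorm δ a b) (h' : UNorm δ' a' b')
    (e : uvec δ a b = c • uvec δ' a' b') : umat δ a b = umat δ' a' b' := by
  obtain ⟨rfl, rfl, rfl⟩ := uvec_coords e
  have hs : star (c : ℂ) = c := Complex.conj_ofReal _
  have hc : (c : ℂ) * c = 1 := by
    have := h.1
    rw [star_mul', hs] at this
    linear_combination this - (c : ℂ) * c * h'.1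
  ext i j
  fin_cases i <;> fin_cases j <;> simp [umat]
  · linear_combination δ' * a' * hc
  · linear_combination δ' * b' * hc
  · linear_combination δ' * (starRingEnd ℂ) b' * hc
  · linear_combination δ' * (starRingEnd ℂ) a' * hc

theorem UNorm.uvec_of_umat {δ a b δ' a' b' : ℂ} (h : UNorm δ a b) (h' : UNorm δ' a' b')
    (e : umat δ a b = umat δ' a' b') : ∃ c : ℝ, c ≠ 0 ∧ uvec δ a b = c • uvec δ' a' b' := by
  have e0 : δ * a = δ' * a' := by simpa [umat] using congrFun (congrFun e 0) 0
  have e1 : δ * b = δ' * b' := by simpa [umat] using congrFun (congrFun e 0) 1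
  have e2 : δ * star b = δ' * star b' := by simpa [umat] using congrFun (congrFun e 1) 0
  have e3 : δ * star a = δ' * star a' := by simpa [umat] using congrFun (congrFun e 1) 1
  have hsq : δ ^ 2 = δ' ^ 2 := by
    linear_combination e0 * (δ * star a) + δ' * a' * e3 + e1 * (δ * star b) + δ' * b' * e2
      - δ ^ 2 * h.2 + δ' ^ 2 * h'.2
  have hδ := h'.ne_zero
  rcases sq_eq_sq_iff_eq_or_eq_neg.1 hsq with rfl | rfl
  · refine ⟨1, one_ne_zero, ?_⟩
    rw [one_smul, mul_left_cancel₀ hδ e0, mul_left_cancel₀ hδ e1]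
  · refine ⟨-1, by norm_num, ?_⟩
    have ha : a = -a' := mul_left_cancel₀ hδ (by linear_combination -e0)
    have hb : b = -b' := mul_left_cancel₀ hδ (by linear_combination -e1)
    rw [← uvec_smul, ha, hb]
    simp

/-- The isotropic vector attached to a unitary matrix. -/
def uray (U : U2) : Vec :=
  uvec (exists_umat U).choose (exists_umat U).choose_spec.choose
    (exists_umat U).choose_spec.choose_spec.choose

theorem exists_uray (U : U2) : ∃ δ a b, UNorm δ a b ∧ (U : Mat2) = umat δ a b ∧ uray U = uvec δ a b :=
  have h := (exists_umat U).choose_spec.choose_spec.choose_spec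
  ⟨_, _, _, h.1, h.2, rfl⟩

theorem uray_of_eq {U : U2} {δ a b : ℂ} (h : UNorm δ a b) (e : (U : Mat2) = umat δ a b) :
    ∃ c : ℝ, c ≠ 0 ∧ uray U = c • uvec δ a b := by
  obtain ⟨δ', a', b', h', e', hr⟩ := exists_uray U
  rw [hr]
  exact h'.uvec_of_umat h (e'.symm.trans e)

theorem model_uray : Model CoherentU uray where
  ne_zero U h0 := by
    obtain ⟨δ, a, b, h, -, hr⟩ := exists_uray U
    have := (uvec_coords (c := 0) (δ' := 0) (a' := 0) (b' := 0) (by rw [← hr, h0, zero_smul])).1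
    exact h.ne_zero (by simpa using this)
  null U := by
    obtain ⟨δ, a, b, h, -, hr⟩ := exists_uray U
    rw [hr, vq_uvec h]
  coh U V := by
    obtain ⟨δ, a, b, h, e, hr⟩ := exists_uray U
    obtain ⟨δ', a', b', h', e', hr'⟩ := exists_uray V
    rw [CoherentU, rank_le_one_iff, e, e', det_umat_sub h h', hr, hr']
    simp [h.ne_zero, h'.ne_zero]
  inj U V c hc := by
    obtain ⟨δ, a, b, h, e, hr⟩ := exists_uray U
    obtain ⟨δ', a', b', h', e', hr'⟩ := exists_uray V
    rw [hr, hr'] at hc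
    exact Subtype.ext (by rw [e, e', h.smul_umat h' hc])
  surj v h0 hv := by
    obtain ⟨δ, a, b, h, c, hc, e⟩ := exists_uvec_normalized h0 hv
    obtain ⟨d, hd, e'⟩ := uray_of_eq (U := ⟨_, umat_mem h⟩) h rfl
    exact ⟨_, d * c, mul_ne_zero hd hc, by rw [e', e, smul_smul]⟩

/-- The Cayley transform of a hermitian matrix corresponds to its conformal embedding. -/
theorem uray_cayley (X : Mink) : ∃ c : ℝ, c ≠ 0 ∧ uray (cayley (herm X)) = c • emb X := by
  obtain ⟨δ, a, b, h, c, hc, e⟩ := exists_uvec_normalized (emb_ne_zero X) (vq_emb X)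
  have hdet : (herm X + Complex.I • (1 : Mat2)).det ≠ 0 := by
    rw [det_fin_two]
    intro h0
    have hr := congrArg Complex.re h0
    have hi := congrArg Complex.im h0
    simp [herm] at hr hi
    nlinarith [sq_nonneg (X 0), sq_nonneg (X 3), sq_nonneg (X 1), sq_nonneg (X 2)]
  have hmat : cayleyMat (herm X) = umat δ a b := by
    have key : umat δ a b * (herm X + Complex.I • (1 : Mat2)) = herm X - Complex.I • (1 : Mat2) := by
      have he : emb X = uvec ⟨(1 - mq X) / 2, (X 0 + X 3) / 2⟩ ⟨-(1 + mq X) / 2, (X 3 - X 0) / 2⟩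
          ⟨X 2, -X 1⟩ := by
        apply vec_ext <;> simp [uvec, emb] <;> ring
      rw [he] at e
      obtain ⟨hδ, ha, hb⟩ := uvec_coords e
      have k00 : a * (X 0 + Complex.I) + b * ⟨X 1, -X 2⟩ = star δ * (X 0 - Complex.I) := by
        rw [hδ, ha, hb]; apply Complex.ext <;> simp [mq] <;> ring
      have k01 : a * ⟨X 1, X 2⟩ + b * (X 3 + Complex.I) = star δ * ⟨X 1, X 2⟩ := by
        rw [hδ, ha, hb]; apply Complex.ext <;> simp [mq] <;> ring
      have k10 : -star b * (X 0 + Complex.I) + star a * ⟨X 1, -X 2⟩ = star δ * ⟨X 1, -X 2⟩ := by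
        rw [hδ, ha, hb]; apply Complex.ext <;> simp [mq] <;> ring
      have k11 : -star b * ⟨X 1, X 2⟩ + star a * (X 3 + Complex.I) = star δ * (X 3 - Complex.I) := by
        rw [hδ, ha, hb]; apply Complex.ext <;> simp [mq] <;> ring
      have h1 := h.1
      simp only [Complex.star_def] at h1 k00 k01 k10 k11
      ext i j
      fin_cases i <;> fin_cases j <;> simp [umat, herm, mul_apply, Fin.sum_univ_two]
      · linear_combination δ * k00 + (X 0 - Complex.I) * h1
      · linear_combination δ * k01 + ⟨X 1, X 2⟩ * h1
      · linear_combination δ * k10 + ⟨X 1, -X 2⟩ * h1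
      · linear_combination δ * k11 + (X 3 - Complex.I) * h1
    rw [cayleyMat, ← key, mul_nonsing_inv_cancel_right _ _ (isUnit_iff_ne_zero.2 hdet)]
  have hmem : cayleyMat (herm X) ∈ unitaryGroup (Fin 2) ℂ := hmat ▸ umat_mem h
  obtain ⟨d, hd, e'⟩ := uray_of_eq (U := cayley (herm X)) h (by rw [cayley, dif_pos hmem]; exact hmat)
  exact ⟨d * c, mul_ne_zero hd hc, by rw [e', e, smul_smul]⟩

end Coherency

namespace Coherency

/-! ### Coherency preservers of hermitian matrices -/

theorem isLine_common {U V : U2} (hne : U ≠ V) (h : CoherentU U V) :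
    IsLine {W | CoherentU W U ∧ CoherentU W V} := by
  have G := model_uray.isGQ
  refine ⟨fun W hW W' hW' => G.tri hne h hW.1 hW.2 hW'.1 hW'.2, fun m hm hc => ?_⟩
  refine Set.Subset.antisymm (fun W hW => ?_) hm
  exact ⟨hc W hW U (hm ⟨G.refl U, h⟩), hc W hW V (hm ⟨G.symm h, G.refl V⟩)⟩

theorem coherentU_cayley (X Y : Mink) :
    CoherentU (cayley (herm X)) (cayley (herm Y)) ↔ mq (X - Y) = 0 := by
  obtain ⟨c, hc, e⟩ := uray_cayley X
  obtain ⟨d, hd, e'⟩ := uray_cayley Y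
  rw [model_uray.coh, e, e', vb_smul_left, vb_smul_right, vb_emb]
  simp [hc, hd]

theorem cayley_injective {X Y : Mink} (h : cayley (herm X) = cayley (herm Y)) : X = Y := by
  obtain ⟨c, hc, e⟩ := uray_cayley X
  obtain ⟨d, hd, e'⟩ := uray_cayley Y
  rw [h, e'] at e
  have h1 : d = c := by simpa [emb] using congrArg Prod.fst e
  rw [h1] at e
  exact (congrArg (fun v : Vec => v.2.1) (smul_right_injective Vec hc e)).symm

theorem standard_or_degenerate_image {𝒲 𝒱 : Set Mink} {θ ψ : Mink → Mink} {h : Vec →ₗ[ℝ] Vec}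
    (C : Chart 𝒲 𝒱 θ ψ h) (hU : IsUpperM 𝒱) (hO : IsOpen 𝒱) (hne : 𝒱.Nonempty) {φ : Mat2 → U2}
    (hφ : ∀ X ∈ herm '' 𝒲, ∀ Y ∈ herm '' 𝒲, Coherent X Y → CoherentU (φ X) (φ Y)) :
    (∃ Φ : U2 → U2, IsAut Φ ∧ ∀ X ∈ herm '' 𝒲, φ X = Φ (cayley X)) ∨
    (∃ A₀ ∈ herm '' 𝒲, ∃ B₀ ∈ φ '' (herm '' 𝒲), ∀ X ∈ herm '' 𝒲, X ≠ A₀ → CoherentU (φ X) B₀) ∨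
    (∃ ℓ ℓ' : Set U2, IsLine ℓ ∧ IsLine ℓ' ∧ ∀ X ∈ herm '' 𝒲, cayley X ∉ ℓ → φ X ∈ ℓ') := by
  have hφ' : Pres CoherentU (φ ∘ herm) 𝒲 := fun X hX Y hY hXY =>
    hφ _ ⟨X, hX, rfl⟩ _ ⟨Y, hY, rfl⟩ ((coherent_herm X Y).2 hXY)
  rcases C.standard_or_degenerate model_uray hU hO hne hφ' (κ := cayley ∘ herm) uray_cayley with
    ⟨Φ, hΦ, e⟩ | ⟨A, hA, B, hB, hd⟩ | ⟨P, hP, Q, hQ, hPQ, hc, a, b, hab, hr, hd⟩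
  · refine Or.inl ⟨Φ, hΦ, ?_⟩
    rintro _ ⟨X, hX, rfl⟩
    exact e X hX
  · refine Or.inr (Or.inl ⟨_, ⟨A, hA, rfl⟩, _, ⟨_, ⟨B, hB, rfl⟩, rfl⟩, ?_⟩)
    rintro _ ⟨X, hX, rfl⟩ hXA
    exact hd X hX fun e => hXA (by rw [e])
  · refine Or.inr (Or.inr ⟨_, _, isLine_common (fun e => hPQ (cayley_injective e))
      ((coherentU_cayley P Q).2 hc), isLine_common hab hr, ?_⟩)
    rintro _ ⟨X, hX, rfl⟩ hXl
    refine hd X hX fun h => hXl ?_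
    exact ⟨(coherentU_cayley X P).2 h.1, (coherentU_cayley X Q).2 h.2⟩

theorem eq_image_herm {𝒰 : Set Mat2} {𝒲 : Set Mink} (h : ∀ X ∈ 𝒰, X.IsHermitian)
    (hm : ∀ X, herm X ∈ 𝒰 ↔ X ∈ 𝒲) : 𝒰 = herm '' 𝒲 := by
  ext A
  constructor
  · intro hA
    obtain ⟨X, rfl⟩ := exists_herm (h A hA)
    exact ⟨X, (hm X).1 hA, rfl⟩
  · rintro ⟨X, hX, rfl⟩
    exact (hm X).2 hX

end Coherency

open Coherency in
/-- A coherency preserver on an open interval of `H₂` is either standard or degenerate. -/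
theorem coherency_preserver_on_open_interval
    (𝒰 : Set Mat2)
    (h𝒰 : (∃ A B : Mat2, A.IsHermitian ∧ (B - A).PosDef ∧
            𝒰 = {X | (X - A).PosDef ∧ (B - X).PosDef}) ∨
          (∃ A : Mat2, A.IsHermitian ∧ 𝒰 = {X | (X - A).PosDef}) ∨
          (∃ A : Mat2, A.IsHermitian ∧ 𝒰 = {X | (A - X).PosDef}) ∨
          𝒰 = H2set)
    (φ : Mat2 → U2)
    (hφ : ∀ X ∈ 𝒰, ∀ Y ∈ 𝒰, Coherent X Y → CoherentU (φ X) (φ Y)) :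
    (∃ Φ : U2 → U2, IsAut Φ ∧ ∀ X ∈ 𝒰, φ X = Φ (cayley X)) ∨
    (∃ A₀ ∈ 𝒰, ∃ B₀ ∈ φ '' 𝒰, ∀ X ∈ 𝒰, X ≠ A₀ → CoherentU (φ X) B₀) ∨
    (∃ ℓ ℓ' : Set U2, IsLine ℓ ∧ IsLine ℓ' ∧ ∀ X ∈ 𝒰, cayley X ∉ ℓ → φ X ∈ ℓ') := by
  have above : ∀ {A X : Mat2}, A.IsHermitian → (X - A).PosDef → X.IsHermitian :=
    fun {A X} hA h => by simpa using h.isHermitian.add hA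
  have below : ∀ {A X : Mat2}, A.IsHermitian → (A - X).PosDef → X.IsHermitian :=
    fun {A X} hA h => by simpa using hA.sub h.isHermitian
  rcases h𝒰 with ⟨A, B, hA, hAB, h⟩ | ⟨A, hA, h⟩ | ⟨A, hA, h⟩ | h
  · obtain ⟨B, rfl⟩ := exists_herm (above hA hAB)
    obtain ⟨A, rfl⟩ := exists_herm hA
    rw [← herm_sub, posDef_herm] at hAB
    have e : 𝒰 = herm '' {X | Fut (X - A) ∧ Fut (B - X)} := by
      refine eq_image_herm (fun X hX => ?_) fun X => ?_
      · rw [h] at hX; exact above hA hX.1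
      · rw [h, Set.mem_ofPred_eq, ← herm_sub, ← herm_sub, posDef_herm, posDef_herm]; rfl
    subst e
    exact standard_or_degenerate_image (chart_inversion hAB) (isUpper_fut _) (isOpen_fut_sub _)
      (nonempty_fut _) hφ
  · obtain ⟨A, rfl⟩ := exists_herm hA
    have e : 𝒰 = herm '' {X | Fut (X - A)} := by
      refine eq_image_herm (fun X hX => ?_) fun X => ?_
      · rw [h] at hX; exact above hA hX
      · rw [h, Set.mem_ofPred_eq, ← herm_sub, posDef_herm]; rfl
    subst e
    exact standard_or_degenerate_image (chart_id _) (isUpper_fut _) (isOpen_fut_sub _)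
      (nonempty_fut _) hφ
  · obtain ⟨A, rfl⟩ := exists_herm hA
    have e : 𝒰 = herm '' {X | Fut (A - X)} := by
      refine eq_image_herm (fun X hX => ?_) fun X => ?_
      · rw [h] at hX; exact below hA hX
      · rw [h, Set.mem_ofPred_eq, ← herm_sub, posDef_herm]; rfl
    subst e
    exact standard_or_degenerate_image (chart_refl A) (isUpper_fut _) (isOpen_fut_sub _)
      (nonempty_fut _) hφ
  · have e : 𝒰 = herm '' Set.univ := by
      refine eq_image_herm (fun X hX => ?_) fun X => ?_
      · rw [h] at hX; exact hX
      · rw [h]; exact iff_of_true (isHermitian_herm X) trivial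
    subst e
    exact standard_or_degenerate_image (chart_id _) (fun _ _ _ _ => trivial) isOpen_univ
      Set.univ_nonempty hφ
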